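/- There exists a real non-separable Banach space X such that every bounded linear operator T on X is of the form T = λ·I + S for some λ ∈ ℝ, where S is strictly singular and has separable range. -/

import Mathlib

open Filter Topology

/-- The J-set of `x` under the operator `T`. -/
def JSet {𝕜 X : Type*} [NontriviallyNormedField 𝕜] [NormedAddCommGroup X] [NormedSpace 𝕜 X]
    (T : X →L[𝕜] X) (x : X) : Set X :=
  {y | ∃ k : ℕ → ℕ, StrictMono k ∧ ∃ u : ℕ → X,
    Tendsto u atTop (𝓝 x) ∧ Tendsto (fun n => (T ^ k n) (u n)) atTop (𝓝 y)}

/-- A bounded operator is strictly singular if it is bounded below by no positive constant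
on any infinite-dimensional subspace. -/
def StrictlySingular {𝕜 X : Type*} [NontriviallyNormedField 𝕜] [NormedAddCommGroup X]
    [NormedSpace 𝕜 X] (S : X →L[𝕜] X) : Prop :=
  ∀ M : Submodule 𝕜 X, ¬ FiniteDimensional 𝕜 M →
    ¬ ∃ c : ℝ, 0 < c ∧ ∀ x ∈ M, c * ‖x‖ ≤ ‖S x‖

namespace SSX

structure IsAlg (𝔅 : Set (Set ℕ)) : Prop where
  univ : Set.univ ∈ 𝔅
  compl : ∀ B ∈ 𝔅, Bᶜ ∈ 𝔅
  inter : ∀ B ∈ 𝔅, ∀ C ∈ 𝔅, B ∩ C ∈ 𝔅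

namespace IsAlg
variable {𝔅 : Set (Set ℕ)}

theorem empty (h : IsAlg 𝔅) : ∅ ∈ 𝔅 := by
  have := h.compl _ h.univ
  simpa using this

theorem union (h : IsAlg 𝔅) {B C : Set ℕ} (hB : B ∈ 𝔅) (hC : C ∈ 𝔅) : B ∪ C ∈ 𝔅 := by
  have := h.compl _ (h.inter _ (h.compl _ hB) _ (h.compl _ hC))
  simpa [Set.compl_inter] using this

theorem diff (h : IsAlg 𝔅) {B C : Set ℕ} (hB : B ∈ 𝔅) (hC : C ∈ 𝔅) : B \ C ∈ 𝔅 :=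
  h.inter _ hB _ (h.compl _ hC)

theorem biUnion (h : IsAlg 𝔅) {ι : Type*} (A : Set ι) (hA : A.Finite) (B : ι → Set ℕ)
    (hB : ∀ k ∈ A, B k ∈ 𝔅) : (⋃ k ∈ A, B k) ∈ 𝔅 := by
  induction A, hA using Set.Finite.induction_on with
  | empty => simpa using h.empty
  | insert _ _ ih =>
    rw [Set.biUnion_insert]
    exact h.union (hB _ (Set.mem_insert _ _)) (ih fun k hk => hB k (Set.mem_insert_of_mem _ hk))

end IsAlg

inductive Gen (S : Set (Set ℕ)) : Set ℕ → Prop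
  | base (B) : B ∈ S → Gen S B
  | univ : Gen S Set.univ
  | compl (B) : Gen S B → Gen S Bᶜ
  | inter (B C) : Gen S B → Gen S C → Gen S (B ∩ C)

theorem isAlg_gen (S : Set (Set ℕ)) : IsAlg {E | Gen S E} :=
  ⟨Gen.univ, fun B h => Gen.compl B h, fun B h C h' => Gen.inter B C h h'⟩

theorem gen_min {S 𝔅 : Set (Set ℕ)} (h : IsAlg 𝔅) (hS : S ⊆ 𝔅) {E : Set ℕ} (hE : Gen S E) :
    E ∈ 𝔅 := by
  induction hE with
  | base B hB => exact hS hB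
  | univ => exact h.univ
  | compl B _ ih => exact h.compl _ ih
  | inter B C _ _ ih ih' => exact h.inter _ ih _ ih'

theorem gen_mono {S S' : Set (Set ℕ)} (h : S ⊆ S') {E : Set ℕ} (hE : Gen S E) : Gen S' E :=
  gen_min (isAlg_gen S') (fun B hB => Gen.base B (h hB)) hE

/-- levels of the generation process -/
def lev (S : Set (Set ℕ)) : ℕ → Set (Set ℕ)
  | 0 => insert Set.univ S
  | n + 1 => lev S n ∪ (compl '' lev S n ∪ (fun p : Set ℕ × Set ℕ => p.1 ∩ p.2) '' (lev S n ×ˢ lev S n))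

theorem lev_mono (S : Set (Set ℕ)) : Monotone (lev S) :=
  monotone_nat_of_le_succ fun n => by
    rw [lev]; exact Set.subset_union_left

theorem gen_lev {S : Set (Set ℕ)} {E : Set ℕ} (hE : Gen S E) : E ∈ ⋃ n, lev S n := by
  refine gen_min ⟨?_, ?_, ?_⟩ ?_ hE
  · exact Set.mem_iUnion.2 ⟨0, Set.mem_insert _ _⟩
  · intro B hB
    obtain ⟨n, hn⟩ := Set.mem_iUnion.1 hB
    refine Set.mem_iUnion.2 ⟨n+1, ?_⟩
    rw [lev]
    exact Or.inr (Or.inl ⟨B, hn, rfl⟩)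
  · intro B hB C hC
    obtain ⟨n, hn⟩ := Set.mem_iUnion.1 hB
    obtain ⟨m, hm⟩ := Set.mem_iUnion.1 hC
    refine Set.mem_iUnion.2 ⟨max n m+1, ?_⟩
    rw [lev]
    exact Or.inr (Or.inr ⟨(B, C), ⟨lev_mono S (le_max_left _ _) hn, lev_mono S (le_max_right _ _) hm⟩, rfl⟩)
  · intro B hB
    exact Set.mem_iUnion.2 ⟨0, Set.mem_insert_of_mem _ hB⟩

open Cardinal in
theorem mk_gen_le (S : Set (Set ℕ)) (κ : Cardinal.{0}) (hκ : ℵ₀ ≤ κ) (hS : #S ≤ κ) :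
    #{E | Gen S E} ≤ κ := by
  have hl : ∀ n, #(lev S n) ≤ κ := by
    intro n
    induction n with
    | zero =>
      rw [lev]
      refine Cardinal.mk_insert_le.trans ?_
      exact Cardinal.add_le_of_le hκ hS (Cardinal.one_le_aleph0.trans hκ)
    | succ n ih =>
      rw [lev]
      refine (Cardinal.mk_union_le _ _).trans (Cardinal.add_le_of_le hκ ih ?_)
      refine (Cardinal.mk_union_le _ _).trans (Cardinal.add_le_of_le hκ (Cardinal.mk_image_le.trans ih) ?_)
      refine Cardinal.mk_image_le.trans ?_
      rw [Cardinal.mk_setProd]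
      simpa using Cardinal.mul_le_of_le hκ ih ih
  refine (Cardinal.mk_le_mk_of_subset (fun E hE => gen_lev hE)).trans ?_
  refine (Cardinal.mk_iUnion_le _).trans ?_
  refine Cardinal.mul_le_of_le hκ ?_ (ciSup_le' hl)
  simpa using hκ

theorem exists_wf {I α : Type*} [LinearOrder I] [WellFoundedLT I] [Inhabited α]
    (Q : (I → α) → I → Prop)
    (hloc : ∀ f g i, (∀ j ≤ i, f j = g j) → Q f i → Q g i)
    (hstep : ∀ f i, (∀ j < i, Q f j) → ∃ a, Q (Function.update f i a) i) :
    ∃ f, ∀ i, Q f i := by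
  classical
  have wf : WellFounded (fun a b : I => a < b) := wellFounded_lt
  let ext : (i : I) → ((j : I) → j < i → α) → I → α := fun i r j => if h : j < i then r j h else default
  let F : (i : I) → ((j : I) → j < i → α) → α := fun i r =>
    if h : ∃ a, Q (Function.update (ext i r) i a) i then h.choose else default
  let f : I → α := wf.fix F
  have hf : ∀ i, f i = F i (fun j _ => f j) := fun i => wf.fix_eq F i
  refine ⟨f, fun i => ?_⟩
  induction i using wf.induction with
  | _ i ih =>
    have h1 : ∃ a, Q (Function.update (ext i (fun j _ => f j)) i a) i := by
      apply hstep
      intro j hj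
      refine hloc f _ j ?_ (ih j hj)
      intro k hk
      simp [ext, lt_of_le_of_lt hk hj]
    have h2 : Q (Function.update (ext i (fun j _ => f j)) i (f i)) i := by
      rw [hf i]
      simp only [F]
      rw [dif_pos h1]
      exact h1.choose_spec
    refine hloc _ f i ?_ h2
    intro j hj
    rcases eq_or_lt_of_le hj with rfl | hj
    · simp
    · rw [Function.update_of_ne hj.ne]; simp [ext, hj]

/-- almost disjoint family -/
def adf (x : ℕ → Bool) : Set ℕ := Set.range fun k => Encodable.encode (List.ofFn fun i : Fin k => x i)

theorem adf_infinite (x : ℕ → Bool) : (adf x).Infinite := by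
  refine Set.infinite_range_of_injective fun k l h => ?_
  have := congrArg List.length (Encodable.encode_injective h)
  simpa using this

theorem adf_inter {x y : ℕ → Bool} (h : x ≠ y) : (adf x ∩ adf y).Finite := by
  obtain ⟨n, hn⟩ : ∃ n, x n ≠ y n := by
    by_contra! hc; exact h (funext hc)
  refine ((Set.finite_Iic n).image fun k => Encodable.encode (List.ofFn fun i : Fin k => x i)).subset ?_
  rintro _ ⟨⟨k, rfl⟩, ⟨l, hl⟩⟩
  refine ⟨k, ?_, rfl⟩
  have h1 := Encodable.encode_injective hl
  have h2 := congrArg List.length h1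
  simp only [List.length_ofFn] at h2
  subst h2
  by_contra hk
  simp only [Set.mem_Iic, not_le] at hk
  have := congrFun (List.ofFn_injective h1) ⟨n, hk⟩
  exact hn this.symm

theorem adf_injective : Function.Injective adf := by
  intro x y h
  by_contra hne
  have := adf_inter hne
  rw [← h, Set.inter_self] at this
  exact adf_infinite x this

end SSX

namespace SSX

def DD (B : ℕ → Set ℕ) (A : Set ℕ) : Set ℕ := ⋃ k ∈ A, B k

theorem mem_DD {B : ℕ → Set ℕ} {A : Set ℕ} {z : ℕ} : z ∈ DD B A ↔ ∃ k ∈ A, z ∈ B k := by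
  simp [DD]

theorem DD_inter {B : ℕ → Set ℕ} (hd : Pairwise (Function.onFun Disjoint B)) (A A' : Set ℕ) (z : ℕ) :
    z ∈ DD B (A ∩ A') ↔ z ∈ DD B A ∧ z ∈ DD B A' := by
  simp only [mem_DD]
  constructor
  · rintro ⟨k, hk, hz⟩
    exact ⟨⟨k, hk.1, hz⟩, ⟨k, hk.2, hz⟩⟩
  · rintro ⟨⟨k, hk, hz⟩, ⟨l, hl, hz'⟩⟩
    have : k = l := by
      by_contra hne
      exact Set.disjoint_left.1 (hd hne) hz hz'
    subst this
    exact ⟨k, ⟨hk, hl⟩, hz⟩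

def cmb (C C' D : Set ℕ) : Set ℕ := (C ∩ D) ∪ (C' \ D)

theorem mem_cmb {C C' D : Set ℕ} {z : ℕ} : z ∈ cmb C C' D ↔ (z ∈ C ∧ z ∈ D) ∨ (z ∈ C' ∧ z ∉ D) := Iff.rfl

theorem gen_cmb {𝔅 : Set (Set ℕ)} (h : IsAlg 𝔅) {D E : Set ℕ} (hE : Gen (𝔅 ∪ {D}) E) :
    ∃ C ∈ 𝔅, ∃ C' ∈ 𝔅, E = cmb C C' D := by
  induction hE with
  | base B hB =>
    rcases hB with hB | hB
    · refine ⟨B, hB, B, hB, ?_⟩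
      ext z; rw [mem_cmb]; tauto
    · rw [Set.mem_singleton_iff] at hB
      refine ⟨Set.univ, h.univ, ∅, h.empty, ?_⟩
      ext z; rw [mem_cmb, hB]; simp
  | univ =>
    refine ⟨Set.univ, h.univ, Set.univ, h.univ, ?_⟩
    ext z; rw [mem_cmb]; simp; tauto
  | compl B _ ih =>
    obtain ⟨C, hC, C', hC', rfl⟩ := ih
    refine ⟨_, h.compl _ hC, _, h.compl _ hC', ?_⟩
    ext z; simp only [mem_cmb, Set.mem_compl_iff]; tauto
  | inter B B' _ _ ih ih' =>
    obtain ⟨C, hC, C', hC', rfl⟩ := ih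
    obtain ⟨G, hG, G', hG', rfl⟩ := ih'
    refine ⟨_, h.inter _ hC _ hG, _, h.inter _ hC' _ hG', ?_⟩
    ext z; simp only [mem_cmb, Set.mem_inter_iff]; tauto

open Cardinal in
theorem mk_iUnion_subsingleton {ι α : Type} (s : ι → Set α) (h : ∀ i, (s i).Subsingleton) :
    #(⋃ i, s i : Set α) ≤ #ι := by
  refine (Cardinal.mk_iUnion_le _).trans ?_
  refine (mul_le_mul_right (ciSup_le' (a := (1 : Cardinal)) fun i => ?_) _).trans (by simp)
  exact Cardinal.mk_le_one_iff_set_subsingleton.2 (h i)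

open Cardinal in
theorem one_step (𝔅 : Set (Set ℕ)) (hA : IsAlg 𝔅) (hcard : #𝔅 < 𝔠) (null : Set ℕ → Prop)
    (hmono : ∀ B C : Set ℕ, B ⊆ C → null C → null B)
    (hunion : ∀ B C, null B → null C → null (B ∪ C))
    (hnull : ∀ B ∈ 𝔅, null B → B = ∅)
    (P : Set ((ℕ → ℕ) × Set ℕ)) (hPc : #P < 𝔠) (hP : ∀ p ∈ P, ∀ C ∈ 𝔅, p.1 ⁻¹' C ≠ p.2)
    (used : Set (ℕ → Bool)) (hu : #used < 𝔠)
    (B : ℕ → Set ℕ) (hB : ∀ k, B k ∈ 𝔅) (hd : Pairwise (Function.onFun Disjoint B)) (w : ℕ → ℕ)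
    (hw : ∀ k j, w k ∉ B j) :
    ∃ x ∉ used, (∀ E, Gen (𝔅 ∪ {DD B (adf x)}) E → null E → E = ∅) ∧
      (∀ p ∈ P, ∀ E, Gen (𝔅 ∪ {DD B (adf x)}) E → p.1 ⁻¹' E ≠ p.2) ∧
      ∀ E, Gen (𝔅 ∪ {DD B (adf x)}) E → w ⁻¹' E ≠ adf x := by
  have hfin : ∀ x y, x ≠ y → DD B (adf x ∩ adf y) ∈ 𝔅 := fun x y hxy =>
    hA.biUnion _ (adf_inter hxy) B fun k _ => hB k
  let bad1 : 𝔅 × 𝔅 → Set (ℕ → Bool) := fun q =>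
    {x | null (cmb q.1 q.2 (DD B (adf x))) ∧ cmb q.1 q.2 (DD B (adf x)) ≠ ∅}
  let bad2 : (𝔅 × 𝔅) × P → Set (ℕ → Bool) := fun q =>
    {x | q.2.1.1 ⁻¹' (cmb q.1.1 q.1.2 (DD B (adf x))) = q.2.1.2}
  let bad3 : 𝔅 × 𝔅 → Set (ℕ → Bool) := fun q =>
    {x | w ⁻¹' (cmb q.1 q.2 (DD B (adf x))) = adf x}
  have hC : ∀ C ∈ 𝔅, ∀ C' ∈ 𝔅, ∀ x y, x ≠ y → cmb C C' (DD B (adf x ∩ adf y)) ∈ 𝔅 :=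
    fun C hC C' hC' x y hxy => hA.union (hA.inter _ hC _ (hfin x y hxy)) (hA.diff hC' (hfin x y hxy))
  have h1 : ∀ q, (bad1 q).Subsingleton := by
    rintro ⟨⟨C, hC1⟩, ⟨C', hC2⟩⟩ x ⟨hx, hxne⟩ y ⟨hy, -⟩
    by_contra hxy
    simp only at hx hy hxne
    have e : cmb C C' (DD B (adf x ∩ adf y)) = ∅ := by
      refine hnull _ (hC C hC1 C' hC2 x y hxy) (hmono _ _ ?_ (hunion _ _ hx hy))
      intro z
      simp only [Set.mem_union, mem_cmb, DD_inter hd]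
      tauto
    obtain ⟨z, hz⟩ := Set.nonempty_iff_ne_empty.2 hxne
    have hz0 : z ∉ cmb C C' (DD B (adf x ∩ adf y)) := by rw [e]; exact fun h => h
    have hz1 : z ∈ C ∧ z ∈ DD B (adf x) := by
      simp only [mem_cmb, DD_inter hd] at hz hz0
      tauto
    obtain ⟨k, hk, hzk⟩ := mem_DD.1 hz1.2
    have : C ∩ B k = ∅ := by
      refine hnull _ (hA.inter _ hC1 _ (hB k)) (hmono _ _ ?_ hx)
      rintro u ⟨hu1, hu2⟩
      exact Or.inl ⟨hu1, mem_DD.2 ⟨k, hk, hu2⟩⟩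
    have hz2 : z ∈ C ∩ B k := ⟨hz1.1, hzk⟩
    rw [this] at hz2
    exact hz2
  have h2 : ∀ q, (bad2 q).Subsingleton := by
    rintro ⟨⟨⟨C, hC1⟩, ⟨C', hC2⟩⟩, ⟨⟨v, A⟩, hp⟩⟩ x hx y hy
    by_contra hxy
    simp only [bad2, Set.mem_ofPred_eq] at hx hy
    refine hP _ hp _ (hC C hC1 C' hC2 x y hxy) ?_
    ext n
    have ex := Set.ext_iff.1 hx n
    have ey := Set.ext_iff.1 hy n
    simp only [Set.mem_preimage, mem_cmb, DD_inter hd] at ex ey ⊢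
    tauto
  have h3 : ∀ q, (bad3 q).Subsingleton := by
    rintro ⟨⟨C, hC1⟩, ⟨C', hC2⟩⟩ x hx y hy
    apply adf_injective
    have hm : ∀ n x, w n ∉ DD B (adf x) := by
      intro n x hn
      obtain ⟨k, _, hk⟩ := mem_DD.1 hn
      exact hw _ _ hk
    simp only [bad3, Set.mem_ofPred_eq] at hx hy
    ext n
    have ex := Set.ext_iff.1 hx n
    have ey := Set.ext_iff.1 hy n
    have := hm n x
    have := hm n y
    simp only [Set.mem_preimage, mem_cmb] at ex ey
    tauto
  have hc1 : #(𝔅 × 𝔅) < 𝔠 := by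
    rw [Cardinal.mk_prod]; simpa using Cardinal.mul_lt_of_lt Cardinal.aleph0_le_continuum hcard hcard
  have hc2 : #((𝔅 × 𝔅) × P) < 𝔠 := by
    rw [Cardinal.mk_prod]; simpa using Cardinal.mul_lt_of_lt Cardinal.aleph0_le_continuum hc1 hPc
  have hlt : #(used ∪ ((⋃ q, bad1 q) ∪ ((⋃ q, bad2 q) ∪ (⋃ q, bad3 q))) : Set (ℕ → Bool)) < 𝔠 := by
    have this : ∀ {a b : Cardinal.{0}}, a < 𝔠 → b < 𝔠 → a + b < 𝔠 :=
      fun h h' => Cardinal.add_lt_of_lt Cardinal.aleph0_le_continuum h h'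
    refine (mk_union_le _ _).trans_lt (this hu ?_)
    refine (mk_union_le _ _).trans_lt (this ((mk_iUnion_subsingleton _ h1).trans_lt hc1) ?_)
    exact (mk_union_le _ _).trans_lt (this ((mk_iUnion_subsingleton _ h2).trans_lt hc2)
      ((mk_iUnion_subsingleton _ h3).trans_lt hc1))
  obtain ⟨x, hx⟩ : ∃ x, x ∉ (used ∪ ((⋃ q, bad1 q) ∪ ((⋃ q, bad2 q) ∪ (⋃ q, bad3 q))) : Set (ℕ → Bool)) := by
    by_contra! hc
    rw [Set.eq_univ_of_forall hc, Cardinal.mk_univ] at hlt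
    simp at hlt
  simp only [Set.mem_union, Set.mem_iUnion, not_or, not_exists] at hx
  obtain ⟨hx0, hx1, hx2, hx3⟩ := hx
  refine ⟨x, hx0, ?_, ?_, ?_⟩
  · intro E hE hn
    obtain ⟨C, hC, C', hC', rfl⟩ := gen_cmb hA hE
    by_contra hne
    exact hx1 (⟨C, hC⟩, ⟨C', hC'⟩) ⟨hn, hne⟩
  · intro p hp E hE
    obtain ⟨C, hC, C', hC', rfl⟩ := gen_cmb hA hE
    intro hne
    exact hx2 ((⟨C, hC⟩, ⟨C', hC'⟩), ⟨p, hp⟩) hne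
  · intro E hE
    obtain ⟨C, hC, C', hC', rfl⟩ := gen_cmb hA hE
    intro hne
    exact hx3 (⟨C, hC⟩, ⟨C', hC'⟩) hne

end SSX

namespace SSX
open Cardinal

/-- index set of the recursion -/
abbrev II : Type := (Cardinal.continuum.{0}).ord.ToType

theorem II_bdd (s : ℕ → II) : ∃ i, ∀ k, s k < i := by
  have h : ¬ IsCofinal (Set.range s) := by
    intro hc
    have h1 := Order.cof_le hc
    rw [Ordinal.cof_toType] at h1
    have h2 := Cardinal.lt_cof_ord_power (a := ℵ₀) (b := (2 : Cardinal.{0})) le_rfl Cardinal.one_lt_two.{0}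
    rw [Cardinal.two_power_aleph0] at h2
    exact absurd ((h2.trans_le h1).trans_le (Cardinal.mk_range_le)) (by simp)
  obtain ⟨x, hx⟩ := not_isCofinal_iff.1 h
  exact ⟨x, fun k => hx _ ⟨k, rfl⟩⟩

theorem II_mk_Iic (i : II) : #(Set.Iic i) < 𝔠 := by
  rw [← Set.Iio_insert]
  refine Cardinal.mk_insert_le.trans_lt ?_
  exact Cardinal.add_lt_of_lt Cardinal.aleph0_le_continuum (mk_Iio_toType_ord_lt i)
    (Cardinal.one_lt_aleph0.trans_le Cardinal.aleph0_le_continuum)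

abbrev JJ : Type := (ℕ → Set ℕ) × (ℕ → ℕ)

theorem mk_JJ : #JJ = 𝔠 := by
  simp [JJ]

theorem exists_enum : Nonempty (II ≃ JJ × II) := by
  rw [← Cardinal.eq]
  rw [Cardinal.mk_prod, Cardinal.lift_id, Cardinal.lift_id, mk_JJ, mk_ord_toType,
    Cardinal.continuum_mul_self]

section rec
variable (𝔅0 : Set (Set ℕ)) (null : Set ℕ → Prop) (e : II → JJ)

def Glt (f : II → Set ℕ × (ℕ → Bool)) (i : II) : Set (Set ℕ) :=
  {E | Gen (𝔅0 ∪ {E | ∃ j < i, E = (f j).1}) E}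
def Gle (f : II → Set ℕ × (ℕ → Bool)) (i : II) : Set (Set ℕ) :=
  {E | Gen (𝔅0 ∪ {E | ∃ j ≤ i, E = (f j).1}) E}

def Val (f : II → Set ℕ × (ℕ → Bool)) (i : II) : Prop :=
  (∀ k, (e i).1 k ∈ Glt 𝔅0 f i) ∧ Pairwise (Function.onFun Disjoint (e i).1) ∧
    ∀ k j, (e i).2 k ∉ (e i).1 j

def QQ (f : II → Set ℕ × (ℕ → Bool)) (i : II) : Prop :=
  (∀ E ∈ Gle 𝔅0 f i, null E → E = ∅) ∧
  (∀ j ≤ i, Val 𝔅0 e f j → ∀ C ∈ Gle 𝔅0 f i, (e j).2 ⁻¹' C ≠ adf (f j).2) ∧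
  (Val 𝔅0 e f i → (f i).1 = DD (e i).1 (adf (f i).2) ∧ ∀ j < i, (f j).2 ≠ (f i).2)

variable {𝔅0 null e}

theorem Glt_congr {f g : II → Set ℕ × (ℕ → Bool)} {i : II} (h : ∀ j < i, f j = g j) :
    Glt 𝔅0 f i = Glt 𝔅0 g i := by
  have : {E | ∃ j < i, E = (f j).1} = {E | ∃ j < i, E = (g j).1} := by
    ext E
    constructor <;> rintro ⟨j, hj, rfl⟩
    · exact ⟨j, hj, by rw [h j hj]⟩
    · exact ⟨j, hj, by rw [h j hj]⟩
  rw [Glt, Glt, this]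

theorem Gle_congr {f g : II → Set ℕ × (ℕ → Bool)} {i : II} (h : ∀ j ≤ i, f j = g j) :
    Gle 𝔅0 f i = Gle 𝔅0 g i := by
  have : {E | ∃ j ≤ i, E = (f j).1} = {E | ∃ j ≤ i, E = (g j).1} := by
    ext E
    constructor <;> rintro ⟨j, hj, rfl⟩
    · exact ⟨j, hj, by rw [h j hj]⟩
    · exact ⟨j, hj, by rw [h j hj]⟩
  rw [Gle, Gle, this]

theorem Val_congr {f g : II → Set ℕ × (ℕ → Bool)} {i : II} (h : ∀ j < i, f j = g j) :
    Val 𝔅0 e f i ↔ Val 𝔅0 e g i := by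
  rw [Val, Val, Glt_congr h]

theorem QQ_congr {f g : II → Set ℕ × (ℕ → Bool)} {i : II} (h : ∀ j ≤ i, f j = g j)
    (hq : QQ 𝔅0 null e f i) : QQ 𝔅0 null e g i := by
  obtain ⟨h1, h2, h3⟩ := hq
  refine ⟨?_, ?_, ?_⟩
  · rwa [← Gle_congr h]
  · intro j hj hv
    rw [← Gle_congr h, ← h j hj]
    exact h2 j hj ((Val_congr fun k hk => h k (hk.le.trans hj)).2 hv)
  · intro hv
    rw [← h i le_rfl]
    obtain ⟨h4, h5⟩ := h3 ((Val_congr fun k hk => h k hk.le).2 hv)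
    exact ⟨h4, fun j hj => by rw [← h j hj.le]; exact h5 j hj⟩

theorem Gle_mono {f : II → Set ℕ × (ℕ → Bool)} {i j : II} (h : i ≤ j) :
    Gle 𝔅0 f i ⊆ Gle 𝔅0 f j := by
  intro E hE
  refine gen_mono (Set.union_subset_union_right _ ?_) hE
  rintro _ ⟨k, hk, rfl⟩
  exact ⟨k, hk.trans h, rfl⟩

theorem base_Gle {f : II → Set ℕ × (ℕ → Bool)} {i : II} {E : Set ℕ} (h : E ∈ 𝔅0) : E ∈ Gle 𝔅0 f i :=
  Gen.base _ (Or.inl h)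

/-- directedness -/
theorem gen_directed (h0 : IsAlg 𝔅0) {f : II → Set ℕ × (ℕ → Bool)} {p : II → Prop} {E : Set ℕ}
    (hE : Gen (𝔅0 ∪ {E | ∃ j, p j ∧ E = (f j).1}) E) : E ∈ 𝔅0 ∨ ∃ j, p j ∧ E ∈ Gle 𝔅0 f j := by
  induction hE with
  | base B hB =>
    rcases hB with hB | ⟨j, hj, rfl⟩
    · exact Or.inl hB
    · exact Or.inr ⟨j, hj, Gen.base _ (Or.inr ⟨j, le_rfl, rfl⟩)⟩
  | univ => exact Or.inl h0.univ
  | compl B _ ih =>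
    rcases ih with h | ⟨j, hj, h⟩
    · exact Or.inl (h0.compl _ h)
    · exact Or.inr ⟨j, hj, Gen.compl _ h⟩
  | inter B C _ _ ih ih' =>
    rcases ih with h | ⟨j, hj, h⟩ <;> rcases ih' with h' | ⟨j', hj', h'⟩
    · exact Or.inl (h0.inter _ h _ h')
    · exact Or.inr ⟨j', hj', Gen.inter _ _ (base_Gle h) h'⟩
    · exact Or.inr ⟨j, hj, Gen.inter _ _ h (base_Gle h')⟩
    · rcases le_total j j' with hle | hle
      · exact Or.inr ⟨j', hj', Gen.inter _ _ (Gle_mono hle h) h'⟩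
      · exact Or.inr ⟨j, hj, Gen.inter _ _ h (Gle_mono hle h')⟩

theorem mk_Glt (hc : 𝔅0.Countable) (f : II → Set ℕ × (ℕ → Bool)) (i : II) : #(Glt 𝔅0 f i) < 𝔠 := by
  have h1 : #{E | ∃ j < i, E = (f j).1} ≤ #(Set.Iio i) := by
    have : {E | ∃ j < i, E = (f j).1} = (fun j => (f j).1) '' Set.Iio i := by
      ext E; constructor
      · rintro ⟨j, hj, rfl⟩; exact ⟨j, hj, rfl⟩
      · rintro ⟨j, hj, rfl⟩; exact ⟨j, hj, rfl⟩
    rw [this]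
    exact Cardinal.mk_image_le
  have h2 : max ℵ₀ #(Set.Iio i) < 𝔠 := max_lt Cardinal.aleph0_lt_continuum (mk_Iio_toType_ord_lt i)
  refine (mk_gen_le _ (max ℵ₀ #(Set.Iio i)) (le_max_left _ _) ?_).trans_lt h2
  refine (Cardinal.mk_union_le _ _).trans ?_
  exact Cardinal.add_le_of_le (le_max_left _ _) ((Cardinal.le_aleph0_iff_set_countable.2 hc).trans (le_max_left _ _))
    (h1.trans (le_max_right _ _))

theorem QQ_step (h0 : IsAlg 𝔅0) (hc : 𝔅0.Countable)
    (hmono : ∀ B C : Set ℕ, B ⊆ C → null C → null B)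
    (hunion : ∀ B C, null B → null C → null (B ∪ C))
    (hnull : ∀ B ∈ 𝔅0, null B → B = ∅)
    (f : II → Set ℕ × (ℕ → Bool)) (i : II) (hf : ∀ j < i, QQ 𝔅0 null e f j) :
    ∃ a, QQ 𝔅0 null e (Function.update f i a) i := by
  classical
  have hA : IsAlg (Glt 𝔅0 f i) := isAlg_gen _
  have hn : ∀ B ∈ Glt 𝔅0 f i, null B → B = ∅ := by
    intro B hB
    rcases gen_directed h0 hB with h | ⟨j, hj, h⟩
    · exact hnull B h
    · exact (hf j hj).1 B h
  have hp : ∀ j < i, Val 𝔅0 e f j → ∀ C ∈ Glt 𝔅0 f i, (e j).2 ⁻¹' C ≠ adf (f j).2 := by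
    intro j hj hv C hC
    rcases gen_directed h0 hC with h | ⟨j', hj', h⟩
    · exact (hf j hj).2.1 j le_rfl hv C (base_Gle h)
    · exact (hf (max j j') (max_lt hj hj')).2.1 j (le_max_left _ _) hv C (Gle_mono (le_max_right _ _) h)
  have hup : ∀ a, ∀ j < i, Function.update f i a j = f j := fun a j hj => Function.update_of_ne hj.ne _ _
  have hval : ∀ a, ∀ j ≤ i, Val 𝔅0 e (Function.update f i a) j ↔ Val 𝔅0 e f j := fun a j hj =>
    Val_congr fun k hk => hup a k (hk.trans_le hj)
  have hG : ∀ a, ∀ E ∈ Gle 𝔅0 (Function.update f i a) i, Gen (Glt 𝔅0 f i ∪ {a.1}) E := by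
    intro a E hE
    refine gen_min (isAlg_gen _) ?_ hE
    rintro B (hB | ⟨j, hj, rfl⟩)
    · exact Gen.base _ (Or.inl (Gen.base _ (Or.inl hB)))
    · rcases eq_or_lt_of_le hj with rfl | hj
      · rw [Function.update_self]
        exact Gen.base _ (Or.inr rfl)
      · rw [hup a j hj]
        exact Gen.base _ (Or.inl (Gen.base _ (Or.inr ⟨j, hj, rfl⟩)))
  by_cases hv : Val 𝔅0 e f i
  · let P : Set ((ℕ → ℕ) × Set ℕ) := (fun j => ((e j).2, adf (f j).2)) '' {j | j < i ∧ Val 𝔅0 e f j}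
    let used : Set (ℕ → Bool) := (fun j => (f j).2) '' Set.Iio i
    obtain ⟨x, hx, h1, h2, h3⟩ := one_step (Glt 𝔅0 f i) hA (mk_Glt hc f i) null hmono hunion hn P
      (Cardinal.mk_image_le.trans_lt ((Cardinal.mk_le_mk_of_subset
        (fun j hj => hj.1)).trans_lt (mk_Iio_toType_ord_lt i)))
      (by
        rintro _ ⟨j, ⟨hj, hvj⟩, rfl⟩ C hC
        exact hp j hj hvj C hC)
      used (Cardinal.mk_image_le.trans_lt (mk_Iio_toType_ord_lt i)) (e i).1 hv.1 hv.2.1 (e i).2 hv.2.2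
    refine ⟨(DD (e i).1 (adf x), x), ?_, ?_, ?_⟩
    · intro E hE
      exact h1 E (hG _ E hE)
    · intro j hj hvj C hC
      have hvj' := (hval _ j hj).1 hvj
      rcases eq_or_lt_of_le hj with rfl | hj
      · simpa using h3 C (hG _ C hC)
      · rw [hup _ j hj]
        exact h2 _ ⟨j, ⟨hj, hvj'⟩, rfl⟩ C (hG _ C hC)
    · intro _
      refine ⟨by simp, ?_⟩
      intro j hj
      rw [hup _ j hj]
      simp only [Function.update_self]
      exact fun h => hx ⟨j, hj, h⟩
  · have hG' : ∀ x, ∀ E ∈ Gle 𝔅0 (Function.update f i (∅, x)) i, E ∈ Glt 𝔅0 f i := by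
      intro x E hE
      refine gen_min hA ?_ (hG _ E hE)
      rintro B (hB | hB)
      · exact hB
      · rw [Set.mem_singleton_iff.1 hB]; exact hA.empty
    refine ⟨(∅, fun _ => true), ?_, ?_, ?_⟩
    · intro E hE
      exact hn E (hG' _ E hE)
    · intro j hj hvj C hC
      have hvj' := (hval _ j hj).1 hvj
      rcases eq_or_lt_of_le hj with rfl | hj
      · exact absurd hvj' hv
      · rw [hup _ j hj]
        exact hp j hj hvj' C (hG' _ C hC)
    · intro h
      exact absurd ((hval _ i le_rfl).1 h) hv

end rec

theorem exists_alg (𝔅0 : Set (Set ℕ)) (null : Set ℕ → Prop) (h0 : IsAlg 𝔅0) (hc : 𝔅0.Countable)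
    (hmono : ∀ B C : Set ℕ, B ⊆ C → null C → null B)
    (hunion : ∀ B C, null B → null C → null (B ∪ C))
    (hnull : ∀ B ∈ 𝔅0, null B → B = ∅) :
    ∃ 𝔅 : Set (Set ℕ), IsAlg 𝔅 ∧ 𝔅0 ⊆ 𝔅 ∧ (∀ B ∈ 𝔅, null B → B = ∅) ∧
      ∀ (B : ℕ → Set ℕ) (w : ℕ → ℕ), (∀ k, B k ∈ 𝔅) → Pairwise (Function.onFun Disjoint B) →
        (∀ k j, w k ∉ B j) →
        ∃ 𝒰 : Set (Set ℕ), ¬ 𝒰.Countable ∧ (∀ A ∈ 𝒰, ∀ A' ∈ 𝒰, A ≠ A' → (A ∩ A').Finite) ∧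
          (∀ A ∈ 𝒰, A.Infinite) ∧
          ∀ A ∈ 𝒰, DD B A ∈ 𝔅 ∧ ∀ C ∈ 𝔅, w ⁻¹' C ≠ A := by
  obtain ⟨en⟩ := exists_enum
  let e : II → JJ := fun i => (en i).1
  obtain ⟨f, hf⟩ := exists_wf (QQ 𝔅0 null e) (fun f g i h => QQ_congr h)
    (QQ_step h0 hc hmono hunion hnull)
  let 𝔅 : Set (Set ℕ) := {E | Gen (𝔅0 ∪ {E | ∃ j, True ∧ E = (f j).1}) E}
  have hdir : ∀ E ∈ 𝔅, ∃ j, E ∈ Gle 𝔅0 f j := by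
    intro E hE
    rcases gen_directed h0 hE with h | ⟨j, -, h⟩
    · obtain ⟨i, -⟩ := II_bdd (fun _ => en.symm (⟨fun _ => ∅, id⟩, Classical.choice (by
        have : #II ≠ 0 := by rw [mk_ord_toType]; exact Cardinal.continuum_ne_zero
        exact Cardinal.mk_ne_zero_iff.1 this)))
      exact ⟨i, base_Gle h⟩
    · exact ⟨j, h⟩
  refine ⟨𝔅, isAlg_gen _, fun E hE => Gen.base _ (Or.inl hE), ?_, ?_⟩
  · intro E hE
    obtain ⟨j, hj⟩ := hdir E hE
    exact (hf j).1 E hj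
  · intro B w hB hd hw
    choose s hs using fun k => hdir _ (hB k)
    obtain ⟨i0, hi0⟩ := II_bdd s
    let K : Set II := {i | i0 ≤ i ∧ e i = (B, w)}
    have hval : ∀ i ∈ K, Val 𝔅0 e f i := by
      rintro i ⟨hi, he⟩
      rw [Val, he]
      refine ⟨fun k => ?_, hd, hw⟩
      refine gen_mono (Set.union_subset_union_right _ ?_) (hs k)
      rintro _ ⟨j, hj, rfl⟩
      exact ⟨j, hj.trans_lt ((hi0 k).trans_le hi), rfl⟩
    have hinj : Set.InjOn (fun i => adf (f i).2) K := by
      intro i hi j hj hij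
      have hij' := adf_injective hij
      rcases lt_trichotomy i j with h | h | h
      · exact absurd hij' (((hf j).2.2 (hval j hj)).2 i h)
      · exact h
      · exact absurd hij'.symm (((hf i).2.2 (hval i hi)).2 j h)
    refine ⟨(fun i => adf (f i).2) '' K, ?_, ?_, ?_, ?_⟩
    · intro hcount
      have hK : K.Countable := Set.MapsTo.countable_of_injOn (Set.mapsTo_image _ _) hinj hcount
      have h1 : Set.range (fun t : II => en.symm ((B, w), t)) ⊆ K ∪ Set.Iic i0 := by
        rintro _ ⟨t, rfl⟩
        rcases le_total i0 (en.symm ((B, w), t)) with h | h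
        · exact Or.inl ⟨h, by simp [e]⟩
        · exact Or.inr h
      have h2 := Cardinal.mk_le_mk_of_subset h1
      rw [Cardinal.mk_range_eq _ (by
        intro t t' htt
        simpa using htt), mk_ord_toType] at h2
      refine absurd (h2.trans (Cardinal.mk_union_le _ _)) (not_le.2 ?_)
      exact Cardinal.add_lt_of_lt Cardinal.aleph0_le_continuum
        ((Cardinal.le_aleph0_iff_set_countable.2 hK).trans_lt Cardinal.aleph0_lt_continuum) (II_mk_Iic i0)
    · rintro _ ⟨i, hi, rfl⟩ _ ⟨j, hj, rfl⟩ hne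
      exact adf_inter fun h => hne (by simp only [h])
    · rintro _ ⟨i, hi, rfl⟩
      exact adf_infinite _
    · rintro _ ⟨i, hi, rfl⟩
      have h1 := (hf i).2.2 (hval i hi)
      have he : e i = (B, w) := hi.2
      constructor
      · have := h1.1
        rw [he] at this
        rw [← this]
        exact Gen.base _ (Or.inr ⟨i, trivial, rfl⟩)
      · intro C hC
        obtain ⟨j, hj⟩ := hdir C hC
        have := (hf (max i j)).2.1 i (le_max_left _ _) (hval i hi) C (Gle_mono (le_max_right _ _) hj)
        rwa [he] at this

end SSX

namespace SSX

abbrev EE : Type := BoundedContinuousFunction ℕ ℝ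

def mkE (f : ℕ → ℝ) (C : ℝ) (h : ∀ n, |f n| ≤ C) : EE :=
  BoundedContinuousFunction.ofNormedAddCommGroupDiscrete f C h

@[simp] theorem mkE_apply (f : ℕ → ℝ) (C : ℝ) (h : ∀ n, |f n| ≤ C) (n : ℕ) : mkE f C h n = f n := rfl

theorem norm_mkE_le (f : ℕ → ℝ) (C : ℝ) (h : ∀ n, |f n| ≤ C) : ‖mkE f C h‖ ≤ C :=
  (BoundedContinuousFunction.norm_le ((abs_nonneg _).trans (h 0))).2 h

theorem abs_le_norm (f : EE) (n : ℕ) : |f n| ≤ ‖f‖ := f.norm_coe_le_norm n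

theorem norm_le_of {f : EE} {C : ℝ} (hC : 0 ≤ C) (h : ∀ n, |f n| ≤ C) : ‖f‖ ≤ C :=
  (BoundedContinuousFunction.norm_le hC).2 h

open Classical in
noncomputable def ind (B : Set ℕ) : EE := mkE (fun n => if n ∈ B then 1 else 0) 1 (by intro n; split_ifs <;> simp)

open Classical in
theorem ind_apply (B : Set ℕ) (n : ℕ) : ind B n = if n ∈ B then 1 else 0 := rfl

theorem ind_mem {B : Set ℕ} {n : ℕ} (h : n ∈ B) : ind B n = 1 := by rw [ind_apply, if_pos h]
theorem ind_not_mem {B : Set ℕ} {n : ℕ} (h : n ∉ B) : ind B n = 0 := by rw [ind_apply, if_neg h]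

theorem norm_ind_le (B : Set ℕ) : ‖ind B‖ ≤ 1 := norm_mkE_le _ _ _

/-- dyadic averages -/
noncomputable def avg (N : ℕ) (f : EE) : ℝ := (∑ m ∈ Finset.range (2 ^ N), f m) / 2 ^ N

theorem abs_avg_le (N : ℕ) (f : EE) : |avg N f| ≤ ‖f‖ := by
  rw [avg, abs_div, abs_of_pos (by positivity : (0:ℝ) < 2 ^ N), div_le_iff₀ (by positivity)]
  refine (Finset.abs_sum_le_sum_abs _ _).trans ?_
  refine (Finset.sum_le_sum fun m _ => abs_le_norm f m).trans ?_
  simp [mul_comm]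

theorem avg_tendsto (f : EE) : ∃ l, Tendsto (fun N => avg N f) (hyperfilter ℕ) (𝓝 l) := by
  have hc : IsCompact (Set.Icc (-‖f‖) ‖f‖) := isCompact_Icc
  obtain ⟨l, -, hl⟩ := hc.ultrafilter_le_nhds ((hyperfilter ℕ).map (fun N => avg N f)) (by
    rw [Ultrafilter.coe_map, le_principal_iff]
    exact Filter.mem_map.2 (Filter.univ_mem' fun N => abs_le.1 (abs_avg_le N f)))
  exact ⟨l, hl⟩

noncomputable def mu0 (f : EE) : ℝ := (avg_tendsto f).choose
theorem mu0_spec (f : EE) : Tendsto (fun N => avg N f) (hyperfilter ℕ) (𝓝 (mu0 f)) := (avg_tendsto f).choose_spec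

theorem mu0_eq {f : EE} {l : ℝ} (h : Tendsto (fun N => avg N f) (hyperfilter ℕ) (𝓝 l)) : mu0 f = l :=
  tendsto_nhds_unique (mu0_spec f) h

noncomputable def mu : EE →L[ℝ] ℝ :=
  LinearMap.mkContinuous
    { toFun := mu0
      map_add' := fun f g => mu0_eq (((mu0_spec f).add (mu0_spec g)).congr fun N => by
        simp [avg, Finset.sum_add_distrib, add_div])
      map_smul' := fun c f => mu0_eq (((mu0_spec f).const_mul c).congr fun N => by
        simp [avg, ← Finset.mul_sum, mul_div_assoc]) } 1 (fun f => by
    rw [one_mul]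
    exact le_of_tendsto (mu0_spec f).abs (Eventually.of_forall fun N => abs_avg_le N f))

theorem mu_spec (f : EE) : Tendsto (fun N => avg N f) (hyperfilter ℕ) (𝓝 (mu f)) := mu0_spec f

theorem mu_le_norm (f : EE) : |mu f| ≤ ‖f‖ :=
  le_of_tendsto (mu0_spec f).abs (Eventually.of_forall fun N => abs_avg_le N f)

theorem mu_mono {f g : EE} (h : ∀ n, f n ≤ g n) : mu f ≤ mu g :=
  le_of_tendsto_of_tendsto' (mu_spec f) (mu_spec g) fun N => by
    rw [avg, avg]; gcongr; exact h _

theorem mu_nonneg {f : EE} (h : ∀ n, 0 ≤ f n) : 0 ≤ mu f := by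
  have := mu_mono (f := 0) (g := f) h
  simpa using this

theorem avg_per_succ {f : EE} {N : ℕ} (h : ∀ m, f (m % 2 ^ N) = f m) (M : ℕ) : avg (N + M) f = avg N f := by
  induction M with
  | zero => rfl
  | succ M ih =>
    rw [← ih, avg, avg, ← add_assoc, pow_succ, mul_two, Finset.sum_range_add]
    have : ∑ x ∈ Finset.range (2 ^ (N + M)), f (2 ^ (N + M) + x) = ∑ x ∈ Finset.range (2 ^ (N + M)), f x := by
      refine Finset.sum_congr rfl fun x _ => ?_
      rw [← h (2 ^ (N + M) + x), ← h x, pow_add, Nat.mul_add_mod]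
    rw [this, pow_succ]
    field_simp
    ring

theorem mu_per {f : EE} {N : ℕ} (h : ∀ m, f (m % 2 ^ N) = f m) : mu f = avg N f := by
  refine mu0_eq ?_
  refine tendsto_const_nhds.congr' ?_
  have : ∀ᶠ K in atTop, avg N f = avg K f := by
    filter_upwards [eventually_ge_atTop N] with K hK
    obtain ⟨M, rfl⟩ := Nat.exists_eq_add_of_le hK
    exact (avg_per_succ h M).symm
  exact Nat.hyperfilter_le_atTop this

theorem mu_one : mu 1 = 1 := by
  rw [mu_per (N := 0) (f := 1) (by simp)]
  simp [avg]

theorem prod_formula {R : Type*} [CommRing R] (F : ℕ → Bool → R) (N : ℕ) :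
    ∑ m ∈ Finset.range (2 ^ N), ∏ n ∈ Finset.range N, F n (m.testBit n) =
      ∏ n ∈ Finset.range N, (F n false + F n true) := by
  induction N with
  | zero => simp
  | succ N ih =>
    rw [pow_succ, mul_two, Finset.sum_range_add, Finset.prod_range_succ, ← ih, mul_add, Finset.sum_mul, Finset.sum_mul]
    congr 1
    · refine Finset.sum_congr rfl fun m hm => ?_
      rw [Finset.prod_range_succ, Nat.testBit_lt_two_pow (Finset.mem_range.1 hm)]
    · refine Finset.sum_congr rfl fun m hm => ?_
      rw [Finset.prod_range_succ, Nat.testBit_two_pow_add_eq, Nat.testBit_lt_two_pow (Finset.mem_range.1 hm)]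
      congr 1
      refine Finset.prod_congr rfl fun n hn => ?_
      rw [Nat.testBit_two_pow_add_gt (Finset.mem_range.1 hn)]

/-- the sign of a bit -/
def sg (b : Bool) : ℝ := if b then -1 else 1

theorem sg_sq (b : Bool) : sg b * sg b = 1 := by cases b <;> simp [sg]
theorem abs_sg (b : Bool) : |sg b| = 1 := by cases b <;> simp [sg]

/-- Walsh functions -/
def wal (S : Finset ℕ) : EE := mkE (fun m => ∏ n ∈ S, sg (m.testBit n)) 1 (by
  intro m; rw [Finset.abs_prod]; simp [abs_sg])

theorem wal_apply (S : Finset ℕ) (m : ℕ) : wal S m = ∏ n ∈ S, sg (m.testBit n) := rfl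

theorem testBit_mod {m N n : ℕ} (h : n < N) : (m % 2 ^ N).testBit n = m.testBit n := by
  rw [Nat.testBit_mod_two_pow]; simp [h]

/-- Rademacher functions -/
def rad (n : ℕ) : EE := mkE (fun m => sg (m.testBit n)) 1 (by intro m; simp [abs_sg])

theorem rad_apply (n m : ℕ) : rad n m = sg (m.testBit n) := rfl
theorem abs_rad (n m : ℕ) : |rad n m| = 1 := abs_sg _
theorem rad_sq (n m : ℕ) : rad n m * rad n m = 1 := sg_sq _
theorem norm_rad_le (n : ℕ) : ‖rad n‖ ≤ 1 := norm_mkE_le _ _ _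

theorem wal_singleton (n : ℕ) : wal {n} = rad n := by
  ext m; simp [wal_apply, rad_apply]

theorem wal_pair {n m : ℕ} (h : n ≠ m) : wal {n, m} = rad n * rad m := by
  ext k; simp [wal_apply, rad_apply, Finset.prod_pair h]

theorem mu_wal (S T : Finset ℕ) : mu (wal S * wal T) = if S = T then 1 else 0 := by
  obtain ⟨N, hN⟩ : ∃ N, ∀ n ∈ S ∪ T, n < N := ⟨(S ∪ T).sup id + 1, fun n hn =>
    Nat.lt_succ_of_le (Finset.le_sup (f := id) hn)⟩
  have hS : S ⊆ Finset.range N := fun n hn => Finset.mem_range.2 (hN n (Finset.mem_union_left _ hn))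
  have hT : T ⊆ Finset.range N := fun n hn => Finset.mem_range.2 (hN n (Finset.mem_union_right _ hn))
  rw [mu_per (N := N)]
  · have e : ∀ m, (wal S * wal T) m = ∏ n ∈ Finset.range N,
        ((if n ∈ S then sg (m.testBit n) else 1) * (if n ∈ T then sg (m.testBit n) else 1)) := by
      intro m
      rw [Finset.prod_mul_distrib]
      simp only [BoundedContinuousFunction.coe_mul, Pi.mul_apply, wal_apply]
      rw [Finset.prod_ite_mem, Finset.prod_ite_mem, Finset.inter_eq_right.2 hS, Finset.inter_eq_right.2 hT]
    rw [avg]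
    simp only [e]
    rw [prod_formula (fun n b => (if n ∈ S then sg b else 1) * (if n ∈ T then sg b else 1)) N]
    have e2 : ∀ n, ((if n ∈ S then sg false else 1) * (if n ∈ T then sg false else 1) +
        (if n ∈ S then sg true else 1) * (if n ∈ T then sg true else 1) : ℝ) =
        2 * if (n ∈ S ↔ n ∈ T) then 1 else 0 := by
      intro n
      by_cases h1 : n ∈ S <;> by_cases h2 : n ∈ T <;> simp [h1, h2, sg] <;> norm_num
    simp only [e2]
    rw [Finset.prod_mul_distrib, Finset.prod_const, Finset.card_range, mul_div_assoc, mul_comm,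
      div_mul_cancel₀ _ (by positivity)]
    split_ifs with h
    · simp [h]
    · obtain ⟨n, hn⟩ : ∃ n, ¬ (n ∈ S ↔ n ∈ T) := by
        by_contra! hc
        exact h (Finset.ext hc)
      refine Finset.prod_eq_zero (i := n) ?_ (by simp [hn])
      by_cases h1 : n ∈ S
      · exact hS h1
      · exact hT (by tauto)
  · intro m
    simp only [BoundedContinuousFunction.coe_mul, Pi.mul_apply, wal_apply]
    congr 1
    · exact Finset.prod_congr rfl fun n hn => by rw [testBit_mod (Finset.mem_range.1 (hS hn))]
    · exact Finset.prod_congr rfl fun n hn => by rw [testBit_mod (Finset.mem_range.1 (hT hn))]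

theorem bessel {ι : Type*} [DecidableEq ι] (e : ι → EE) (he : ∀ i j, mu (e i * e j) = if i = j then 1 else 0)
    (f : EE) (F : Finset ι) : ∑ i ∈ F, mu (f * e i) ^ 2 ≤ mu (f * f) := by
  set g : EE := f - ∑ i ∈ F, mu (f * e i) • e i with hg
  have h0 : 0 ≤ mu (g * g) := mu_nonneg fun n => mul_self_nonneg (g n)
  have h1 : mu (g * g) = mu (f * f) - ∑ i ∈ F, mu (f * e i) ^ 2 := by
    have e1 : g * g = f * f - (2:ℝ) • ∑ i ∈ F, mu (f * e i) • (f * e i) +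
        ∑ i ∈ F, ∑ j ∈ F, (mu (f * e i) * mu (f * e j)) • (e i * e j) := by
      have : (∑ i ∈ F, mu (f * e i) • e i) * (∑ i ∈ F, mu (f * e i) • e i) =
          ∑ i ∈ F, ∑ j ∈ F, (mu (f * e i) * mu (f * e j)) • (e i * e j) := by
        rw [Finset.sum_mul_sum]
        simp only [smul_mul_smul_comm]
      rw [← this, hg]
      have : ∑ i ∈ F, mu (f * e i) • (f * e i) = f * ∑ i ∈ F, mu (f * e i) • e i := by
        rw [Finset.mul_sum]; simp only [mul_smul_comm]
      rw [this, two_smul]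
      ring
    rw [e1]
    simp only [map_add, map_sub, map_sum, map_smul, he, smul_eq_mul]
    simp only [mul_ite, mul_one, mul_zero, Finset.sum_ite_eq, ← pow_two]
    rw [Finset.sum_congr rfl (fun i hi => if_pos hi)]
    ring
  linarith

theorem mu_sq_le (f : EE) : mu (f * f) ≤ ‖f‖ * ‖f‖ :=
  (le_abs_self _).trans ((mu_le_norm _).trans (norm_mul_le _ _))

theorem bessel_rad (f : EE) (F : Finset ℕ) : ∑ n ∈ F, mu (f * rad n) ^ 2 ≤ mu (f * f) := by
  refine bessel rad (fun i j => ?_) f F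
  rw [← wal_singleton, ← wal_singleton, mu_wal]
  simp

theorem bessel_wal (f : EE) (F : Finset (Finset ℕ)) : ∑ S ∈ F, mu (f * wal S) ^ 2 ≤ mu (f * f) :=
  bessel wal mu_wal f F

theorem mu_rad_tendsto (f : EE) : Tendsto (fun n => mu (f * rad n)) atTop (𝓝 0) := by
  have hs : Summable fun n => mu (f * rad n) ^ 2 :=
    summable_of_sum_le (fun n => sq_nonneg _) (bessel_rad f)
  have := hs.tendsto_atTop_zero
  rw [tendsto_zero_iff_abs_tendsto_zero]
  have h2 := this.sqrt
  simpa [Real.sqrt_sq_eq_abs, Function.comp_def] using h2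

theorem pairs_small (f : EE) (hf : mu f = 0) {ε : ℝ} (hε : 0 < ε) :
    ∀ᶠ n in atTop, ∀ F : Finset ℕ, ∑ m ∈ F, mu ((rad n * f) * rad m) ^ 2 ≤ ε := by
  have hs : Summable fun S => mu (f * wal S) ^ 2 :=
    summable_of_sum_le (fun n => sq_nonneg _) (bessel_wal f)
  obtain ⟨F0, hF0⟩ := hs.vanishing (Metric.ball_mem_nhds (0:ℝ) hε)
  obtain ⟨N, hN⟩ : ∃ N, ∀ S ∈ F0, ∀ n ∈ S, n < N :=
    ⟨(F0.sup id).sup id + 1, fun S hS n hn => Nat.lt_succ_of_le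
      (Finset.le_sup (f := id) ((Finset.le_sup (f := id) hS : S ≤ _) hn))⟩
  filter_upwards [eventually_ge_atTop N] with n hn F
  have h1 : ∑ m ∈ F, mu ((rad n * f) * rad m) ^ 2 = ∑ m ∈ F.erase n, mu ((rad n * f) * rad m) ^ 2 := by
    symm
    refine Finset.sum_subset (Finset.erase_subset _ _) fun m hm hm' => ?_
    have : m = n := by
      by_contra hne
      exact hm' (Finset.mem_erase.2 ⟨hne, hm⟩)
    subst this
    have : rad m * f * rad m = f := by
      ext k
      have := rad_sq m k
      simp only [BoundedContinuousFunction.coe_mul, Pi.mul_apply]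
      linear_combination (f k) * this
    rw [this, hf]; simp
  have h2 : ∑ m ∈ F.erase n, mu ((rad n * f) * rad m) ^ 2 =
      ∑ S ∈ (F.erase n).image (fun m => ({n, m} : Finset ℕ)), mu (f * wal S) ^ 2 := by
    rw [Finset.sum_image]
    · refine Finset.sum_congr rfl fun m hm => ?_
      rw [wal_pair (Finset.ne_of_mem_erase hm).symm]
      congr 2
      ring
    · intro m hm m' hm' h
      have h3 : m ∈ ({n, m'} : Finset ℕ) := by
        have h := h
        simp only at h
        rw [← h]; simp
      simp only [Finset.mem_insert, Finset.mem_singleton] at h3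
      exact h3.resolve_left (Finset.ne_of_mem_erase hm)
  rw [h1, h2]
  have h3 := hF0 ((F.erase n).image (fun m => ({n, m} : Finset ℕ))) (by
    rw [Finset.disjoint_left]
    intro S hS hS0
    obtain ⟨m, _, rfl⟩ := Finset.mem_image.1 hS
    exact absurd (hN _ hS0 n (by simp)) (not_lt.2 hn))
  rw [Metric.mem_ball, dist_zero_right] at h3
  exact (le_abs_self _).trans h3.le

end SSX

namespace SSX

/-- dyadically periodic functions -/
def PerF : Set EE := {f | ∃ N : ℕ, ∀ m, f (m % 2 ^ N) = f m}

noncomputable def zz (b : ℕ → ℝ) (N m : ℕ) : ℂ := ∏ n ∈ Finset.range N, (1 + Complex.I * (b n * sg (m.testBit n) : ℝ))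

theorem norm_zz (b : ℕ → ℝ) (N m : ℕ) (h : ∑ n ∈ Finset.range N, b n ^ 2 ≤ 1) : ‖zz b N m‖ ≤ 2 := by
  have h1 : ‖zz b N m‖ ^ 2 ≤ 2 ^ 2 := by
    rw [zz, norm_prod, ← Finset.prod_pow]
    have h2 : ∀ n, ‖(1 + Complex.I * (b n * sg (m.testBit n) : ℝ))‖ ^ 2 ≤ Real.exp (b n ^ 2) := by
      intro n
      rw [← Complex.normSq_eq_norm_sq, Complex.normSq_apply]
      have h3 := Real.add_one_le_exp (b n ^ 2)
      have h4 := sg_sq (m.testBit n)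
      have : (b n * sg (m.testBit n)) * (b n * sg (m.testBit n)) = b n ^ 2 := by
        linear_combination (b n ^ 2) * h4
      simp
      nlinarith
    refine (Finset.prod_le_prod (fun n _ => by positivity) (fun n _ => h2 n)).trans ?_
    rw [← Real.exp_sum]
    refine (Real.exp_le_exp.2 h).trans ?_
    have := Real.exp_one_lt_d9
    linarith
  exact (pow_le_pow_iff_left₀ (norm_nonneg _) (by norm_num) (by norm_num)).1 h1

theorem lift_fin (a : ℕ → ℝ) (N : ℕ) (ha : ∀ n, N ≤ n → a n = 0) (t : ℝ) (ht : 0 ≤ t)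
    (hs : ∑ n ∈ Finset.range N, a n ^ 2 ≤ t ^ 2) :
    ∃ u ∈ PerF, ‖u‖ ≤ 2 * t ∧ ∀ m, mu (u * rad m) = a m := by
  rcases eq_or_lt_of_le ht with rfl | ht
  · refine ⟨0, ⟨0, by simp⟩, by simp, fun m => ?_⟩
    have : a m = 0 := by
      rcases le_or_gt N m with h | h
      · exact ha m h
      · have h1 := (Finset.single_le_sum (f := fun n => a n ^ 2) (fun n _ => sq_nonneg (a n)) (Finset.mem_range.2 h)).trans hs
        have h2 : a m ^ 2 = 0 := le_antisymm (by simpa using h1) (sq_nonneg _)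
        simpa using h2
    rw [this]; simp
  · set b : ℕ → ℝ := fun n => a n / t with hb
    have hbs : ∑ n ∈ Finset.range N, b n ^ 2 ≤ 1 := by
      simp only [hb, div_pow]
      rw [← Finset.sum_div, div_le_one (by positivity)]
      exact hs
    have hbd : ∀ m, |t * (zz b N m).im| ≤ 2 * t := by
      intro m
      rw [abs_mul, abs_of_pos ht, mul_comm 2 t]
      gcongr
      exact (Complex.abs_im_le_norm _).trans (norm_zz b N m hbs)
    have hz : ∀ M, N ≤ M → ∀ m, zz b N m = zz b M m := by
      intro M hM m
      rw [zz, zz]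
      refine Finset.prod_subset (Finset.range_mono hM) ?_
      intro n _ hn
      simp [hb, ha n (by simpa using hn)]
    have hzp : ∀ M m, zz b M (m % 2 ^ M) = zz b M m := by
      intro M m
      rw [zz, zz]
      refine Finset.prod_congr rfl fun n hn => ?_
      rw [testBit_mod (Finset.mem_range.1 hn)]
    refine ⟨mkE (fun m => t * (zz b N m).im) (2 * t) hbd, ⟨N, fun m => by simp [hzp]⟩, norm_mkE_le _ _ _, ?_⟩
    intro k
    set M := max N (k + 1) with hM
    rw [mu_per (N := M)]
    · have e : ∀ m, (mkE (fun m => t * (zz b N m).im) (2 * t) hbd * rad k) m =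
          t * (∏ n ∈ Finset.range M, ((if n = k then ((sg (m.testBit n) : ℝ) : ℂ) else 1) *
            (1 + Complex.I * (b n * sg (m.testBit n) : ℝ)))).im := by
        intro m
        have hk : k ∈ Finset.range M := Finset.mem_range.2 (lt_of_lt_of_le (Nat.lt_succ_self k) (le_max_right _ _))
        rw [Finset.prod_mul_distrib, Finset.prod_ite_eq', if_pos hk]
        change t * (zz b N m).im * sg (m.testBit k) = t * (((sg (m.testBit k) : ℝ) : ℂ) * zz b M m).im
        rw [← hz M (le_max_left _ _), Complex.im_ofReal_mul]
        ring
      rw [avg]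
      simp only [e]
      rw [← Finset.mul_sum, ← Complex.im_sum,
        prod_formula (fun n c => (if n = k then ((sg c : ℝ) : ℂ) else 1) *
            (1 + Complex.I * (b n * sg c : ℝ))) M]
      have e2 : ∀ n, ((if n = k then ((sg false : ℝ) : ℂ) else 1) * (1 + Complex.I * (b n * sg false : ℝ)) +
          (if n = k then ((sg true : ℝ) : ℂ) else 1) * (1 + Complex.I * (b n * sg true : ℝ))) =
          2 * (if n = k then Complex.I * b n else 1) := by
        intro n
        split_ifs <;> simp [sg] <;> ring
      simp only [e2]
      rw [Finset.prod_mul_distrib, Finset.prod_const, Finset.card_range, Finset.prod_ite_eq', if_pos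
        (Finset.mem_range.2 (lt_of_lt_of_le (Nat.lt_succ_self k) (le_max_right _ _)))]
      have : ((2:ℂ) ^ M * (Complex.I * b k)).im = 2 ^ M * b k := by
        have : ((2:ℂ) ^ M * (Complex.I * b k)) = ((2 ^ M * b k : ℝ) : ℂ) * Complex.I := by push_cast; ring
        rw [this, Complex.im_ofReal_mul]; simp
      rw [this, hb]
      field_simp
    · intro m
      have hk : k < M := lt_of_lt_of_le (Nat.lt_succ_self k) (le_max_right _ _)
      simp only [BoundedContinuousFunction.coe_mul, Pi.mul_apply, mkE_apply, rad_apply]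
      rw [testBit_mod hk, hz M (le_max_left _ _), hz M (le_max_left _ _), hzp]

def PerSub : Submodule ℝ EE where
  carrier := PerF
  zero_mem' := ⟨0, by simp⟩
  add_mem' := by
    rintro f g ⟨N, hN⟩ ⟨M, hM⟩
    refine ⟨max N M, fun m => ?_⟩
    have h1 : ∀ K L : ℕ, K ≤ L → ∀ m : ℕ, m % 2 ^ L % 2 ^ K = m % 2 ^ K := fun K L h m =>
      Nat.mod_mod_of_dvd _ (pow_dvd_pow 2 h)
    simp only [BoundedContinuousFunction.coe_add, Pi.add_apply]
    rw [← hN (m % 2 ^ max N M), ← hM (m % 2 ^ max N M), h1 _ _ (le_max_left _ _), h1 _ _ (le_max_right _ _), hN, hM]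
  smul_mem' := by
    rintro c f ⟨N, hN⟩
    exact ⟨N, fun m => by simp [hN]⟩

theorem lift_lem (a : ℕ → ℝ) (t : ℝ) (ht : 0 ≤ t) (hs : ∀ F : Finset ℕ, ∑ n ∈ F, a n ^ 2 ≤ t ^ 2) :
    ∃ u ∈ PerSub.topologicalClosure, ‖u‖ ≤ 6 * t ∧ ∀ m, mu (u * rad m) = a m := by
  rcases eq_or_lt_of_le ht with rfl | ht
  · refine ⟨0, zero_mem _, by simp, fun m => ?_⟩
    have h1 := hs {m}
    have h2 : a m ^ 2 = 0 := le_antisymm (by simpa using h1) (sq_nonneg _)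
    have : a m = 0 := by simpa using h2
    rw [this]; simp
  have hsum : Summable fun n => a n ^ 2 := summable_of_sum_le (fun n => sq_nonneg _) hs
  have htail : ∀ i : ℕ, ∀ᶠ K in atTop, ∀ L, ∑ n ∈ Finset.Ico K L, a n ^ 2 ≤ (t * (1/2) ^ i) ^ 2 := by
    intro i
    have hpos : 0 < (t * (1/2) ^ i) ^ 2 := by positivity
    obtain ⟨F0, hF0⟩ := hsum.vanishing (Metric.ball_mem_nhds (0:ℝ) hpos)
    filter_upwards [eventually_gt_atTop (F0.sup id)] with K hK L
    have := hF0 (Finset.Ico K L) (by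
      rw [Finset.disjoint_left]
      intro n hn hn'
      have h1 : n ≤ F0.sup id := Finset.le_sup (f := id) hn'
      have h2 := (Finset.mem_Ico.1 hn).1
      omega)
    rw [Metric.mem_ball, dist_zero_right] at this
    exact (le_abs_self _).trans this.le
  obtain ⟨φ, hφ, hφt⟩ := Filter.extraction_forall_of_eventually htail
  have hblock : ∀ K L, ∀ s : ℝ, 0 ≤ s → ∑ n ∈ Finset.Ico K L, a n ^ 2 ≤ s ^ 2 →
      ∃ u ∈ PerF, ‖u‖ ≤ 2 * s ∧ ∀ m, mu (u * rad m) = if m ∈ Finset.Ico K L then a m else 0 := by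
    intro K L s hs0 hsq
    refine lift_fin (fun m => if m ∈ Finset.Ico K L then a m else 0) L ?_ s hs0 ?_
    · intro n hn
      rw [if_neg]
      simp only [Finset.mem_Ico]; omega
    · refine le_trans (le_of_eq ?_) hsq
      symm
      refine Finset.sum_subset_zero_on_sdiff (fun n hn => ?_) ?_ ?_
      · simp only [Finset.mem_Ico, Finset.mem_range] at hn ⊢; omega
      · intro n hn
        rw [Finset.mem_sdiff] at hn
        rw [if_neg hn.2]; simp
      · intro n hn
        rw [if_pos hn]
  obtain ⟨v, hv, hvn, hvm⟩ := hblock 0 (φ 0) t ht.le (hs _)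
  choose u hu hun hum using fun i => hblock (φ i) (φ (i+1)) (t * (1/2)^i) (by positivity) (hφt i _)
  have hg : HasSum (fun i : ℕ => 2 * (t * (1/2 : ℝ)^i)) (4 * t) := by
    have := (hasSum_geometric_two).mul_left (2 * t)
    have e1 : 2 * t * 2 = 4 * t := by ring
    rw [e1] at this
    simpa only [mul_assoc] using this
  have hsu : Summable u := Summable.of_norm_bounded hg.summable hun
  have hpart : ∀ k m, mu ((v + ∑ i ∈ Finset.range k, u i) * rad m) = if m < φ k then a m else 0 := by
    intro k m
    induction k with
    | zero => simp [hvm]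
    | succ k ih =>
      rw [Finset.sum_range_succ, ← add_assoc, add_mul, map_add, ih, hum]
      have := hφ (Nat.lt_add_one k)
      by_cases h1 : m < φ k
      · rw [if_pos h1, if_neg (by simp; omega), if_pos (by omega)]; simp
      · by_cases h2 : m < φ (k+1)
        · rw [if_neg h1, if_pos (by simp; omega), if_pos h2]; simp
        · rw [if_neg h1, if_neg (by simp; omega), if_neg h2]; simp
  have hlim : Tendsto (fun k => v + ∑ i ∈ Finset.range k, u i) atTop (𝓝 (v + ∑' i, u i)) :=
    hsu.hasSum.tendsto_sum_nat.const_add v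
  refine ⟨v + ∑' i, u i, ?_, ?_, fun m => ?_⟩
  · rw [← SetLike.mem_coe, Submodule.topologicalClosure_coe]
    refine mem_closure_of_tendsto hlim (Eventually.of_forall fun k => ?_)
    exact PerSub.add_mem hv (PerSub.sum_mem fun i _ => hu i)
  · have := tsum_of_norm_bounded hg hun
    refine (norm_add_le _ _).trans ?_
    linarith
  · have h1 : Tendsto (fun k => mu ((v + ∑ i ∈ Finset.range k, u i) * rad m)) atTop
        (𝓝 (mu ((v + ∑' i, u i) * rad m))) :=
      (mu.continuous.tendsto _).comp (hlim.mul_const _)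
    refine tendsto_nhds_unique h1 (tendsto_const_nhds.congr' ?_)
    filter_upwards [eventually_gt_atTop m] with k hk
    rw [hpart, if_pos (lt_of_lt_of_le hk (hφ.id_le k))]

/-- periodic sets -/
def PerS : Set (Set ℕ) := {B | ∃ N : ℕ, ∀ m, m % 2 ^ N ∈ B ↔ m ∈ B}

theorem isAlg_PerS : IsAlg PerS := by
  refine ⟨⟨0, by simp⟩, ?_, ?_⟩
  · rintro B ⟨N, hN⟩
    exact ⟨N, fun m => not_congr (hN m)⟩
  · rintro B ⟨N, hN⟩ C ⟨M, hM⟩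
    refine ⟨max N M, fun m => ?_⟩
    have h1 : ∀ K L : ℕ, K ≤ L → ∀ m : ℕ, m % 2 ^ L % 2 ^ K = m % 2 ^ K := fun K L h m =>
      Nat.mod_mod_of_dvd _ (pow_dvd_pow 2 h)
    simp only [Set.mem_inter_iff]
    rw [← hN (m % 2 ^ max N M), ← hM (m % 2 ^ max N M), h1 _ _ (le_max_left _ _), h1 _ _ (le_max_right _ _), hN, hM]

theorem countable_PerS : PerS.Countable := by
  have : PerS ⊆ Set.range (fun p : ℕ × Finset ℕ => {m | m % 2 ^ p.1 ∈ p.2}) := by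
    classical
    rintro B ⟨N, hN⟩
    refine ⟨(N, (Finset.range (2 ^ N)).filter (· ∈ B)), ?_⟩
    ext m
    have : m % 2 ^ N < 2 ^ N := Nat.mod_lt _ (by positivity)
    simp [hN, this]
  exact (Set.countable_range _).mono this

theorem null_PerS (B : Set ℕ) (hB : B ∈ PerS) (h0 : mu (ind B) = 0) : B = ∅ := by
  obtain ⟨N, hN⟩ := hB
  by_contra hne
  obtain ⟨m, hm⟩ := Set.nonempty_iff_ne_empty.2 hne
  have h1 : ∀ m, ind B (m % 2 ^ N) = ind B m := fun m => by
    by_cases h : m ∈ B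
    · rw [ind_mem h, ind_mem ((hN m).2 h)]
    · rw [ind_not_mem h, ind_not_mem (fun h' => h ((hN m).1 h'))]
  rw [mu_per h1, avg] at h0
  have h2 : 0 < ∑ m ∈ Finset.range (2 ^ N), ind B m := by
    refine Finset.sum_pos' (fun i _ => ?_) ⟨m % 2 ^ N, ?_, ?_⟩
    · rw [ind_apply]; split_ifs <;> simp
    · exact Finset.mem_range.2 (Nat.mod_lt _ (by positivity))
    · rw [ind_mem ((hN m).2 hm)]; simp
  have : (0:ℝ) < 2 ^ N := by positivity
  exact absurd h0 (div_pos h2 this).ne'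

end SSX

namespace SSX

theorem add_ap (f g : EE) (n : ℕ) : (f + g) n = f n + g n := rfl
theorem sub_ap (f g : EE) (n : ℕ) : (f - g) n = f n - g n := rfl
theorem neg_ap (f : EE) (n : ℕ) : (-f) n = -f n := rfl
theorem mul_ap (f g : EE) (n : ℕ) : (f * g) n = f n * g n := rfl
theorem smul_ap (c : ℝ) (f : EE) (n : ℕ) : (c • f) n = c * f n := rfl
theorem one_ap (n : ℕ) : (1 : EE) n = 1 := rfl
theorem zero_ap (n : ℕ) : (0 : EE) n = 0 := rfl
theorem sum_ap {ι : Type*} (F : Finset ι) (f : ι → EE) (n : ℕ) : (∑ i ∈ F, f i) n = ∑ i ∈ F, f i n := by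
  rw [BoundedContinuousFunction.coe_sum, Finset.sum_apply]

structure Good (𝔅 : Set (Set ℕ)) : Prop where
  alg : IsAlg 𝔅
  per : PerS ⊆ 𝔅
  pos : ∀ B ∈ 𝔅, mu (ind B) = 0 → B = ∅
  prom : ∀ (B : ℕ → Set ℕ) (w : ℕ → ℕ), (∀ k, B k ∈ 𝔅) → Pairwise (Function.onFun Disjoint B) →
        (∀ k j, w k ∉ B j) →
        ∃ 𝒰 : Set (Set ℕ), ¬ 𝒰.Countable ∧ (∀ A ∈ 𝒰, ∀ A' ∈ 𝒰, A ≠ A' → (A ∩ A').Finite) ∧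
          (∀ A ∈ 𝒰, A.Infinite) ∧
          ∀ A ∈ 𝒰, DD B A ∈ 𝔅 ∧ ∀ C ∈ 𝔅, w ⁻¹' C ≠ A

theorem mu_ind_nonneg (B : Set ℕ) : 0 ≤ mu (ind B) :=
  mu_nonneg fun n => by rw [ind_apply]; split_ifs <;> simp

theorem ind_le_ind {B C : Set ℕ} (h : B ⊆ C) (n : ℕ) : ind B n ≤ ind C n := by
  by_cases hn : n ∈ B
  · rw [ind_mem hn, ind_mem (h hn)]
  · rw [ind_not_mem hn, ind_apply]; split_ifs <;> simp

theorem ind_union {B C : Set ℕ} (h : Disjoint B C) : ind (B ∪ C) = ind B + ind C := by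
  ext n
  rw [BoundedContinuousFunction.coe_add, Pi.add_apply]
  by_cases hB : n ∈ B
  · have hC : n ∉ C := Set.disjoint_left.1 h hB
    rw [ind_mem hB, ind_not_mem hC, ind_mem (Or.inl hB)]; simp
  · by_cases hC : n ∈ C
    · rw [ind_not_mem hB, ind_mem hC, ind_mem (Or.inr hC)]; simp
    · rw [ind_not_mem hB, ind_not_mem hC, ind_not_mem (by simp [hB, hC])]; simp

theorem ind_empty : ind ∅ = 0 := by
  ext n; rw [ind_not_mem (by simp)]; rfl

theorem exists_good : ∃ 𝔅, Good 𝔅 := by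
  obtain ⟨𝔅, h1, h2, h3, h4⟩ := exists_alg PerS (fun B => mu (ind B) = 0) isAlg_PerS countable_PerS
    (fun B C h hC => le_antisymm (hC ▸ mu_mono (ind_le_ind h)) (mu_ind_nonneg B))
    (fun B C hB hC => by
      refine le_antisymm ?_ (mu_ind_nonneg _)
      have : mu (ind (B ∪ C)) ≤ mu (ind B + ind C) := mu_mono fun n => by
        simp only [BoundedContinuousFunction.coe_add, Pi.add_apply, ind_apply, Set.mem_union]
        by_cases h1 : n ∈ B <;> by_cases h2 : n ∈ C <;> simp [h1, h2]
      rwa [map_add, hB, hC, add_zero] at this)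
    null_PerS
  exact ⟨𝔅, h1, h2, h3, h4⟩

/-- simple functions -/
def VsS (𝔅 : Set (Set ℕ)) : Set EE := {f | (Set.range f).Finite ∧ ∀ s : Set ℝ, f ⁻¹' s ∈ 𝔅}

section
variable {𝔅 : Set (Set ℕ)}

theorem Vs_op (h : IsAlg 𝔅) {f g k : EE} (hf : f ∈ VsS 𝔅) (hg : g ∈ VsS 𝔅) (op : ℝ → ℝ → ℝ)
    (hk : ∀ n, k n = op (f n) (g n)) : k ∈ VsS 𝔅 := by
  constructor
  · refine ((hf.1.prod hg.1).image fun p => op p.1 p.2).subset ?_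
    rintro _ ⟨n, rfl⟩
    exact ⟨(f n, g n), ⟨⟨n, rfl⟩, ⟨n, rfl⟩⟩, (hk n).symm⟩
  · intro s
    have : k ⁻¹' s = ⋃ p ∈ {p ∈ Set.range f ×ˢ Set.range g | op p.1 p.2 ∈ s}, (f ⁻¹' {p.1} ∩ g ⁻¹' {p.2}) := by
      ext n
      simp only [Set.mem_preimage, Set.mem_iUnion, Set.mem_inter_iff, Set.mem_singleton_iff, exists_prop]
      rw [hk]
      constructor
      · intro hn
        exact ⟨(f n, g n), ⟨⟨⟨n, rfl⟩, ⟨n, rfl⟩⟩, hn⟩, rfl, rfl⟩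
      · rintro ⟨p, ⟨_, hp⟩, h1, h2⟩
        rwa [h1, h2]
    rw [this]
    exact h.biUnion _ ((hf.1.prod hg.1).subset fun p hp => hp.1) _ fun p _ => h.inter _ (hf.2 _) _ (hg.2 _)

theorem Vs_op1 (h : IsAlg 𝔅) {f k : EE} (hf : f ∈ VsS 𝔅) (op : ℝ → ℝ)
    (hk : ∀ n, k n = op (f n)) : k ∈ VsS 𝔅 := Vs_op h hf hf (fun a _ => op a) hk

theorem Vs_const (h : IsAlg 𝔅) {f : EE} (c : ℝ) (hf : ∀ n, f n = c) : f ∈ VsS 𝔅 := by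
  constructor
  · refine (Set.finite_singleton c).subset ?_
    rintro _ ⟨n, rfl⟩; exact hf n
  · intro s
    by_cases hc : c ∈ s
    · have : f ⁻¹' s = Set.univ := by ext n; simp [hf, hc]
      rw [this]; exact h.univ
    · have : f ⁻¹' s = ∅ := by ext n; simp [hf, hc]
      rw [this]; exact h.empty

theorem Vs_ind (h : IsAlg 𝔅) {B : Set ℕ} (hB : B ∈ 𝔅) : ind B ∈ VsS 𝔅 := by
  constructor
  · refine (Set.toFinite ({0, 1} : Set ℝ)).subset ?_
    rintro _ ⟨n, rfl⟩
    rw [ind_apply]; split_ifs <;> simp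
  · intro s
    have hp : ∀ n, n ∈ ind B ⁻¹' s ↔ (n ∈ B ∧ (1:ℝ) ∈ s) ∨ (n ∉ B ∧ (0:ℝ) ∈ s) := by
      intro n
      rw [Set.mem_preimage, ind_apply]
      split_ifs with hn <;> simp [hn]
    by_cases h1 : (1:ℝ) ∈ s <;> by_cases h0 : (0:ℝ) ∈ s
    · have : ind B ⁻¹' s = Set.univ := by ext n; rw [hp]; simp [h1, h0]; tauto
      rw [this]; exact h.univ
    · have : ind B ⁻¹' s = B := by ext n; rw [hp]; simp [h1, h0]
      rw [this]; exact hB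
    · have : ind B ⁻¹' s = Bᶜ := by ext n; rw [hp]; simp [h1, h0]
      rw [this]; exact h.compl _ hB
    · have : ind B ⁻¹' s = ∅ := by ext n; rw [hp]; simp [h1, h0]
      rw [this]; exact h.empty

theorem Vs_mul (h : IsAlg 𝔅) {f g : EE} (hf : f ∈ VsS 𝔅) (hg : g ∈ VsS 𝔅) : f * g ∈ VsS 𝔅 :=
  Vs_op h hf hg (· * ·) fun _ => rfl
theorem Vs_add (h : IsAlg 𝔅) {f g : EE} (hf : f ∈ VsS 𝔅) (hg : g ∈ VsS 𝔅) : f + g ∈ VsS 𝔅 :=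
  Vs_op h hf hg (· + ·) fun _ => rfl
theorem Vs_sub (h : IsAlg 𝔅) {f g : EE} (hf : f ∈ VsS 𝔅) (hg : g ∈ VsS 𝔅) : f - g ∈ VsS 𝔅 :=
  Vs_op h hf hg (· - ·) fun _ => rfl
theorem Vs_smul (h : IsAlg 𝔅) {f : EE} (c : ℝ) (hf : f ∈ VsS 𝔅) : c • f ∈ VsS 𝔅 :=
  Vs_op1 h hf (c * ·) fun _ => rfl

def Vs (h : IsAlg 𝔅) : Submodule ℝ EE where
  carrier := VsS 𝔅
  zero_mem' := Vs_const h 0 fun _ => rfl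
  add_mem' := Vs_add h
  smul_mem' := fun c _ => Vs_smul h c

theorem Vs_per (h : Good 𝔅) {f : EE} (hf : f ∈ PerF) : f ∈ VsS 𝔅 := by
  obtain ⟨N, hN⟩ := hf
  constructor
  · refine ((Set.finite_Iio (2 ^ N)).image f).subset ?_
    rintro _ ⟨n, rfl⟩
    exact ⟨n % 2 ^ N, Nat.mod_lt _ (by positivity), hN n⟩
  · intro s
    exact h.per ⟨N, fun m => by simp [hN]⟩

/-- the big space -/
noncomputable def WW (h : IsAlg 𝔅) : Submodule ℝ EE := (Vs h).topologicalClosure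

theorem Vs_le_WW (h : IsAlg 𝔅) {f : EE} (hf : f ∈ VsS 𝔅) : f ∈ WW h :=
  (Vs h).le_topologicalClosure hf

theorem per_le_WW (h : Good 𝔅) {f : EE} (hf : f ∈ PerSub.topologicalClosure) : f ∈ WW h.alg :=
  Submodule.topologicalClosure_mono (fun _ hg => Vs_per h hg) hf

theorem WW_approx (h : IsAlg 𝔅) {f : EE} (hf : f ∈ WW h) {ε : ℝ} (hε : 0 < ε) :
    ∃ s ∈ VsS 𝔅, ‖f - s‖ < ε := by
  rw [WW, ← SetLike.mem_coe, Submodule.topologicalClosure_coe] at hf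
  obtain ⟨s, hs, hd⟩ := Metric.mem_closure_iff.1 hf ε hε
  exact ⟨s, hs, by rwa [dist_eq_norm] at hd⟩

theorem WW_sep (h : IsAlg 𝔅) {f : EE} (hf : f ∈ WW h) {c d : ℝ} (hcd : c < d) :
    ∃ C ∈ 𝔅, ∀ n, (d ≤ f n → n ∈ C) ∧ (f n ≤ c → n ∉ C) := by
  obtain ⟨s, hs, hd⟩ := WW_approx h hf (ε := (d - c) / 2) (by linarith)
  refine ⟨s ⁻¹' Set.Ioi ((c + d) / 2), hs.2 _, fun n => ?_⟩
  have h1 := (abs_le_norm (f - s) n).trans_lt hd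
  rw [BoundedContinuousFunction.coe_sub, Pi.sub_apply, abs_lt] at h1
  simp only [Set.mem_preimage, Set.mem_Ioi]
  constructor
  · intro h2; linarith
  · intro h2; linarith

theorem rad_mem (h : Good 𝔅) (n : ℕ) : rad n ∈ VsS 𝔅 := by
  refine Vs_per h ⟨n + 1, fun m => ?_⟩
  rw [rad_apply, rad_apply, testBit_mod (Nat.lt_succ_self n)]

/-- our space -/
noncomputable def XX (h : IsAlg 𝔅) : Submodule ℝ EE where
  carrier := {f | f ∈ WW h ∧ ∀ n, mu (f * rad n) = 0}
  zero_mem' := ⟨zero_mem _, fun n => by simp⟩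
  add_mem' := fun {f g} hf hg => ⟨add_mem hf.1 hg.1, fun n => by rw [add_mul, map_add, hf.2, hg.2, add_zero]⟩
  smul_mem' := fun c f hf => ⟨Submodule.smul_mem _ _ hf.1, fun n => by
    rw [smul_mul_assoc, map_smul, hf.2, smul_zero]⟩

theorem XX_closed (h : IsAlg 𝔅) : IsClosed (XX h : Set EE) := by
  have : (XX h : Set EE) = (WW h : Set EE) ∩ ⋂ n, {f | mu (f * rad n) = 0} := by
    ext f; simp [XX]
  rw [this]
  refine (Vs h).isClosed_topologicalClosure.inter (isClosed_iInter fun n => ?_)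
  exact isClosed_eq (mu.continuous.comp (continuous_id.mul continuous_const)) continuous_const

theorem WW_lift (h : Good 𝔅) (f : EE) (t : ℝ) (ht : 0 ≤ t)
    (hs : ∀ F : Finset ℕ, ∑ n ∈ F, mu (f * rad n) ^ 2 ≤ t ^ 2) :
    ∃ u ∈ WW h.alg, ‖u‖ ≤ 6 * t ∧ ∀ m, mu (u * rad m) = mu (f * rad m) := by
  obtain ⟨u, hu, h1, h2⟩ := lift_lem (fun n => mu (f * rad n)) t ht hs
  exact ⟨u, per_le_WW h hu, h1, h2⟩

theorem ind_mul_self (B : Set ℕ) : ind B * ind B = ind B := by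
  ext n
  simp only [BoundedContinuousFunction.coe_mul, Pi.mul_apply, ind_apply]
  split_ifs <;> simp

/-- lift of an indicator -/
theorem ind_lift (h : Good 𝔅) (B : Set ℕ) :
    ∃ u ∈ WW h.alg, ‖u‖ ≤ 6 * Real.sqrt (mu (ind B)) ∧ ∀ m, mu (u * rad m) = mu (ind B * rad m) := by
  refine WW_lift h (ind B) _ (Real.sqrt_nonneg _) fun F => ?_
  rw [Real.sq_sqrt (mu_ind_nonneg B)]
  refine (bessel_rad (ind B) F).trans ?_
  rw [ind_mul_self]

end

/-! ### additivity on almost disjoint families -/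

theorem abs_sum_le (φ : EE →L[ℝ] ℝ) {ι : Type*} (D : ι → Set ℕ) (F : Finset ι)
    (hd : (F : Set ι).Pairwise (Function.onFun Disjoint D)) : ∑ i ∈ F, |φ (ind (D i))| ≤ ‖φ‖ := by
  classical
  set s : ι → ℝ := fun i => SignType.sign (φ (ind (D i))) with hs
  have hsabs : ∀ i, |s i| ≤ 1 := by
    intro i
    simp only [hs]
    rcases lt_trichotomy (φ (ind (D i))) 0 with h | h | h
    · simp [sign_neg h]
    · simp [h]
    · simp [sign_pos h]
  have h1 : ∑ i ∈ F, |φ (ind (D i))| = φ (∑ i ∈ F, s i • ind (D i)) := by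
    rw [map_sum]
    refine Finset.sum_congr rfl fun i _ => ?_
    rw [map_smul, smul_eq_mul, hs, sign_mul_self]
  have h2 : ‖∑ i ∈ F, s i • ind (D i)‖ ≤ 1 := by
    refine norm_le_of zero_le_one fun n => ?_
    rw [BoundedContinuousFunction.coe_sum, Finset.sum_apply]
    by_cases hn : ∃ i ∈ F, n ∈ D i
    · obtain ⟨i, hi, hni⟩ := hn
      rw [Finset.sum_eq_single_of_mem i hi]
      · rw [smul_ap, ind_mem hni]
        simpa using hsabs i
      · intro j hj hji
        rw [smul_ap, ind_not_mem, mul_zero]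
        exact fun hnj => Set.disjoint_left.1 (hd hj hi hji) hnj hni
    · rw [Finset.sum_eq_zero]
      · simp
      · intro j hj
        rw [smul_ap, ind_not_mem, mul_zero]
        exact fun hnj => hn ⟨j, hj, hnj⟩
  rw [h1]
  refine (le_abs_self _).trans ((φ.le_opNorm _).trans ?_)
  nlinarith [norm_nonneg φ]

theorem summable_phi (φ : EE →L[ℝ] ℝ) {B : ℕ → Set ℕ} (hd : Pairwise (Function.onFun Disjoint B)) :
    Summable fun j => φ (ind (B j)) := by
  refine Summable.of_abs ?_
  exact summable_of_sum_le (fun _ => abs_nonneg _) fun F => abs_sum_le φ B F (fun i _ j _ h => hd h)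

noncomputable def psi (φ : EE →L[ℝ] ℝ) (B : ℕ → Set ℕ) (A : Set ℕ) : ℝ :=
  φ (ind (DD B A)) - ∑' j, A.indicator (fun j => φ (ind (B j))) j

theorem psi_diff (φ : EE →L[ℝ] ℝ) {B : ℕ → Set ℕ} (hd : Pairwise (Function.onFun Disjoint B)) (A : Set ℕ)
    (J : Finset ℕ) : psi φ B A = psi φ B (A \ J) := by
  classical
  induction J using Finset.induction_on with
  | empty => simp
  | insert a J _ ih =>
    rw [ih]
    set A' := A \ J
    have e : A \ ((insert a J : Finset ℕ) : Set ℕ) = A' \ {a} := by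
      ext n; simp [A']; tauto
    rw [e]
    by_cases ha : a ∈ A'
    · have h1 : ind (DD B A') = ind (B a) + ind (DD B (A' \ {a})) := by
        rw [← ind_union]
        · congr 1
          ext n
          simp only [mem_DD, Set.mem_union]
          constructor
          · rintro ⟨k, hk, hn⟩
            by_cases hka : k = a
            · exact Or.inl (hka ▸ hn)
            · exact Or.inr ⟨k, ⟨hk, hka⟩, hn⟩
          · rintro (hn | ⟨k, hk, hn⟩)
            · exact ⟨a, ha, hn⟩
            · exact ⟨k, hk.1, hn⟩
        · rw [Set.disjoint_left]
          intro n hn hn'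
          obtain ⟨k, hk, hnk⟩ := mem_DD.1 hn'
          exact Set.disjoint_left.1 (hd hk.2) hnk hn
      have hs := summable_phi φ hd
      have h2 : ∑' j, A'.indicator (fun j => φ (ind (B j))) j =
          φ (ind (B a)) + ∑' j, (A' \ {a}).indicator (fun j => φ (ind (B j))) j := by
        rw [(hs.indicator A').tsum_eq_add_tsum_ite a, Set.indicator_of_mem ha]
        congr 1
        refine tsum_congr fun j => ?_
        by_cases hja : j = a
        · simp [hja]
        · by_cases hj : j ∈ A'
          · rw [Set.indicator_of_mem (show j ∈ A' \ {a} from ⟨hj, hja⟩), Set.indicator_of_mem hj, if_neg hja]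
          · rw [Set.indicator_of_notMem (fun h : j ∈ A' \ {a} => hj h.1), Set.indicator_of_notMem hj, if_neg hja]
      rw [psi, psi, h1, h2, map_add]
      ring
    · rw [Set.diff_singleton_eq_self ha]

theorem psi_finite (φ : EE →L[ℝ] ℝ) {B : ℕ → Set ℕ} (hd : Pairwise (Function.onFun Disjoint B))
    (𝒰 : Set (Set ℕ)) (had : ∀ A ∈ 𝒰, ∀ A' ∈ 𝒰, A ≠ A' → (A ∩ A').Finite) {ε : ℝ} (hε : 0 < ε) :
    {A ∈ 𝒰 | ε < |psi φ B A|}.Finite := by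
  classical
  by_contra hinf
  obtain ⟨N, hN⟩ := exists_nat_gt (2 * ‖φ‖ / ε)
  obtain ⟨F, hF, hFc⟩ := Set.Infinite.exists_subset_card_eq hinf N
  -- a finite set of indices containing all intersections
  have hJ : ∃ J : Finset ℕ, ∀ A ∈ F, ∀ A' ∈ F, A ≠ A' → A ∩ A' ⊆ J := by
    have : (⋃ p ∈ {p : Set ℕ × Set ℕ | p ∈ F ×ˢ F ∧ p.1 ≠ p.2}, p.1 ∩ p.2).Finite := by
      refine Set.Finite.biUnion ((F ×ˢ F).finite_toSet.subset fun p hp => hp.1) ?_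
      rintro ⟨A, A'⟩ ⟨hp, hne⟩
      rw [Finset.mem_product] at hp
      exact had A (hF hp.1).1 A' (hF hp.2).1 hne
    refine ⟨this.toFinset, fun A hA A' hA' hne => ?_⟩
    rw [Set.Finite.coe_toFinset]
    intro n hn
    simp only [Set.mem_iUnion]
    exact ⟨(A, A'), ⟨Finset.mem_product.2 ⟨hA, hA'⟩, hne⟩, hn⟩
  obtain ⟨J, hJ⟩ := hJ
  have hdis : (F : Set (Set ℕ)).Pairwise (Function.onFun Disjoint fun A => A \ (J : Set ℕ)) := by
    intro A hA A' hA' hne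
    rw [Function.onFun, Set.disjoint_left]
    rintro n ⟨h1, h2⟩ ⟨h3, _⟩
    exact h2 (hJ A hA A' hA' hne ⟨h1, h3⟩)
  have h1 : ∑ A ∈ F, |φ (ind (DD B (A \ J)))| ≤ ‖φ‖ := by
    refine abs_sum_le φ (fun A : Set ℕ => DD B (A \ J)) F ?_
    intro A hA A' hA' hne
    rw [Function.onFun, Set.disjoint_left]
    intro n hn hn'
    obtain ⟨k, hk, hnk⟩ := mem_DD.1 hn
    obtain ⟨l, hl, hnl⟩ := mem_DD.1 hn'
    have : k ≠ l := by
      rintro rfl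
      exact Set.disjoint_left.1 (hdis hA hA' hne) hk hl
    exact Set.disjoint_left.1 (hd this) hnk hnl
  have hs := (summable_phi φ hd).abs
  have h2 : ∑ A ∈ F, ∑' j, (A \ (J : Set ℕ)).indicator (fun j => |φ (ind (B j))|) j ≤ ‖φ‖ := by
    rw [← Summable.tsum_finsetSum (fun A _ => hs.indicator _)]
    have h3 : ∀ j, ∑ A ∈ F, (A \ (J : Set ℕ)).indicator (fun j => |φ (ind (B j))|) j ≤ |φ (ind (B j))| := by
      intro j
      by_cases hj : ∃ A ∈ F, j ∈ A \ (J : Set ℕ)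
      · obtain ⟨A, hA, hjA⟩ := hj
        rw [Finset.sum_eq_single_of_mem A hA, Set.indicator_of_mem hjA]
        intro A' hA' hne
        exact Set.indicator_of_notMem (fun h => Set.disjoint_left.1 (hdis hA' hA hne) h hjA) _
      · rw [Finset.sum_eq_zero]
        · exact abs_nonneg _
        · intro A hA
          exact Set.indicator_of_notMem (fun h => hj ⟨A, hA, h⟩) _
    refine (Summable.tsum_le_tsum h3 (summable_sum fun A _ => hs.indicator _) hs).trans ?_
    exact hs.tsum_le_of_sum_le fun G => abs_sum_le φ B G (fun i _ j _ h => hd h)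
  have h3 : ∀ A ∈ F, ε ≤ |φ (ind (DD B (A \ J)))| + ∑' j, (A \ (J : Set ℕ)).indicator (fun j => |φ (ind (B j))|) j := by
    intro A hA
    have h4 := (hF hA).2.le
    rw [psi_diff φ hd A J, psi] at h4
    refine h4.trans ((abs_sub _ _).trans (add_le_add_right ?_ _))
    refine (norm_tsum_le_tsum_norm (f := fun j => (A \ (J : Set ℕ)).indicator (fun j => φ (ind (B j))) j) ?_).trans
      (le_of_eq (tsum_congr fun j => ?_))
    · refine (hs.indicator (A \ (J : Set ℕ))).congr fun j => ?_
      rw [Real.norm_eq_abs]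
      by_cases hj : j ∈ A \ (J : Set ℕ)
      · simp only [Set.indicator_of_mem hj]
      · simp only [Set.indicator_of_notMem hj, abs_zero]
    · rw [Real.norm_eq_abs]
      by_cases hj : j ∈ A \ (J : Set ℕ)
      · simp only [Set.indicator_of_mem hj]
      · simp only [Set.indicator_of_notMem hj, abs_zero]
  have h4 := Finset.sum_le_sum h3
  rw [Finset.sum_add_distrib, Finset.sum_const, hFc, nsmul_eq_mul] at h4
  rw [div_lt_iff₀ hε] at hN
  linarith

theorem psi_countable (φ : EE →L[ℝ] ℝ) {B : ℕ → Set ℕ} (hd : Pairwise (Function.onFun Disjoint B))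
    (𝒰 : Set (Set ℕ)) (had : ∀ A ∈ 𝒰, ∀ A' ∈ 𝒰, A ≠ A' → (A ∩ A').Finite) :
    {A ∈ 𝒰 | psi φ B A ≠ 0}.Countable := by
  have : {A ∈ 𝒰 | psi φ B A ≠ 0} ⊆ ⋃ q : ℕ, {A ∈ 𝒰 | 1 / ((q:ℝ) + 1) < |psi φ B A|} := by
    rintro A ⟨hA, hne⟩
    obtain ⟨q, hq⟩ := exists_nat_one_div_lt (abs_pos.2 hne)
    exact Set.mem_iUnion.2 ⟨q, hA, hq⟩
  exact (Set.countable_iUnion fun q => (psi_finite φ hd 𝒰 had (by positivity)).countable).mono this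

end SSX

namespace SSX
section
variable {𝔅 : Set (Set ℕ)}

noncomputable def muR (m : ℕ) : EE →L[ℝ] ℝ := mu.comp ((ContinuousLinearMap.mul ℝ EE).flip (rad m))
theorem muR_apply (m : ℕ) (f : EE) : muR m f = mu (f * rad m) := rfl

noncomputable def ev (n : ℕ) : EE →L[ℝ] ℝ := BoundedContinuousFunction.evalCLM ℝ n
theorem ev_apply (n : ℕ) (f : EE) : ev n f = f n := rfl

/-- Rosenthal's disjointification lemma -/
theorem rosenthal_aux {δ : ℝ} (hδ : 0 < δ) (n : ℕ) : ∀ (a : ℕ → ℕ → ℝ), (∀ k j, 0 ≤ a k j) →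
    (∀ k, ∀ F : Finset ℕ, k ∉ F → ∑ j ∈ F, a k j ≤ n * δ) →
    ∃ φ : ℕ → ℕ, Function.Injective φ ∧ ∀ k, ∀ F : Finset ℕ, k ∉ F → ∑ j ∈ F, a (φ k) (φ j) ≤ δ := by
  classical
  induction n with
  | zero =>
    intro a ha hs
    exact ⟨id, Function.injective_id, fun k F hF => (hs k F hF).trans (by simp [hδ.le])⟩
  | succ n ih =>
    intro a ha hs
    by_cases h : ∃ p, ∀ k, ∀ F : Finset ℕ, k ∉ F → ∑ j ∈ F, a (Nat.pair p k) (Nat.pair p j) ≤ δ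
    · obtain ⟨p, hp⟩ := h
      exact ⟨fun k => Nat.pair p k, fun x y hxy => (Nat.pair_eq_pair.1 hxy).2, hp⟩
    · push Not at h
      choose k F hF hgt using h
      set κ : ℕ → ℕ := fun p => Nat.pair p (k p) with hκ
      have hinj : Function.Injective κ := fun x y hxy => (Nat.pair_eq_pair.1 hxy).1
      obtain ⟨φ, hφ, hr⟩ := ih (fun p q => a (κ p) (κ q)) (fun _ _ => ha _ _) (by
        intro p G hG
        have h1 := hs (κ p) (G.image κ ∪ (F p).image (fun j => Nat.pair p j)) (by
          simp only [Finset.mem_union, Finset.mem_image, not_or, not_exists, not_and]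
          constructor
          · intro q hq hqp
            exact hG (hinj hqp ▸ hq)
          · intro j hj hjp
            exact hF p ((Nat.pair_eq_pair.1 hjp).2 ▸ hj))
        rw [Finset.sum_union, Finset.sum_image (fun x _ y _ h => hinj h),
          Finset.sum_image (fun x _ y _ h => (Nat.pair_eq_pair.1 h).2)] at h1
        · have := hgt p
          push_cast at h1
          simp only [hκ] at h1 ⊢
          linarith
        · rw [Finset.disjoint_left]
          intro x hx hx'
          obtain ⟨q, hq, rfl⟩ := Finset.mem_image.1 hx
          obtain ⟨j, hj, hjq⟩ := Finset.mem_image.1 hx'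
          have := (Nat.pair_eq_pair.1 hjq).1
          exact hG (this ▸ hq))
      exact ⟨fun p => κ (φ p), hinj.comp hφ, hr⟩

theorem rosenthal {C δ : ℝ} (hδ : 0 < δ) (a : ℕ → ℕ → ℝ) (ha : ∀ k j, 0 ≤ a k j)
    (hs : ∀ k, ∀ F : Finset ℕ, ∑ j ∈ F, a k j ≤ C) :
    ∃ φ : ℕ → ℕ, Function.Injective φ ∧ ∀ k, ∀ F : Finset ℕ, k ∉ F → ∑ j ∈ F, a (φ k) (φ j) ≤ δ := by
  obtain ⟨n, hn⟩ := exists_nat_gt (C / δ)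
  rw [div_lt_iff₀ hδ] at hn
  exact rosenthal_aux hδ n a ha fun k F _ => (hs k F).trans hn.le

/-- choice of lifts of indicators -/
theorem exists_lifts (h : Good 𝔅) (B : ℕ → Set ℕ) (hd : Pairwise (Function.onFun Disjoint B)) :
    ∃ u : ℕ → EE, (∀ k, u k ∈ WW h.alg) ∧ Tendsto (fun k => ‖u k‖) atTop (𝓝 0) ∧
      ∀ k m, mu (u k * rad m) = mu (ind (B k) * rad m) := by
  choose u hu hn hm using fun k => ind_lift h (B k)
  refine ⟨u, hu, ?_, hm⟩
  have h1 := (summable_phi mu hd).tendsto_atTop_zero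
  have h2 : Tendsto (fun k => 6 * Real.sqrt (mu (ind (B k)))) atTop (𝓝 0) := by
    have := ((Real.continuous_sqrt.tendsto 0).comp h1).const_mul 6
    simpa using this
  exact squeeze_zero (fun _ => norm_nonneg _) hn h2

theorem summable_geo {u : ℕ → EE} {η : ℝ} (hu : ∀ k, ‖u k‖ ≤ η * (1/2)^(k+1)) (A : Set ℕ) :
    Summable (A.indicator u) ∧ ‖∑' k, A.indicator u k‖ ≤ η := by
  have hs : HasSum (fun k : ℕ => η * (1/2:ℝ)^(k+1)) η := by
    have := (hasSum_geometric_two.mul_right (1/2:ℝ)).mul_left η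
    simpa [pow_succ] using this
  have hb : ∀ k, ‖A.indicator u k‖ ≤ η * (1/2)^(k+1) := fun k =>
    (norm_indicator_le_norm_self u k).trans (hu k)
  exact ⟨Summable.of_norm_bounded hs.summable hb, tsum_of_norm_bounded hs hb⟩

/-- the basic construction of elements of `X` -/
theorem mem_XX_of (h : Good 𝔅) {B : ℕ → Set ℕ}
    {u : ℕ → EE} (huW : ∀ k, u k ∈ WW h.alg) {η : ℝ} (hu : ∀ k, ‖u k‖ ≤ η * (1/2)^(k+1))
    (hm : ∀ k m, mu (u k * rad m) = mu (ind (B k) * rad m))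
    {A : Set ℕ} (hA : DD B A ∈ 𝔅) (hpsi : ∀ m, psi (muR m) B A = 0) :
    ind (DD B A) - ∑' k, A.indicator u k ∈ XX h.alg := by
  obtain ⟨hs, -⟩ := summable_geo hu A
  constructor
  · refine sub_mem (Vs_le_WW h.alg (Vs_ind h.alg hA)) ?_
    have hc : IsClosed (WW h.alg : Set EE) := (Vs h.alg).isClosed_topologicalClosure
    refine hc.mem_of_tendsto hs.hasSum (Eventually.of_forall fun F => ?_)
    refine Submodule.sum_mem _ fun k _ => ?_
    by_cases hk : k ∈ A
    · rw [Set.indicator_of_mem hk]; exact huW k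
    · rw [Set.indicator_of_notMem hk]; exact zero_mem _
  · intro m
    rw [← muR_apply, map_sub, (muR m).map_tsum hs]
    have h1 := hpsi m
    rw [psi] at h1
    rw [← h1]
    congr 2
    ext k
    by_cases hk : k ∈ A
    · rw [Set.indicator_of_mem hk, Set.indicator_of_mem hk, muR_apply, muR_apply, hm]
    · rw [Set.indicator_of_notMem hk, Set.indicator_of_notMem hk, map_zero]

theorem exists_not_countable {𝒰 : Set (Set ℕ)} (h : ¬ 𝒰.Countable) {V : Set (Set ℕ)} (hV : V.Countable) :
    ∃ A ∈ 𝒰, A ∉ V := by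
  by_contra hc
  push Not at hc
  exact h (hV.mono hc)

theorem lemma1_core (h : Good 𝔅) (Tt : EE →L[ℝ] EE) (hT : ∀ x ∈ XX h.alg, Tt x ∈ WW h.alg)
    {B : ℕ → Set ℕ} (hB : ∀ k, B k ∈ 𝔅) (hd : Pairwise (Function.onFun Disjoint B)) {w : ℕ → ℕ}
    (hw : ∀ k j, w k ∉ B j) {u : ℕ → EE} (huW : ∀ k, u k ∈ WW h.alg) {η : ℝ}
    (hu : ∀ k, ‖u k‖ ≤ η * (1/2)^(k+1))
    (hm : ∀ k m, mu (u k * rad m) = mu (ind (B k) * rad m)) {ε : ℝ} (hε : 0 < ε)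
    (hη : ‖Tt‖ * η ≤ ε / 8) (hoff : ∀ k, ∀ F : Finset ℕ, k ∉ F → ∑ j ∈ F, |Tt (ind (B j)) (w k)| ≤ ε / 8)
    (hdiag : ∀ k, ε ≤ Tt (ind (B k)) (w k)) : False := by
  classical
  obtain ⟨𝒰, h𝒰, had, -, hpr⟩ := h.prom B w hB hd hw
  obtain ⟨A, hA𝒰, hAV⟩ := exists_not_countable h𝒰
    (V := (⋃ m, {A ∈ 𝒰 | psi (muR m) B A ≠ 0}) ∪ ⋃ k, {A ∈ 𝒰 | psi ((ev (w k)).comp Tt) B A ≠ 0})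
    ((Set.countable_iUnion fun m => psi_countable _ hd 𝒰 had).union
      (Set.countable_iUnion fun m => psi_countable _ hd 𝒰 had))
  simp only [Set.mem_union, Set.mem_iUnion, not_or, not_exists, Set.mem_ofPred_eq, not_and, not_not] at hAV
  obtain ⟨hA1, hA2⟩ := hAV
  replace hA1 := fun m => hA1 m hA𝒰
  replace hA2 := fun m => hA2 m hA𝒰
  obtain ⟨hDA, hC⟩ := hpr A hA𝒰
  obtain ⟨hs, hsn⟩ := summable_geo hu A
  have hx := hT _ (mem_XX_of h huW hu hm hDA hA1)
  set v := ∑' k, A.indicator u k with hv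
  have hval : ∀ k, |Tt (ind (DD B A) - v) (w k) - ∑' j, A.indicator (fun j => Tt (ind (B j)) (w k)) j| ≤ ε / 8 := by
    intro k
    have h1 := hA2 k
    rw [psi] at h1
    simp only [ContinuousLinearMap.comp_apply, ev_apply] at h1
    rw [map_sub, sub_ap]
    have h2 : |Tt v (w k)| ≤ ε / 8 := (abs_le_norm _ _).trans ((Tt.le_opNorm v).trans
      ((mul_le_mul_of_nonneg_left hsn (norm_nonneg _)).trans hη))
    rw [show Tt (ind (DD B A)) (w k) - Tt v (w k) - ∑' j, A.indicator (fun j => Tt (ind (B j)) (w k)) j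
      = - Tt v (w k) by linarith, abs_neg]
    exact h2
  have hsum : ∀ k, Summable (A.indicator (fun j => Tt (ind (B j)) (w k))) := fun k =>
    (summable_phi ((ev (w k)).comp Tt) hd).indicator A
  have hle : ∀ k, ∀ F : Finset ℕ, k ∉ F → |∑ j ∈ F, A.indicator (fun j => Tt (ind (B j)) (w k)) j| ≤ ε / 8 := by
    intro k F hF
    refine (Finset.abs_sum_le_sum_abs _ _).trans ((Finset.sum_le_sum fun j _ => ?_).trans (hoff k F hF))
    by_cases hj : j ∈ A
    · rw [Set.indicator_of_mem hj]
    · rw [Set.indicator_of_notMem hj, abs_zero]; exact abs_nonneg _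
  have hin : ∀ k ∈ A, 3 * ε / 4 ≤ Tt (ind (DD B A) - v) (w k) := by
    intro k hk
    have h1 : 7 * ε / 8 ≤ ∑' j, A.indicator (fun j => Tt (ind (B j)) (w k)) j := by
      refine ge_of_tendsto (hsum k).hasSum ((eventually_ge_atTop {k}).mono fun F hF => ?_)
      have hkF : k ∈ F := hF (Finset.mem_singleton_self k)
      rw [← Finset.add_sum_erase F _ hkF, Set.indicator_of_mem hk]
      have h2 := hle k (F.erase k) (Finset.notMem_erase k F)
      rw [abs_le] at h2
      have := hdiag k
      linarith [h2.1]
    have := hval k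
    rw [abs_le] at this
    linarith [this.1]
  have hout : ∀ k, k ∉ A → Tt (ind (DD B A) - v) (w k) ≤ ε / 4 := by
    intro k hk
    have h1 : ∑' j, A.indicator (fun j => Tt (ind (B j)) (w k)) j ≤ ε / 8 := by
      refine le_of_tendsto (hsum k).hasSum (Eventually.of_forall fun F => ?_)
      by_cases hkF : k ∈ F
      · rw [← Finset.add_sum_erase F _ hkF, Set.indicator_of_notMem hk, zero_add]
        exact (abs_le.1 (hle k (F.erase k) (Finset.notMem_erase k F))).2
      · exact (abs_le.1 (hle k F hkF)).2
    have := hval k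
    rw [abs_le] at this
    linarith [this.2]
  obtain ⟨C, hC𝔅, hsep⟩ := WW_sep h.alg hx (c := ε / 4) (d := 3 * ε / 4) (by linarith)
  refine hC C hC𝔅 ?_
  ext k
  constructor
  · intro hk
    by_contra hkA
    exact (hsep (w k)).2 (hout k hkA) hk
  · intro hk
    exact (hsep (w k)).1 (hin k hk)

theorem lemma1_pos (h : Good 𝔅) (Tt : EE →L[ℝ] EE) (hT : ∀ x ∈ XX h.alg, Tt x ∈ WW h.alg)
    {B : ℕ → Set ℕ} (hB : ∀ k, B k ∈ 𝔅) (hd : Pairwise (Function.onFun Disjoint B)) {w : ℕ → ℕ}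
    (hw : ∀ k, w k ∉ B k) {ε : ℝ} (hε : 0 < ε)
    (hdiag : ∀ k, ε ≤ Tt (ind (B k)) (w k)) : False := by
  classical
  set δ := min (ε / 8) (1 / 2) with hδd
  have hδ : 0 < δ := lt_min (by linarith) (by norm_num)
  obtain ⟨φ, hφ, hr⟩ := rosenthal (C := ‖Tt‖ + 1) hδ
    (fun k j => |Tt (ind (B j)) (w k)| + ind (B j) (w k))
    (fun k j => add_nonneg (abs_nonneg _) (by rw [ind_apply]; split_ifs <;> norm_num)) (by
      intro k F
      rw [Finset.sum_add_distrib]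
      refine add_le_add ?_ ?_
      · refine (abs_sum_le ((ev (w k)).comp Tt) B F (fun i _ j _ h => hd h)).trans ?_
        refine ContinuousLinearMap.opNorm_le_bound _ Tt.opNorm_nonneg fun f => ?_
        exact (abs_le_norm _ _).trans (Tt.le_opNorm f)
      · refine (Finset.sum_le_sum fun j _ => le_abs_self _).trans ((abs_sum_le (ev (w k)) B F (fun i _ j _ h => hd h)).trans ?_)
        refine ContinuousLinearMap.opNorm_le_bound _ zero_le_one fun f => ?_
        rw [one_mul]; exact abs_le_norm _ _)
  have hnn : ∀ k j, 0 ≤ ind (B j) (w k) := fun k j => by rw [ind_apply]; split_ifs <;> norm_num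
  have hw' : ∀ k j, w (φ k) ∉ B (φ j) := by
    intro k j hkj
    rcases eq_or_ne k j with rfl | hne
    · exact hw _ hkj
    · have h1 := hr k {j} (by simpa using hne)
      rw [Finset.sum_singleton, ind_mem hkj] at h1
      have : δ ≤ 1 / 2 := min_le_right _ _
      linarith [abs_nonneg (Tt (ind (B (φ j))) (w (φ k)))]
  have hd' : Pairwise (Function.onFun Disjoint (B ∘ φ)) := fun i j hij => hd (hφ.ne hij)
  obtain ⟨u, huW, hu0, hum⟩ := exists_lifts h (B ∘ φ) hd'
  set η := ε / 8 / (‖Tt‖ + 1) with hη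
  have hTp : 0 < ‖Tt‖ + 1 := by positivity
  have hηp : 0 < η := by positivity
  obtain ⟨ψ, hψ, hψu⟩ := extraction_forall_of_eventually (P := fun k n => ‖u n‖ ≤ η * (1/2)^(k+1)) (fun k =>
    hu0.eventually_le_const (by positivity))
  refine lemma1_core h Tt hT (B := fun k => B (φ (ψ k))) (fun k => hB _)
    (fun i j hij => hd (hφ.ne (hψ.injective.ne hij))) (w := fun k => w (φ (ψ k))) (fun k j => hw' _ _)
    (u := fun k => u (ψ k)) (fun k => huW _) hψu (fun k m => hum _ _) hε ?_ ?_ (fun k => hdiag _)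
  · rw [hη, mul_div_assoc', div_le_iff₀ hTp]
    nlinarith
  · intro k F hF
    have h1 := hr (ψ k) (F.image ψ) (by
      intro hk
      obtain ⟨j, hj, hjk⟩ := Finset.mem_image.1 hk
      exact hF (hψ.injective hjk ▸ hj))
    rw [Finset.sum_image (fun x _ y _ h => hψ.injective h)] at h1
    refine (Finset.sum_le_sum fun j _ => ?_).trans (h1.trans (min_le_left _ _))
    linarith [hnn (φ (ψ k)) (φ (ψ j))]

theorem lemma1 (h : Good 𝔅) (Tt : EE →L[ℝ] EE) (hT : ∀ x ∈ XX h.alg, Tt x ∈ WW h.alg)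
    {B : ℕ → Set ℕ} (hB : ∀ k, B k ∈ 𝔅) (hd : Pairwise (Function.onFun Disjoint B)) {w : ℕ → ℕ}
    (hw : ∀ k, w k ∉ B k) {ε : ℝ} (hε : 0 < ε)
    (hdiag : ∀ k, ε ≤ |Tt (ind (B k)) (w k)|) : False := by
  by_cases hi : {k | 0 ≤ Tt (ind (B k)) (w k)}.Infinite
  · have e := hi.natEmbedding
    refine lemma1_pos h Tt hT (B := fun k => B (e k)) (fun k => hB _)
      (fun i j hij => hd (fun hh => hij (e.injective (Subtype.ext hh)))) (w := fun k => w (e k)) (fun k => hw _) hε ?_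
    intro k
    have h1 := hdiag (e k)
    rwa [abs_of_nonneg (e k).2] at h1
  · have hi' : {k | 0 ≤ Tt (ind (B k)) (w k)}ᶜ.Infinite := (Set.not_infinite.1 hi).infinite_compl
    have e := hi'.natEmbedding
    refine lemma1_pos h (-Tt) (fun x hx => by simpa using neg_mem (hT x hx)) (B := fun k => B (e k)) (fun k => hB _)
      (fun i j hij => hd (fun hh => hij (e.injective (Subtype.ext hh)))) (w := fun k => w (e k)) (fun k => hw _) hε ?_
    intro k
    have h1 := hdiag (e k)
    have h2 : ¬ (0 ≤ Tt (ind (B (e k))) (w (e k))) := (e k).2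
    rw [abs_of_neg (not_le.1 h2)] at h1
    exact h1
end
end SSX

namespace SSX
section
variable {𝔅 : Set (Set ℕ)}

/-- cluster value -/
theorem exists_cluster (h : IsAlg 𝔅) (Tt : EE →L[ℝ] EE) (w : ℕ) :
    ∃ g : ℝ, |g| ≤ ‖Tt‖ ∧ ∀ C ∈ 𝔅, w ∈ C → ∀ η > 0, ∃ C' ∈ 𝔅, C' ⊆ C ∧ w ∈ C' ∧ |Tt (ind C') w - g| < η := by
  set I := {C : Set ℕ // C ∈ 𝔅 ∧ w ∈ C}
  set t : I → Set ℝ := fun C => closure {y | ∃ C' ∈ 𝔅, C' ⊆ C.1 ∧ w ∈ C' ∧ y = Tt (ind C') w} with ht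
  have hb : ∀ C : I, {y | ∃ C' ∈ 𝔅, C' ⊆ C.1 ∧ w ∈ C' ∧ y = Tt (ind C') w} ⊆ Set.Icc (-‖Tt‖) ‖Tt‖ := by
    rintro C y ⟨C', -, -, -, rfl⟩
    refine abs_le.1 ((abs_le_norm _ _).trans ((Tt.le_opNorm _).trans ?_))
    exact mul_le_of_le_one_right (norm_nonneg _) (norm_ind_le _)
  have hb' : ∀ C : I, t C ⊆ Set.Icc (-‖Tt‖) ‖Tt‖ := fun C => closure_minimal (hb C) isClosed_Icc
  haveI : Nonempty I := ⟨⟨Set.univ, h.univ, trivial⟩⟩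
  obtain ⟨g, hg⟩ := IsCompact.nonempty_iInter_of_directed_nonempty_isCompact_isClosed t
    (fun C D => ⟨⟨C.1 ∩ D.1, h.inter _ C.2.1 _ D.2.1, C.2.2, D.2.2⟩,
      closure_mono fun y ⟨C', h1, h2, h3⟩ => ⟨C', h1, h2.trans Set.inter_subset_left, h3⟩,
      closure_mono fun y ⟨C', h1, h2, h3⟩ => ⟨C', h1, h2.trans Set.inter_subset_right, h3⟩⟩)
    (fun C => ⟨_, subset_closure ⟨C.1, C.2.1, subset_rfl, C.2.2, rfl⟩⟩)
    (fun C => isCompact_Icc.of_isClosed_subset isClosed_closure (hb' C))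
    (fun C => isClosed_closure)
  rw [Set.mem_iInter] at hg
  refine ⟨g, abs_le.2 (hb' ⟨Set.univ, h.univ, trivial⟩ (hg _)), fun C hC hw η hη => ?_⟩
  obtain ⟨y, ⟨C', h1, h2, h3, rfl⟩, hd⟩ := Metric.mem_closure_iff.1 (hg ⟨C, hC, hw⟩) η hη
  exact ⟨C', h1, h2, h3, by rwa [dist_comm, Real.dist_eq] at hd⟩

/-- vanishing on disjoint sequences -/
def Van (𝔅 : Set (Set ℕ)) (S : EE →L[ℝ] EE) : Prop :=
  ∀ B : ℕ → Set ℕ, (∀ k, B k ∈ 𝔅) → Pairwise (Function.onFun Disjoint B) → ∀ ε > 0, ∃ k, ‖S (ind (B k))‖ < ε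

noncomputable def mulE (g : EE) : EE →L[ℝ] EE := ContinuousLinearMap.mul ℝ EE g
theorem mulE_apply (g f : EE) : mulE g f = g * f := rfl

theorem exists_of_norm {f : EE} {ε : ℝ} (hε : 0 < ε) (h : ε ≤ ‖f‖) : ∃ n, ε / 2 ≤ |f n| := by
  by_contra hc
  push Not at hc
  have := norm_le_of (f := f) (C := ε / 2) (by linarith) fun n => (hc n).le
  linarith

theorem exists_mult (h : Good 𝔅) (Tt : EE →L[ℝ] EE) (hT : ∀ x ∈ XX h.alg, Tt x ∈ WW h.alg) :
    ∃ g : EE, Van 𝔅 (Tt - mulE g) := by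
  choose g hg hc using exists_cluster h.alg Tt
  refine ⟨mkE g ‖Tt‖ hg, fun B hB hd ε hε => ?_⟩
  by_contra hcon
  push Not at hcon
  choose w hw using fun k => exists_of_norm hε (hcon k)
  have key : ∀ k, ∃ D ∈ 𝔅, D ⊆ B k ∧ w k ∉ D ∧ ε / 4 ≤ |Tt (ind D) (w k)| := by
    intro k
    have h1 := hw k
    rw [ContinuousLinearMap.sub_apply, sub_ap, mulE_apply, mul_ap, mkE_apply] at h1
    by_cases hk : w k ∈ B k
    · obtain ⟨C', h2, h3, h4, h5⟩ := hc (w k) (B k) (hB k) hk (ε / 4) (by linarith)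
      refine ⟨B k \ C', h.alg.diff (hB k) h2, Set.diff_subset, fun hh => hh.2 h4, ?_⟩
      have h6 : ind (B k) = ind (B k \ C') + ind C' := by
        rw [← ind_union Set.disjoint_sdiff_left, Set.diff_union_of_subset h3]
      rw [ind_mem hk, mul_one, h6, map_add, add_ap] at h1
      have h7 := abs_add_le (Tt (ind (B k \ C')) (w k)) (Tt (ind C') (w k) - g (w k))
      rw [show Tt (ind (B k \ C')) (w k) + Tt (ind C') (w k) - g (w k) =
        Tt (ind (B k \ C')) (w k) + (Tt (ind C') (w k) - g (w k)) by ring] at h1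
      linarith
    · rw [ind_not_mem hk, mul_zero, sub_zero] at h1
      exact ⟨B k, hB k, subset_rfl, hk, by linarith⟩
  choose D hD hDB hwD hDε using key
  exact lemma1 h Tt hT hD (fun i j hij => (hd hij).mono (hDB i) (hDB j)) hwD (by linarith : 0 < ε / 4) hDε

/-- disjoint periodic sets -/
theorem nonsep (h : Good 𝔅) : ¬ TopologicalSpace.SeparableSpace (XX h.alg) := by
  classical
  intro hsep
  set B : ℕ → Set ℕ := fun k => {m | m % 2 ^ (k + 1) = 2 ^ k} with hBd
  have hB : ∀ k, B k ∈ 𝔅 := fun k => h.per ⟨k + 1, fun m => by simp [hBd]⟩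
  have hd : Pairwise (Function.onFun Disjoint B) := by
    have aux : ∀ i j, i < j → Disjoint (B i) (B j) := by
      intro i j hij
      rw [Set.disjoint_left]
      intro m hm hm'
      have h1 : m % 2 ^ (i + 1) = 2 ^ i := hm
      have h2 : m % 2 ^ (j + 1) = 2 ^ j := hm'
      have h3 : m % 2 ^ (j + 1) % 2 ^ (i + 1) = m % 2 ^ (i + 1) :=
        Nat.mod_mod_of_dvd m (pow_dvd_pow 2 (by omega))
      rw [h2, h1, Nat.mod_eq_zero_of_dvd (pow_dvd_pow 2 (by omega))] at h3
      have : 0 < 2 ^ i := by positivity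
      omega
    intro i j hij
    rcases lt_or_gt_of_ne hij with hh | hh
    · exact aux i j hh
    · exact (aux j i hh).symm
  have hne : ∀ k, 2 ^ k ∈ B k := fun k => Nat.mod_eq_of_lt (Nat.pow_lt_pow_right (by norm_num) (by omega))
  obtain ⟨u, huW, hu0, hum⟩ := exists_lifts h B hd
  obtain ⟨ψ, hψ, hψu⟩ := extraction_forall_of_eventually (P := fun k n => ‖u n‖ ≤ (1/8) * (1/2:ℝ)^(k+1)) (fun k =>
    hu0.eventually_le_const (by positivity))
  set B' : ℕ → Set ℕ := fun k => B (ψ k) with hB'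
  have hd' : Pairwise (Function.onFun Disjoint B') := fun i j hij => hd (hψ.injective.ne hij)
  obtain ⟨𝒰, h𝒰, had, hinf, hpr⟩ := h.prom B' (fun _ => 0) (fun k => hB _) hd' (by
    intro _ j hj
    have h1 : 0 % 2 ^ (ψ j + 1) = 2 ^ (ψ j) := hj
    have : 0 < 2 ^ (ψ j) := by positivity
    rw [Nat.zero_mod] at h1
    omega)
  set 𝒱 := 𝒰 \ ⋃ m, {A ∈ 𝒰 | psi (muR m) B' A ≠ 0} with h𝒱
  have h𝒱c : ¬ 𝒱.Countable := by
    intro hc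
    have : 𝒰 ⊆ 𝒱 ∪ ⋃ m, {A ∈ 𝒰 | psi (muR m) B' A ≠ 0} := by
      intro A hA
      by_cases hh : A ∈ ⋃ m, {A ∈ 𝒰 | psi (muR m) B' A ≠ 0}
      · exact Or.inr hh
      · exact Or.inl ⟨hA, hh⟩
    exact h𝒰 ((hc.union (Set.countable_iUnion fun m => psi_countable _ hd' 𝒰 had)).mono this)
  have hmem : ∀ A : 𝒱, ind (DD B' A.1) - ∑' k, A.1.indicator (fun k => u (ψ k)) k ∈ XX h.alg := by
    intro A
    refine mem_XX_of h (fun k => huW _) hψu (fun k m => hum _ _) (hpr A.1 A.2.1).1 ?_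
    intro m
    by_contra hm
    exact A.2.2 (Set.mem_iUnion.2 ⟨m, A.2.1, hm⟩)
  set x : 𝒱 → XX h.alg := fun A => ⟨_, hmem A⟩ with hx
  have hwlog : ∀ A A' : 𝒱, ∀ k ∈ A.1, k ∉ A'.1 → 1/2 ≤ dist (x A) (x A') := by
    intro A A' k hk hk'
    have h1 : |ind (DD B' A.1) (2 ^ (ψ k)) - ind (DD B' A'.1) (2 ^ ψ k)| = 1 := by
      rw [ind_mem (mem_DD.2 (⟨k, hk, hne _⟩ : ∃ j ∈ A.1, 2 ^ ψ k ∈ B' j)), ind_not_mem]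
      · simp
      · intro hh
        obtain ⟨j, hj, hj'⟩ := mem_DD.1 hh
        refine Set.disjoint_left.1 (hd' (?_ : j ≠ k)) hj' (hne _)
        rintro rfl; exact hk' hj
    have h2 := (summable_geo hψu A.1).2
    have h3 := (summable_geo hψu A'.1).2
    set v := ∑' k, A.1.indicator (fun k => u (ψ k)) k with hv
    set v' := ∑' k, A'.1.indicator (fun k => u (ψ k)) k with hv'
    have h4 : dist (x A) (x A') = ‖(ind (DD B' A.1) - v) - (ind (DD B' A'.1) - v')‖ := by
      show dist ((x A : EE)) (x A' : EE) = _
      exact dist_eq_norm _ _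
    rw [h4]
    have h5 := abs_le_norm ((ind (DD B' A.1) - v) - (ind (DD B' A'.1) - v')) (2 ^ ψ k)
    simp only [sub_ap] at h5
    have h6 := abs_le.1 ((abs_le_norm v (2 ^ ψ k)).trans h2)
    have h7 := abs_le.1 ((abs_le_norm v' (2 ^ ψ k)).trans h3)
    refine le_trans ?_ h5
    have h8 : ∀ a b p q : ℝ, |a - b| = 1 → -(1/8) ≤ p → p ≤ 1/8 → -(1/8) ≤ q → q ≤ 1/8 → 1/2 ≤ |a - p - (b - q)| := by
      intro a b p q hab h1 h2 h3 h4
      rcases abs_cases (a - b) with ⟨h5, h6⟩ | ⟨h5, h6⟩ <;> rcases abs_cases (a - p - (b - q)) with ⟨h7, h8⟩ | ⟨h7, h8⟩ <;> linarith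
    exact h8 _ _ _ _ h1 h6.1 h6.2 h7.1 h7.2
  have hdist : ∀ A A' : 𝒱, A ≠ A' → 1/2 ≤ dist (x A) (x A') := by
    intro A A' hAA
    by_cases hs : A.1 ⊆ A'.1
    · by_cases hs' : A'.1 ⊆ A.1
      · exact absurd (Subtype.ext (hs.antisymm hs')) hAA
      · obtain ⟨k, hk, hk'⟩ := Set.not_subset.1 hs'
        rw [dist_comm]; exact hwlog A' A k hk hk'
    · obtain ⟨k, hk, hk'⟩ := Set.not_subset.1 hs
      exact hwlog A A' k hk hk'
  -- countability
  obtain ⟨D, hDc, hDd⟩ := TopologicalSpace.exists_countable_dense (XX h.alg)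
  choose y hyD hy using fun A : 𝒱 => hDd.exists_dist_lt (x A) (by norm_num : (0:ℝ) < 1/4)
  haveI : Countable D := hDc.to_subtype
  have hinj : Function.Injective (fun A : 𝒱 => (⟨y A, hyD A⟩ : D)) := by
    intro A A' hAA
    by_contra hne'
    have h1 := hdist A A' hne'
    have h2 : y A = y A' := congrArg Subtype.val hAA
    have h3 := dist_triangle_right (x A) (x A') (y A)
    have h4 := hy A
    have h5 := hy A'
    rw [← h2] at h5
    linarith
  exact h𝒱c (Set.countable_coe_iff.1 hinj.countable)
end
end SSX

namespace SSX
section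

def PosF (l : EE →L[ℝ] ℝ) : Prop := ∀ f : EE, (∀ n, 0 ≤ f n) → 0 ≤ l f

theorem PosF.mono {l : EE →L[ℝ] ℝ} (hl : PosF l) {f g : EE} (h : ∀ n, f n ≤ g n) : l f ≤ l g := by
  have := hl (g - f) fun n => by rw [sub_ap]; linarith [h n]
  rw [map_sub] at this
  linarith

noncomputable def PN (p : EE × EE) : EE := mkE (fun n => max (p.1 n + |p.2 n|) 0) (‖p.1‖ + ‖p.2‖) (by
  intro n
  have h1 := abs_le_norm p.1 n
  have h2 := abs_le_norm p.2 n
  rw [abs_of_nonneg (le_max_right _ _)]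
  refine max_le ?_ (by positivity)
  linarith [le_abs_self (p.1 n)])

theorem PN_apply (p : EE × EE) (n : ℕ) : PN p n = max (p.1 n + |p.2 n|) 0 := rfl

theorem exists_majorant (σ : EE →L[ℝ] ℝ) : ∃ ν : EE →L[ℝ] ℝ, PosF ν ∧ (∀ a, |ν a| ≤ ‖σ‖ * ‖a‖) ∧
    ∀ f h : EE, (∀ n, |h n| ≤ f n) → |σ h| ≤ ν f := by
  let f0 : (EE × EE) →ₗ.[ℝ] ℝ :=
    { domain := (⊥ : Submodule ℝ EE).prod ⊤
      toFun := (σ.toLinearMap.comp (LinearMap.snd ℝ EE EE)).comp (Submodule.subtype _) }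
  obtain ⟨g, hg, hgN⟩ := exists_extension_of_le_sublinear f0 (fun p => ‖σ‖ * ‖PN p‖) (by
      intro c hc p
      have : PN (c • p) = c • PN p := by
        ext n
        rw [smul_ap, PN_apply, PN_apply, Prod.smul_fst, Prod.smul_snd, smul_ap, smul_ap, abs_mul, abs_of_pos hc,
          ← mul_add, mul_max_of_nonneg _ _ hc.le, mul_zero]
      simp only [this, norm_smul, Real.norm_eq_abs, abs_of_pos hc]
      ring) (by
      intro p q
      rw [← mul_add]
      refine mul_le_mul_of_nonneg_left ?_ σ.opNorm_nonneg
      refine (norm_le_of (by positivity) fun n => ?_).trans (norm_add_le (PN p) (PN q))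
      refine le_trans ?_ (abs_le_norm _ n)
      have h1 : 0 ≤ PN (p + q) n := le_max_right _ _
      have h2 : PN (p + q) n ≤ (PN p + PN q) n := by
        rw [add_ap, PN_apply, PN_apply, PN_apply, Prod.fst_add, Prod.snd_add, add_ap, add_ap]
        have := abs_add_le (p.2 n) (q.2 n)
        refine max_le ?_ (add_nonneg (le_max_right _ _) (le_max_right _ _))
        linarith [le_max_left (p.1 n + |p.2 n|) 0, le_max_left (q.1 n + |q.2 n|) 0]
      rw [abs_of_nonneg h1]
      exact h2.trans (le_abs_self _)) (by
      rintro ⟨⟨a, b⟩, ha, hb⟩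
      have ha' : a = 0 := ha
      subst ha'
      show σ b ≤ ‖σ‖ * ‖PN (0, b)‖
      refine (le_abs_self _).trans ((σ.le_opNorm b).trans (mul_le_mul_of_nonneg_left ?_ (norm_nonneg _)))
      refine norm_le_of (norm_nonneg _) fun n => le_trans ?_ (abs_le_norm _ n)
      rw [PN_apply, zero_ap, zero_add]
      exact (le_max_left _ _).trans (le_abs_self _))
  have hgs : ∀ b : EE, g (0, b) = σ b := fun b => hg ⟨(0, b), by simp [f0]⟩
  have hnorm : ∀ a, |g (a, 0)| ≤ ‖σ‖ * ‖a‖ := by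
    have : ∀ a : EE, g (a, 0) ≤ ‖σ‖ * ‖a‖ := by
      intro a
      refine (hgN _).trans (mul_le_mul_of_nonneg_left ?_ σ.opNorm_nonneg)
      refine norm_le_of (norm_nonneg _) fun n => ?_
      rw [PN_apply, zero_ap, abs_zero, add_zero, abs_of_nonneg (le_max_right _ _)]
      exact max_le ((le_abs_self _).trans (abs_le_norm _ _)) (norm_nonneg _)
    intro a
    rw [abs_le]
    constructor
    · have h1 := this (-a)
      rw [norm_neg, show ((-a, 0) : EE × EE) = -(a, 0) by simp, map_neg] at h1
      linarith
    · exact this a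
  have hdom : ∀ f h : EE, (∀ n, |h n| ≤ f n) → σ h ≤ g (f, 0) := by
    intro f h hfh
    have h1 := hgN (-f, h)
    have h2 : PN (-f, h) = 0 := by
      ext n
      rw [PN_apply, neg_ap, zero_ap]
      exact max_eq_right (by linarith [hfh n])
    rw [h2, norm_zero, mul_zero, show ((-f, h) : EE × EE) = -(f, 0) + (0, h) by simp, map_add, map_neg, hgs] at h1
    linarith
  refine ⟨LinearMap.mkContinuous (g.comp (LinearMap.inl ℝ EE EE)) ‖σ‖ hnorm, ?_, ?_, ?_⟩
  · intro f hf
    have := hdom f 0 (fun n => by rw [zero_ap, abs_zero]; exact hf n)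
    rw [map_zero] at this
    exact this
  · exact hnorm
  · intro f h hfh
    rw [abs_le']
    refine ⟨hdom f h hfh, ?_⟩
    rw [← map_neg]
    exact hdom f (-h) fun n => by rw [neg_ap, abs_neg]; exact hfh n

/-- a single positive functional controlling all evaluation functionals -/
theorem exists_control (S : EE →L[ℝ] EE) : ∃ l : EE →L[ℝ] ℝ, PosF l ∧
    ∀ (w : ℕ) (f h : EE), (∀ n, |h n| ≤ f n) → |S h w| ≤ 2 ^ (w + 1) * l f := by
  choose ν hpos hnorm hdom using fun w => exists_majorant ((ev w).comp S)
  have hn : ∀ f w, |(1/2:ℝ)^(w+1) * ν w f| ≤ ‖S‖ * ‖f‖ * (1/2)^(w+1) := by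
    intro f w
    rw [abs_mul, abs_of_nonneg (by positivity : (0:ℝ) ≤ (1/2)^(w+1)), mul_comm]
    refine mul_le_mul_of_nonneg_right ((hnorm w f).trans (mul_le_mul_of_nonneg_right ?_ (norm_nonneg _))) (by positivity)
    refine ContinuousLinearMap.opNorm_le_bound _ S.opNorm_nonneg fun f => ?_
    exact (abs_le_norm _ _).trans (S.le_opNorm f)
  have hs0 : ∀ C : ℝ, HasSum (fun w : ℕ => C * (1/2:ℝ)^(w+1)) C := by
    intro C
    have := (hasSum_geometric_two.mul_right (1/2:ℝ)).mul_left C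
    simpa [pow_succ] using this
  have hs : ∀ f, Summable fun w => (1/2:ℝ)^(w+1) * ν w f := fun f => Summable.of_norm_bounded (hs0 _).summable (hn f)
  let L : EE →L[ℝ] ℝ := LinearMap.mkContinuous
    { toFun := fun f => ∑' w, (1/2:ℝ)^(w+1) * ν w f
      map_add' := fun f g => by
        rw [← (hs f).tsum_add (hs g)]
        simp only [map_add, mul_add]
      map_smul' := fun c f => by
        rw [RingHom.id_apply, smul_eq_mul, ← tsum_mul_left]
        refine tsum_congr fun w => ?_
        rw [map_smul, smul_eq_mul]; ring } ‖S‖ (fun f => tsum_of_norm_bounded (hs0 _) (hn f))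
  have hap : ∀ f, HasSum (fun w => (1/2:ℝ)^(w+1) * ν w f) (L f) := fun f => (hs f).hasSum
  refine ⟨L, ?_, ?_⟩
  · intro f hf
    exact (hap f).nonneg fun w => mul_nonneg (by positivity) (hpos w f hf)
  · intro w f h hfh
    have hf : ∀ n, 0 ≤ f n := fun n => (abs_nonneg _).trans (hfh n)
    have h1 : |S h w| ≤ ν w f := hdom w f h hfh
    have h2 := le_hasSum (hap f) w fun j _ => mul_nonneg (by positivity) (hpos j f hf)
    have h3 : ν w f = 2 ^ (w+1) * ((1/2:ℝ)^(w+1) * ν w f) := by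
      rw [← mul_assoc, ← mul_pow]; norm_num
    rw [h3] at h1
    exact h1.trans (mul_le_mul_of_nonneg_left h2 (by positivity))
end

section
variable {𝔅 : Set (Set ℕ)}

def NL (𝔅 : Set (Set ℕ)) (S : EE →L[ℝ] EE) (B : Set ℕ) (r : ℝ) : Prop :=
  ∀ C ∈ 𝔅, C ⊆ B → ‖S (ind C)‖ ≤ r

theorem NL.mono {S : EE →L[ℝ] EE} {B B' : Set ℕ} {r r' : ℝ} (h : NL 𝔅 S B r) (hB : B' ⊆ B) (hr : r ≤ r') :
    NL 𝔅 S B' r' := fun C hC hCB => (h C hC (hCB.trans hB)).trans hr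

theorem NL.union (ha : IsAlg 𝔅) {S : EE →L[ℝ] EE} {B B' : Set ℕ} {r r' : ℝ} (h : NL 𝔅 S B r) (h' : NL 𝔅 S B' r')
    (hB : B ∈ 𝔅) : NL 𝔅 S (B ∪ B') (r + r') := by
  intro C hC hCB
  have h1 : ind C = ind (C ∩ B) + ind (C \ B) := by
    rw [← ind_union (Set.disjoint_sdiff_right.mono_left Set.inter_subset_right), Set.inter_union_diff]
  rw [h1, map_add]
  refine (norm_add_le _ _).trans (add_le_add (h _ (ha.inter _ hC _ hB) Set.inter_subset_right)
    (h' _ (ha.diff hC hB) ?_))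
  rintro x ⟨hx, hx'⟩
  exact (hCB hx).resolve_left hx'

theorem NL_mono_seq {S : EE →L[ℝ] EE} (hV : Van 𝔅 S) {U : ℕ → Set ℕ} (hm : Monotone U) {η : ℝ} (hη : 0 < η) :
    ∃ m0, ∀ m, m0 ≤ m → NL 𝔅 S (U m \ U m0) η := by
  by_contra hcon
  unfold NL at hcon
  push Not at hcon
  choose m hm1 C hC hCU hgt using hcon
  set M : ℕ → ℕ := fun i => Nat.rec 0 (fun _ x => m x) i with hM
  have hMs : ∀ i, M (i + 1) = m (M i) := fun i => rfl
  have hMm : Monotone M := monotone_nat_of_le_succ fun i => hm1 _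
  have aux : ∀ i j, i < j → Disjoint (C (M i)) (C (M j)) := by
    intro i j hij
    rw [Set.disjoint_left]
    intro x hx hx'
    have h1 := (hCU (M i) hx).1
    rw [← hMs] at h1
    exact (hCU (M j) hx').2 (hm (hMm hij) h1)
  obtain ⟨k, hk⟩ := hV (fun i => C (M i)) (fun i => hC _) (by
    intro i j hij
    rcases lt_or_gt_of_ne hij with hh | hh
    · exact aux i j hh
    · exact (aux j i hh).symm) η hη
  exact absurd hk (not_lt.2 (hgt _).le)

theorem exhaustion (ha : IsAlg 𝔅) {S : EE →L[ℝ] EE} (hV : Van 𝔅 S) {l : EE →L[ℝ] ℝ} (hl : PosF l)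
    (hc : ∀ (w : ℕ) (f h : EE), (∀ n, |h n| ≤ f n) → |S h w| ≤ 2 ^ (w + 1) * l f) {ε : ℝ} (hε : 0 < ε) :
    ∃ δ > 0, ∀ E ∈ 𝔅, l (ind E) < δ → NL 𝔅 S E ε := by
  classical
  by_contra hcon
  push Not at hcon
  choose E hE hlE hNE using fun n : ℕ => hcon ((1/2:ℝ)^n) (by positivity)
  set V : ℕ → ℕ → Set ℕ := fun n m => ⋃ j ∈ Finset.Icc n m, E j with hVd
  have hVmono : ∀ n, Monotone (V n) := by
    intro n a b hab x hx
    simp only [hVd, Set.mem_iUnion, Finset.mem_Icc] at hx ⊢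
    obtain ⟨j, hj, hx⟩ := hx
    exact ⟨j, ⟨hj.1, hj.2.trans hab⟩, hx⟩
  have hV𝔅 : ∀ n m, V n m ∈ 𝔅 := fun n m =>
    ha.biUnion (Finset.Icc n m : Set ℕ) (Finset.finite_toSet _) E (fun k _ => hE k)
  choose m hm using fun n => NL_mono_seq hV (hVmono n) (η := ε * (1/2)^(n+3)) (by positivity)
  have hVl : ∀ n k, l (ind (V n (n + k))) ≤ 2 * (1/2)^n - (1/2)^(n+k) := by
    intro n k
    induction k with
    | zero =>
      have : V n (n + 0) = E n := by simp only [hVd, add_zero, Finset.Icc_self, Finset.mem_singleton, Set.iUnion_iUnion_eq_left]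
      rw [this]
      have := (hlE n).le
      simp only [add_zero]
      linarith
    | succ k ih =>
      have h1 : ∀ x, ind (V n (n + (k + 1))) x ≤ (ind (V n (n + k)) + ind (E (n + (k + 1)))) x := by
        intro x
        rw [add_ap]
        have h0 : ∀ B : Set ℕ, 0 ≤ ind B x := fun B => by rw [ind_apply]; split_ifs <;> norm_num
        by_cases hx : x ∈ V n (n + (k + 1))
        · rw [ind_mem hx]
          simp only [hVd, Set.mem_iUnion, Finset.mem_Icc] at hx
          obtain ⟨j, hj, hx⟩ := hx
          rcases Nat.lt_or_ge j (n + (k + 1)) with h2 | h2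
          · rw [ind_mem (show x ∈ V n (n + k) by
              simp only [hVd, Set.mem_iUnion, Finset.mem_Icc]; exact ⟨j, ⟨hj.1, by omega⟩, hx⟩)]
            linarith [h0 (E (n + (k + 1)))]
          · have : j = n + (k + 1) := le_antisymm hj.2 h2
            rw [this] at hx
            rw [ind_mem hx]
            linarith [h0 (V n (n + k))]
        · rw [ind_not_mem hx]
          linarith [h0 (E (n + (k + 1))), h0 (V n (n + k))]
      have h2 := hl.mono h1
      rw [map_add] at h2
      have h3 := (hlE (n + (k + 1))).le
      have h4 : (1/2:ℝ)^(n+k) = 2 * (1/2)^(n+(k+1)) := by rw [← add_assoc, pow_succ]; ring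
      linarith
  set m' : ℕ → ℕ := fun n => max n (m n) with hm'
  set G : ℕ → Set ℕ := fun n => V n (m' n) with hG
  have hGl : ∀ n, l (ind (G n)) ≤ 2 * (1/2)^n := by
    intro n
    have h1 := hVl n (m' n - n)
    rw [Nat.add_sub_cancel' (le_max_left _ _)] at h1
    have : (0:ℝ) ≤ (1/2)^(m' n) := by positivity
    exact h1.trans (by linarith)
  have hGN : ∀ i n, i ≤ n → NL 𝔅 S (E n \ G i) (ε * (1/2)^(i+3)) := by
    intro i n hin
    refine (hm i (max n (m i)) (le_max_right _ _)).mono ?_ le_rfl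
    rintro x ⟨hx, hx'⟩
    refine ⟨?_, fun hh => hx' (hVmono i (le_max_right _ _) hh)⟩
    simp only [hVd, Set.mem_iUnion, Finset.mem_Icc]
    exact ⟨n, ⟨hin, le_max_left _ _⟩, hx⟩
  set H : ℕ → Set ℕ := fun n => (⋃ i ∈ Finset.range n, (G i)ᶜ)ᶜ with hH
  have hH𝔅 : ∀ n, H n ∈ 𝔅 := fun n => ha.compl _ (ha.biUnion (Finset.range n : Set ℕ) (Finset.finite_toSet _)
    (fun i => (G i)ᶜ) (fun k _ => ha.compl _ (hV𝔅 _ _)))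
  have hHmem : ∀ n x, x ∈ H n ↔ ∀ i < n, x ∈ G i := by
    intro n x; simp [hH]
  have hHm : Monotone fun n => (H n)ᶜ := by
    intro a b hab
    refine Set.compl_subset_compl.2 fun x hx => (hHmem _ _).2 fun i hi => (hHmem _ _).1 hx i (by omega)
  obtain ⟨n0, hn0⟩ := NL_mono_seq hV hHm (η := ε / 8) (by linarith)
  have hNH : NL 𝔅 S (H n0) (ε / 4) := by
    intro C hC hCH
    refine norm_le_of (by linarith) fun w => ?_
    obtain ⟨q, hq⟩ : ∃ q : ℕ, 2 ^ (w + 1) * (2 * (1/2:ℝ)^q) < ε / 8 := by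
      have : Tendsto (fun q : ℕ => 2 ^ (w + 1) * (2 * (1/2:ℝ)^q)) atTop (𝓝 (2 ^ (w + 1) * (2 * 0))) :=
        ((tendsto_pow_atTop_nhds_zero_of_lt_one (by norm_num) (by norm_num)).const_mul 2).const_mul _
      rw [mul_zero, mul_zero] at this
      exact (this.eventually_lt_const (by linarith : 0 < ε / 8)).exists
    set p := max n0 (q + 1)
    have h1 : ind C = ind (C \ H p) + ind (C ∩ H p) := by
      rw [← ind_union (Set.disjoint_sdiff_left.mono_right Set.inter_subset_right), Set.diff_union_inter]
    have h2 := (abs_le_norm _ w).trans (hn0 p (le_max_left _ _) (C \ H p) (ha.diff hC (hH𝔅 _))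
      (fun x hx => ⟨hx.2, fun hh => hh (hCH hx.1)⟩))
    have h3 : |S (ind (C ∩ H p)) w| ≤ 2 ^ (w + 1) * l (ind (G q)) := by
      refine hc w _ _ fun x => ?_
      rw [abs_of_nonneg (by rw [ind_apply]; split_ifs <;> norm_num)]
      exact ind_le_ind (fun y hy => (hHmem _ _).1 hy.2 q (lt_of_lt_of_le (Nat.lt_succ_self q) (le_max_right _ _))) x
    have h4 : 2 ^ (w + 1) * l (ind (G q)) ≤ 2 ^ (w + 1) * (2 * (1/2:ℝ)^q) :=
      mul_le_mul_of_nonneg_left (hGl q) (by positivity)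
    rw [h1, map_add, add_ap]
    refine (abs_add_le _ _).trans ?_
    linarith
  have hEH : ∀ k, k ≤ n0 + 1 → NL 𝔅 S (E n0 \ H k) (ε / 4 - ε * (1/2)^(k+2)) := by
    intro k
    induction k with
    | zero =>
      intro _ C hC hCH
      have : C = ∅ := by
        refine Set.eq_empty_of_forall_notMem fun x hx => (hCH hx).2 ((hHmem _ _).2 fun i hi => absurd hi (Nat.not_lt_zero i))
      rw [this, ind_empty, map_zero, norm_zero]
      linarith
    | succ k ih =>
      intro hk
      refine (NL.union ha (ih (by omega)) (hGN k n0 (by omega)) (ha.diff (hE _) (hH𝔅 _))).mono ?_ ?_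
      · rintro x ⟨hx, hx'⟩
        by_cases hxk : x ∈ H k
        · refine Or.inr ⟨hx, fun hxG => hx' ((hHmem _ _).2 fun i hi => ?_)⟩
          rcases Nat.lt_succ_iff_lt_or_eq.1 hi with h1 | rfl
          · exact (hHmem _ _).1 hxk i h1
          · exact hxG
        · exact Or.inl ⟨hx, hxk⟩
      · apply le_of_eq; ring
  refine hNE n0 ((NL.union ha hNH (hEH n0 (by omega)) (hH𝔅 n0)).mono (fun x hx => ?_) ?_)
  · by_cases h : x ∈ H n0
    · exact Or.inl h
    · exact Or.inr ⟨hx, h⟩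
  · have : 0 ≤ ε * (1/2)^(n0+2) := by positivity
    linarith
end
end SSX

namespace SSX
section
variable {𝔅 : Set (Set ℕ)}

theorem ind_nonneg (B : Set ℕ) (n : ℕ) : 0 ≤ ind B n := by rw [ind_apply]; split_ifs <;> norm_num

theorem simple_bound {S : EE →L[ℝ] EE} {f : EE} (hf : f ∈ VsS 𝔅) (ha : IsAlg 𝔅) {B : Set ℕ} (hB : B ∈ 𝔅) {r K : ℝ}
    (hK : ‖f‖ ≤ K) (hN : NL 𝔅 S B r) : ‖S (f * ind B)‖ ≤ K * (2 * r) := by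
  classical
  have hr : 0 ≤ r := (norm_nonneg _).trans (hN ∅ ha.empty (Set.empty_subset _))
  have hK0 : 0 ≤ K := (norm_nonneg f).trans hK
  refine norm_le_of (by positivity) fun w => ?_
  set F := hf.1.toFinset with hF
  have hFm : ∀ n, f n ∈ F := fun n => hf.1.mem_toFinset.2 ⟨n, rfl⟩
  have hFb : ∀ v ∈ F, |v| ≤ K := by
    intro v hv
    obtain ⟨n, rfl⟩ := hf.1.mem_toFinset.1 hv
    exact (abs_le_norm f n).trans hK
  set D : ℝ → Set ℕ := fun v => f ⁻¹' {v} ∩ B with hD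
  have hDap : ∀ v n, ind (D v) n = if f n = v then ind B n else 0 := by
    intro v n
    by_cases h1 : f n = v
    · rw [if_pos h1]
      by_cases h2 : n ∈ B
      · rw [ind_mem h2, ind_mem (show n ∈ D v from ⟨h1, h2⟩)]
      · rw [ind_not_mem h2, ind_not_mem fun hh => h2 hh.2]
    · rw [if_neg h1, ind_not_mem fun hh => h1 hh.1]
  have h1 : f * ind B = ∑ v ∈ F, v • ind (D v) := by
    ext n
    rw [sum_ap, mul_ap, Finset.sum_eq_single (f n)]
    · rw [smul_ap, hDap, if_pos rfl]
    · intro v _ hv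
      rw [smul_ap, hDap, if_neg hv.symm, mul_zero]
    · intro hh; exact absurd (hFm n) hh
  have h2 : ∀ (P : ℝ → Prop) [DecidablePred P], ∑ v ∈ F.filter P, ind (D v) = ind (f ⁻¹' {v | P v} ∩ B) := by
    intro P _
    ext n
    rw [sum_ap]
    by_cases hp : P (f n)
    · rw [Finset.sum_eq_single (f n)]
      · rw [hDap, if_pos rfl]
        by_cases h2 : n ∈ B
        · rw [ind_mem h2, ind_mem (show n ∈ f ⁻¹' {v | P v} ∩ B from ⟨hp, h2⟩)]
        · rw [ind_not_mem h2, ind_not_mem fun hh => h2 hh.2]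
      · intro v _ hv
        rw [hDap, if_neg hv.symm]
      · intro hh; exact absurd (Finset.mem_filter.2 ⟨hFm n, hp⟩) hh
    · rw [ind_not_mem fun hh => hp hh.1]
      refine Finset.sum_eq_zero fun v hv => ?_
      rw [hDap, if_neg]
      rintro rfl
      exact hp (Finset.mem_filter.1 hv).2
  have h3 : ∀ (P : ℝ → Prop) [DecidablePred P], |∑ v ∈ F.filter P, S (ind (D v)) w| ≤ r := by
    intro P _
    have : ∑ v ∈ F.filter P, S (ind (D v)) w = S (ind (f ⁻¹' {v | P v} ∩ B)) w := by
      rw [← h2, map_sum, sum_ap]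
    rw [this]
    exact (abs_le_norm _ _).trans (hN _ (ha.inter _ (hf.2 _) _ hB) Set.inter_subset_right)
  have h4 : ∑ v ∈ F, |S (ind (D v)) w| ≤ 2 * r := by
    rw [← Finset.sum_filter_add_sum_filter_not F (fun v => 0 ≤ S (ind (D v)) w)]
    have h5 := (le_abs_self _).trans (h3 (P := fun v => 0 ≤ S (ind (D v)) w))
    have h6 := (neg_le_abs _).trans (h3 (P := fun v => ¬ 0 ≤ S (ind (D v)) w))
    rw [← Finset.sum_neg_distrib] at h6
    have h7 : ∑ v ∈ F.filter (fun v => 0 ≤ S (ind (D v)) w), |S (ind (D v)) w| =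
        ∑ v ∈ F.filter (fun v => 0 ≤ S (ind (D v)) w), S (ind (D v)) w :=
      Finset.sum_congr rfl fun v hv => abs_of_nonneg (Finset.mem_filter.1 hv).2
    have h8 : ∑ v ∈ F.filter (fun v => ¬ 0 ≤ S (ind (D v)) w), |S (ind (D v)) w| =
        ∑ v ∈ F.filter (fun v => ¬ 0 ≤ S (ind (D v)) w), - S (ind (D v)) w :=
      Finset.sum_congr rfl fun v hv => abs_of_neg (not_le.1 (Finset.mem_filter.1 hv).2)
    rw [h7, h8]
    linarith
  rw [h1, map_sum, sum_ap]
  refine (Finset.abs_sum_le_sum_abs _ _).trans (le_trans (Finset.sum_le_sum fun v hv => ?_)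
    ((Finset.mul_sum F _ K).symm.le.trans (mul_le_mul_of_nonneg_left h4 hK0)))
  rw [map_smul, smul_ap, abs_mul]
  exact mul_le_mul_of_nonneg_right (hFb v hv) (abs_nonneg _)

theorem dom_simple (ha : IsAlg 𝔅) {S : EE →L[ℝ] EE} (hV : Van 𝔅 S) {l : EE →L[ℝ] ℝ} (hl : PosF l)
    (hc : ∀ (w : ℕ) (f h : EE), (∀ n, |h n| ≤ f n) → |S h w| ≤ 2 ^ (w + 1) * l f) {ε : ℝ} (hε : 0 < ε) :
    ∃ δ > 0, ∀ f ∈ VsS 𝔅, ‖f‖ ≤ 2 → l (f * f) < δ → ‖S f‖ ≤ ε := by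
  obtain ⟨δ, hδ, hE⟩ := exhaustion ha hV hl hc (ε := ε / 8) (by linarith)
  have hSp : 0 < ‖S‖ + 1 := by have := S.opNorm_nonneg; linarith
  set η := ε / 2 / (‖S‖ + 1) with hη
  have hηp : 0 < η := by positivity
  refine ⟨δ * η ^ 2, by positivity, fun f hf hf2 hlf => ?_⟩
  set B := f ⁻¹' {v | η < |v|} with hB
  have hB𝔅 : B ∈ 𝔅 := hf.2 _
  have h1 : l (ind B) < δ := by
    have h2 : l (η ^ 2 • ind B) ≤ l (f * f) := by
      refine hl.mono fun n => ?_
      rw [smul_ap, mul_ap]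
      by_cases hn : n ∈ B
      · rw [ind_mem hn]
        have : η < |f n| := hn
        nlinarith [sq_abs (f n)]
      · rw [ind_not_mem hn]; nlinarith [mul_self_nonneg (f n)]
    rw [map_smul, smul_eq_mul] at h2
    have h3 := h2.trans_lt hlf
    have : 0 < η ^ 2 := by positivity
    nlinarith
  have h2 := simple_bound hf ha hB𝔅 hf2 (hE B hB𝔅 h1)
  have h3 : ‖S (f - f * ind B)‖ ≤ ε / 2 := by
    refine (S.le_opNorm _).trans ?_
    have h4 : ‖f - f * ind B‖ ≤ η := by
      refine norm_le_of hηp.le fun n => ?_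
      rw [sub_ap, mul_ap]
      by_cases hn : n ∈ B
      · rw [ind_mem hn, mul_one, sub_self, abs_zero]; exact hηp.le
      · rw [ind_not_mem hn, mul_zero, sub_zero]
        exact not_lt.1 hn
    refine (mul_le_mul_of_nonneg_left h4 S.opNorm_nonneg).trans ?_
    rw [hη, mul_div_assoc', div_le_iff₀ hSp]
    nlinarith
  have h5 : S f = S (f - f * ind B) + S (f * ind B) := by rw [← map_add]; congr 1; abel
  rw [h5]
  refine (norm_add_le _ _).trans ?_
  linarith

theorem dom (ha : IsAlg 𝔅) (S : EE →L[ℝ] EE) (hV : Van 𝔅 S) : ∃ l : EE →L[ℝ] ℝ, PosF l ∧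
    ∀ ε > 0, ∃ δ > 0, ∀ f ∈ WW ha, ‖f‖ ≤ 1 → l (f * f) < δ → ‖S f‖ ≤ ε := by
  obtain ⟨l, hl, hc⟩ := exists_control S
  refine ⟨l, hl, fun ε hε => ?_⟩
  obtain ⟨δ, hδ, hs⟩ := dom_simple ha hV hl hc (ε := ε / 2) (by linarith)
  refine ⟨δ, hδ, fun f hf hf1 hlf => ?_⟩
  rw [WW, ← SetLike.mem_coe, Submodule.topologicalClosure_coe, mem_closure_iff] at hf
  obtain ⟨s, ⟨⟨hs1, hs2⟩, hs3⟩, hsV⟩ := hf ({s | l (s * s) < δ} ∩ {s | ‖s‖ < 2} ∩ {s | ‖S (f - s)‖ < ε / 2})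
    (((isOpen_lt (l.continuous.comp (continuous_id.mul continuous_id)) continuous_const).inter
      (isOpen_lt continuous_norm continuous_const)).inter
      (isOpen_lt (S.continuous.comp (continuous_const.sub continuous_id)).norm continuous_const))
    ⟨⟨hlf, lt_of_le_of_lt hf1 (by norm_num)⟩, by
      show ‖S (f - f)‖ < ε / 2
      rw [sub_self, map_zero, norm_zero]; linarith⟩
  have hs1' : l (s * s) < δ := hs1
  have hs2' : ‖s‖ < 2 := hs2
  have hs3' : ‖S (f - s)‖ < ε / 2 := hs3
  have h1 := hs s hsV hs2'.le hs1'
  have h5 : S f = S (f - s) + S s := by rw [← map_add]; congr 1; abel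
  rw [h5]
  refine (norm_add_le _ _).trans ?_
  linarith
end
end SSX

namespace SSX
section
variable {𝔅 : Set (Set ℕ)}

/-- the conclusion of `dom` -/
def DomBy (ha : IsAlg 𝔅) (S : EE →L[ℝ] EE) (l : EE →L[ℝ] ℝ) : Prop :=
  ∀ ε > 0, ∃ δ > 0, ∀ f ∈ WW ha, ‖f‖ ≤ 1 → l (f * f) < δ → ‖S f‖ ≤ ε

noncomputable def absE (f : EE) : EE := mkE (fun n => |f n|) ‖f‖ (fun n => by rw [abs_abs]; exact abs_le_norm f n)
theorem absE_apply (f : EE) (n : ℕ) : absE f n = |f n| := rfl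

theorem PosF.bound {l : EE →L[ℝ] ℝ} (hl : PosF l) (f : EE) : |l f| ≤ l 1 * ‖f‖ := by
  have h1 : l f ≤ l (‖f‖ • 1) := hl.mono fun n => by
    rw [smul_ap, one_ap, mul_one]; exact (le_abs_self _).trans (abs_le_norm f n)
  have h2 : l (-(‖f‖ • 1)) ≤ l f := hl.mono fun n => by
    rw [neg_ap, smul_ap, one_ap, mul_one]; linarith [neg_abs_le (f n), abs_le_norm f n]
  rw [map_neg] at h2
  rw [map_smul, smul_eq_mul] at h1 h2
  rw [abs_le]
  constructor <;> linarith

theorem PosF.one_nonneg {l : EE →L[ℝ] ℝ} (hl : PosF l) : 0 ≤ l 1 := hl 1 fun n => by rw [one_ap]; norm_num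

theorem hyper_lim (a : ℕ → ℝ) (C : ℝ) (h : ∀ n, |a n| ≤ C) : ∃ L, Tendsto a (hyperfilter ℕ) (𝓝 L) := by
  have hc : IsCompact (Set.Icc (-C) C) := isCompact_Icc
  obtain ⟨l, -, hl⟩ := hc.ultrafilter_le_nhds ((hyperfilter ℕ).map a) (by
    rw [Ultrafilter.coe_map, le_principal_iff]
    exact Filter.mem_map.2 (Filter.univ_mem' fun N => abs_le.1 (h N)))
  exact ⟨l, hl⟩

theorem almost_orth (ha : IsAlg 𝔅) {S : EE →L[ℝ] EE} {l : EE →L[ℝ] ℝ} (hl : PosF l) (hdom : DomBy ha S l)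
    (f : ℕ → EE) (hf : ∀ n, f n ∈ WW ha) {R : ℝ} (hR : 1 ≤ R) (hfR : ∀ n, ‖f n‖ ≤ R) (rr : ℕ → EE)
    (hr1 : ∀ n m, |rr n m| = 1) (hrn : ∀ F : EE, Tendsto (fun n => mu (F * rr n)) atTop (𝓝 0))
    {κ : ℝ} (hκ : 0 < κ) (hfκ : ∀ n, 3 * κ / 4 ≤ |mu (S (f n) * rr n)|) : False := by
  classical
  have hRp : 0 < R := by linarith
  obtain ⟨δ, hδ, hD⟩ := hdom (κ / (8 * R)) (by positivity)
  have hl1 := hl.one_nonneg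
  set t := δ * R ^ 2 with ht
  have htp : 0 < t := by positivity
  have hmuabs : ∀ (F : EE) n, |mu (F * rr n)| ≤ mu (absE F) := by
    intro F n
    rw [abs_le', ← map_neg]
    constructor <;> refine mu_mono fun m => ?_
    · rw [mul_ap, absE_apply]
      refine (le_abs_self _).trans ?_
      rw [abs_mul, hr1, mul_one]
    · rw [neg_ap, mul_ap, absE_apply]
      refine (neg_le_abs _).trans ?_
      rw [abs_mul, hr1, mul_one]
  obtain ⟨H, hHP, hHr⟩ := exists_seq_of_forall_finset_exists
    (P := fun x : EE => x ∈ WW ha ∧ ‖x‖ ≤ 2 * R ∧ κ / 2 ≤ mu (absE (S x))) (r := fun x y => |l (x * y)| ≤ t) (by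
    intro s hs
    have hlim : ∀ x : EE, ∃ L, Tendsto (fun n => l (x * f n)) (hyperfilter ℕ) (𝓝 L) := by
      intro x
      refine hyper_lim _ (l 1 * (‖x‖ * R)) fun n => (hl.bound _).trans (mul_le_mul_of_nonneg_left ?_ hl1)
      exact (norm_mul_le _ _).trans (mul_le_mul_of_nonneg_left (hfR n) (norm_nonneg _))
    choose L hL using hlim
    have hev : ∀ᶠ n in (hyperfilter ℕ : Filter ℕ), ∀ x ∈ s, |l (x * f n) - L x| < t / 2 := by
      rw [Filter.eventually_all_finset]
      intro x _
      have := (hL x).eventually (Metric.ball_mem_nhds (L x) (by linarith : 0 < t / 2))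
      exact this.mono fun n hn => by rwa [Real.dist_eq] at hn
    obtain ⟨p, hp⟩ := hev.exists
    have h2 : ∀ᶠ q in (hyperfilter ℕ : Filter ℕ), |mu (S (f p) * rr q)| < κ / 4 := by
      have h3 := (hrn (S (f p))).eventually (Metric.ball_mem_nhds 0 (by linarith : 0 < κ / 4))
      refine (h3.filter_mono ?_).mono fun n hn => by rwa [Real.dist_eq, sub_zero] at hn
      rw [← Nat.cofinite_eq_atTop]; exact hyperfilter_le_cofinite
    obtain ⟨q, hq1, hq2⟩ := (hev.and h2).exists
    refine ⟨f q - f p, ⟨sub_mem (hf _) (hf _), ?_, ?_⟩, fun x hx => ?_⟩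
    · refine (norm_sub_le _ _).trans ?_
      linarith [hfR p, hfR q]
    · refine le_trans ?_ (hmuabs _ q)
      rw [map_sub, sub_mul, map_sub]
      have h4 := abs_sub_abs_le_abs_sub (mu (S (f q) * rr q)) (mu (S (f p) * rr q))
      have := hfκ q
      linarith
    · rw [mul_sub, map_sub]
      have h5 := hp x hx
      have h6 := hq1 x hx
      rw [abs_lt] at h5 h6
      rw [abs_le]
      constructor <;> linarith [h5.1, h5.2, h6.1, h6.2])
  obtain ⟨N, hN⟩ := exists_nat_gt (2 * l 1 / δ + 1)
  have hN1 : (1:ℝ) < N := by have : 0 ≤ 2 * l 1 / δ := by positivity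
                             linarith
  have hNp : (0:ℝ) < N := by linarith
  have hNl : 2 * l 1 < δ * N := by
    have : 2 * l 1 / δ < N := by linarith
    rw [div_lt_iff₀ hδ] at this; linarith
  have hpair : ∀ i j, i ≠ j → |l (H i * H j)| ≤ t := by
    intro i j hij
    rcases lt_or_gt_of_ne hij with h1 | h1
    · exact hHr i j h1
    · rw [mul_comm]; exact hHr j i h1
  have key : ∀ θ : ℕ → ℝ, (∀ i, |θ i| ≤ 1) → ‖S (∑ i ∈ Finset.range N, θ i • H i)‖ ≤ N * κ / 4 := by
    intro θ hθ
    set z := ∑ i ∈ Finset.range N, θ i • H i with hz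
    have hzW : z ∈ WW ha := Submodule.sum_mem _ fun i _ => Submodule.smul_mem _ _ (hHP i).1
    have hzn : ‖z‖ ≤ N * (2 * R) := by
      refine (norm_sum_le _ _).trans ?_
      refine (Finset.sum_le_sum (g := fun _ => 2 * R) fun i _ => ?_).trans (by simp)
      rw [norm_smul, Real.norm_eq_abs]
      have := mul_le_mul (hθ i) (hHP i).2.1 (norm_nonneg _) zero_le_one
      linarith
    have hzl : l (z * z) ≤ N * (l 1 * (4 * R ^ 2)) + N * (N * t) := by
      have e1 : z * z = ∑ i ∈ Finset.range N, ∑ j ∈ Finset.range N, (θ i * θ j) • (H i * H j) := by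
        rw [hz, Finset.sum_mul_sum]
        refine Finset.sum_congr rfl fun i _ => Finset.sum_congr rfl fun j _ => ?_
        rw [smul_mul_smul_comm]
      rw [e1, map_sum]
      have e2 : ∀ i ∈ Finset.range N, l (∑ j ∈ Finset.range N, (θ i * θ j) • (H i * H j)) ≤ l 1 * (4 * R ^ 2) + N * t := by
        intro i hi
        rw [map_sum]
        have hθθ : ∀ j, |θ i * θ j| ≤ 1 := fun j => by
          rw [abs_mul]; exact mul_le_one₀ (hθ i) (abs_nonneg _) (hθ j)
        rw [← Finset.add_sum_erase _ _ hi]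
        refine add_le_add ?_ ?_
        · rw [map_smul, smul_eq_mul]
          refine (le_abs_self _).trans ?_
          rw [abs_mul]
          have h1 : |l (H i * H i)| ≤ l 1 * (4 * R ^ 2) := by
            refine (hl.bound _).trans (mul_le_mul_of_nonneg_left ?_ hl1)
            refine (norm_mul_le _ _).trans ?_
            have := (hHP i).2.1
            nlinarith [norm_nonneg (H i)]
          have := mul_le_mul (hθθ i) h1 (abs_nonneg _) zero_le_one
          linarith
        · refine (Finset.sum_le_card_nsmul _ _ t fun j hj => ?_).trans ?_
          · rw [map_smul, smul_eq_mul]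
            refine (le_abs_self _).trans ?_
            rw [abs_mul]
            have := mul_le_mul (hθθ j) (hpair i j (Finset.ne_of_mem_erase hj).symm) (abs_nonneg _) zero_le_one
            linarith
          · rw [nsmul_eq_mul]
            refine mul_le_mul_of_nonneg_right ?_ htp.le
            have := Finset.card_erase_le (s := Finset.range N) (a := i)
            rw [Finset.card_range] at this
            exact_mod_cast this
      refine (Finset.sum_le_card_nsmul _ _ _ e2).trans ?_
      rw [Finset.card_range, nsmul_eq_mul, mul_add]
    set a := (N * (2 * R))⁻¹ with haD
    have hap : 0 < a := by positivity
    have haN : a * (N * (2 * R)) = 1 := inv_mul_cancel₀ (by positivity)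
    have h1 := hD (a • z) (Submodule.smul_mem _ _ hzW) (by
      rw [norm_smul, Real.norm_of_nonneg hap.le, ← haN]
      exact mul_le_mul_of_nonneg_left hzn hap.le) (by
      rw [smul_mul_smul_comm, map_smul, smul_eq_mul]
      have h2 : N * (l 1 * (4 * R ^ 2)) + N * (N * t) < δ * (N * (2 * R)) ^ 2 := by
        rw [ht]
        have h3 : N * R ^ 2 * (2 * l 1) < N * R ^ 2 * (δ * N) := mul_lt_mul_of_pos_left hNl (by positivity)
        nlinarith [show 0 < N ^ 2 * R ^ 2 * δ by positivity]
      have h4 : a * a * l (z * z) < a * a * (δ * (N * (2 * R)) ^ 2) :=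
        mul_lt_mul_of_pos_left (lt_of_le_of_lt hzl h2) (by positivity)
      have h5 : a * a * (δ * (N * (2 * R)) ^ 2) = δ := by
        calc _ = δ * (a * (N * (2 * R))) ^ 2 := by ring
          _ = δ := by rw [haN]; ring
      linarith)
    rw [map_smul, norm_smul, Real.norm_of_nonneg hap.le] at h1
    have h6 := mul_le_mul_of_nonneg_left h1 (by positivity : 0 ≤ (N * (2 * R)))
    rw [← mul_assoc, mul_comm (N * (2 * R)) a, haN, one_mul] at h6
    refine h6.trans (le_of_eq ?_)
    field_simp
    ring
  have hpt : ∀ w, (∑ i ∈ Finset.range N, absE (S (H i))) w ≤ (N * κ / 4) • (1 : EE) w := by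
    intro w
    have h1 := (le_abs_self _).trans ((abs_le_norm _ w).trans (key (fun i => SignType.sign (S (H i) w)) (fun i => by
      rcases lt_trichotomy (S (H i) w) 0 with h | h | h
      · simp [h]
      · simp [h]
      · simp [h])))
    rw [map_sum, sum_ap] at h1
    rw [sum_ap, one_ap, smul_eq_mul, mul_one]
    refine le_trans (le_of_eq (Finset.sum_congr rfl fun i _ => ?_)) h1
    rw [absE_apply, map_smul, smul_ap, sign_mul_self]
  have hfin := mu_mono (f := ∑ i ∈ Finset.range N, absE (S (H i))) (g := (N * κ / 4) • (1 : EE)) hpt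
  rw [map_sum, map_smul, mu_one, smul_eq_mul, mul_one] at hfin
  have hlow : N * (κ / 2) ≤ ∑ i ∈ Finset.range N, mu (absE (S (H i))) := by
    have := Finset.card_nsmul_le_sum (Finset.range N) (fun i => mu (absE (S (H i)))) (κ / 2) fun i _ => (hHP i).2.2
    rwa [Finset.card_range, nsmul_eq_mul] at this
  nlinarith
end
end SSX

namespace SSX
section
variable {𝔅 : Set (Set ℕ)}

theorem XX_le_WW (h : IsAlg 𝔅) {f : EE} (hf : f ∈ XX h) : f ∈ WW h := hf.1

theorem step4 (h : Good 𝔅) (Tt : EE →L[ℝ] EE) (hT : ∀ x ∈ XX h.alg, Tt x ∈ XX h.alg) (g : EE)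
    (hV : Van 𝔅 (Tt - mulE g)) {φ : EE} (hφ : φ ∈ VsS 𝔅) (hφ0 : mu φ = 0) : mu (g * φ) = 0 := by
  by_contra hne
  set κ := |mu (g * φ)| with hκd
  have hκ : 0 < κ := abs_pos.2 hne
  obtain ⟨l, hl, hdom⟩ := dom h.alg _ hV
  set t := min (1/6) (κ / (24 * (‖g‖ + 1))) with ht
  have hgp : 0 < ‖g‖ + 1 := by positivity
  have htp : 0 < t := lt_min (by norm_num) (by positivity)
  have ht1 : 6 * t ≤ 1 := by have := min_le_left (1/6) (κ / (24 * (‖g‖ + 1))); linarith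
  have ht2 : ‖g‖ * (6 * t) ≤ κ / 4 := by
    have h1 : t ≤ κ / (24 * (‖g‖ + 1)) := min_le_right _ _
    rw [le_div_iff₀ (by positivity)] at h1
    nlinarith
  obtain ⟨n0, hn0⟩ := eventually_atTop.1 (pairs_small φ hφ0 (ε := t ^ 2) (by positivity))
  choose u huW hun hum using fun k => WW_lift h (rad (n0 + k) * φ) t htp.le (hn0 (n0 + k) (by omega))
  have hfX : ∀ k, rad (n0 + k) * φ - u k ∈ XX h.alg := by
    intro k
    refine ⟨sub_mem (Vs_le_WW h.alg (Vs_mul h.alg (rad_mem h _) hφ)) (huW k), fun m => ?_⟩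
    rw [sub_mul, map_sub, hum, sub_self]
  refine almost_orth h.alg hl hdom (fun k => rad (n0 + k) * φ - u k) (fun k => (hfX k).1) (R := ‖φ‖ + 1)
    (by linarith [norm_nonneg φ]) (fun k => ?_) (fun k => rad (n0 + k)) (fun k m => abs_rad _ _) (fun F => ?_) hκ (fun k => ?_)
  · refine (norm_sub_le _ _).trans (add_le_add ?_ ((hun k).trans ht1))
    refine (norm_mul_le _ _).trans ?_
    exact mul_le_of_le_one_left (norm_nonneg _) (norm_rad_le _)
  · exact (mu_rad_tendsto F).comp (tendsto_atTop_mono (fun k => Nat.le_add_left k n0) tendsto_id)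
  · rw [ContinuousLinearMap.sub_apply, mulE_apply, sub_mul, map_sub, (hT _ (hfX k)).2, zero_sub, abs_neg]
    have h1 : g * (rad (n0 + k) * φ - u k) * rad (n0 + k) = g * φ - g * u k * rad (n0 + k) := by
      ext m
      simp only [mul_ap, sub_ap]
      have := rad_sq (n0 + k) m
      linear_combination g m * φ m * this
    rw [h1, map_sub]
    have h2 : |mu (g * u k * rad (n0 + k))| ≤ κ / 4 := by
      refine (mu_le_norm _).trans ((norm_mul_le _ _).trans ((mul_le_of_le_one_right (norm_nonneg _) (norm_rad_le _)).trans
        ((norm_mul_le _ _).trans ((mul_le_mul_of_nonneg_left (hun k) (norm_nonneg _)).trans ht2))))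
    have h3 := abs_sub_abs_le_abs_sub (mu (g * φ)) (mu (g * u k * rad (n0 + k)))
    linarith

theorem step4' (h : Good 𝔅) (Tt : EE →L[ℝ] EE) (hT : ∀ x ∈ XX h.alg, Tt x ∈ XX h.alg) (g : EE)
    (hV : Van 𝔅 (Tt - mulE g)) {E : Set ℕ} (hE : E ∈ 𝔅) : mu (g * ind E) = mu g * mu (ind E) := by
  have h1 := step4 h Tt hT g hV (φ := ind E - mu (ind E) • 1)
    (Vs_sub h.alg (Vs_ind h.alg hE) (Vs_const h.alg (mu (ind E)) fun n => by rw [smul_ap, one_ap, mul_one]))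
    (by rw [map_sub, map_smul, mu_one]; simp)
  rw [mul_sub, map_sub, mul_smul_comm, mul_one, map_smul, smul_eq_mul] at h1
  linarith

theorem van_eventually {S : EE →L[ℝ] EE} (hV : Van 𝔅 S) {B : ℕ → Set ℕ} (hB : ∀ k, B k ∈ 𝔅)
    (hd : Pairwise (Function.onFun Disjoint B)) {ε : ℝ} (hε : 0 < ε) : ∀ᶠ k in atTop, ‖S (ind (B k))‖ < ε := by
  by_contra hc
  obtain ⟨ψ, hψ, hψ'⟩ := extraction_of_frequently_atTop (not_eventually.1 hc)
  obtain ⟨k, hk⟩ := hV (fun k => B (ψ k)) (fun k => hB _) (fun i j hij => hd (hψ.injective.ne hij)) ε hε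
  exact hψ' k hk

theorem step5 (h : Good 𝔅) (Tt : EE →L[ℝ] EE) (hT : ∀ x ∈ XX h.alg, Tt x ∈ XX h.alg) (g : EE)
    (hV : Van 𝔅 (Tt - mulE g)) : Van 𝔅 (Tt - mu g • ContinuousLinearMap.id ℝ EE) := by
  intro B hB hd ε hε
  obtain ⟨u, huW, hu0, hum⟩ := exists_lifts h B hd
  have hTp : 0 < ‖Tt‖ + 1 := by have := Tt.opNorm_nonneg; linarith
  obtain ⟨k, hk1, hk2⟩ := ((van_eventually hV hB hd (ε := ε / 20) (by linarith)).and
    (hu0.eventually_lt_const (by positivity : 0 < ε / 20 / (‖Tt‖ + 1)))).exists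
  refine ⟨k, ?_⟩
  set c := mu g with hc
  set b := ind (B k) with hb
  set y := Tt (b - u k) with hy
  have hyW : y ∈ WW h.alg := by
    refine (hT _ ⟨sub_mem (Vs_le_WW h.alg (Vs_ind h.alg (hB k))) (huW k), fun m => ?_⟩).1
    rw [sub_mul, map_sub, hum, sub_self]
  have hk3 : ‖Tt (u k)‖ ≤ ε / 20 := by
    refine (Tt.le_opNorm _).trans ?_
    rw [lt_div_iff₀ hTp] at hk2
    nlinarith [norm_nonneg (u k)]
  have hyg : ∀ n ∈ B k, |g n - y n| ≤ ε / 10 := by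
    intro n hn
    have h1 : g * b - y = Tt (u k) - (Tt - mulE g) b := by
      rw [hy, ContinuousLinearMap.sub_apply, mulE_apply, map_sub]; abel
    have h2 : ‖g * b - y‖ ≤ ε / 10 := by
      rw [h1]; refine (norm_sub_le _ _).trans ?_; linarith
    have h3 := (abs_le_norm (g * b - y) n).trans h2
    rwa [sub_ap, mul_ap, hb, ind_mem hn, mul_one] at h3
  have hgc : ∀ n ∈ B k, |g n - c| ≤ ε / 2 := by
    intro n hn
    by_contra hcon
    rw [not_le, lt_abs] at hcon
    have hyn := abs_le.1 (hyg n hn)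
    rcases hcon with hcon | hcon
    · obtain ⟨C, hC, hsep⟩ := WW_sep h.alg hyW (c := c + ε / 5) (d := c + 2 * ε / 5) (by linarith)
      have hE : C ∩ B k ∈ 𝔅 := h.alg.inter _ hC _ (hB k)
      have h1 : mu ((c + ε / 10) • ind (C ∩ B k)) ≤ mu (g * ind (C ∩ B k)) := by
        refine mu_mono fun m => ?_
        rw [smul_ap, mul_ap]
        by_cases hm : m ∈ C ∩ B k
        · rw [ind_mem hm, mul_one, mul_one]
          have h2 : c + ε / 5 < y m := by
            by_contra hh; exact (hsep m).2 (not_lt.1 hh) hm.1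
          have := abs_le.1 (hyg m hm.2)
          linarith [this.1]
        · rw [ind_not_mem hm, mul_zero, mul_zero]
      rw [map_smul, smul_eq_mul, step4' h Tt hT g hV hE] at h1
      have h0 := mu_ind_nonneg (C ∩ B k)
      have h2 : mu (ind (C ∩ B k)) = 0 := le_antisymm (by nlinarith) h0
      have h3 := h.pos _ hE h2
      have h4 : n ∈ C ∩ B k := ⟨(hsep n).1 (by linarith [hyn.1]), hn⟩
      rw [h3] at h4
      exact h4
    · obtain ⟨C, hC, hsep⟩ := WW_sep h.alg hyW (c := c - 2 * ε / 5) (d := c - ε / 5) (by linarith)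
      have hE : Cᶜ ∩ B k ∈ 𝔅 := h.alg.inter _ (h.alg.compl _ hC) _ (hB k)
      have h1 : mu (g * ind (Cᶜ ∩ B k)) ≤ mu ((c - ε / 10) • ind (Cᶜ ∩ B k)) := by
        refine mu_mono fun m => ?_
        rw [smul_ap, mul_ap]
        by_cases hm : m ∈ Cᶜ ∩ B k
        · rw [ind_mem hm, mul_one, mul_one]
          have h2 : y m < c - ε / 5 := by
            by_contra hh; exact hm.1 ((hsep m).1 (not_lt.1 hh))
          have := abs_le.1 (hyg m hm.2)
          linarith [this.2]
        · rw [ind_not_mem hm, mul_zero, mul_zero]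
      rw [map_smul, smul_eq_mul, step4' h Tt hT g hV hE] at h1
      have h0 := mu_ind_nonneg (Cᶜ ∩ B k)
      have h2 : mu (ind (Cᶜ ∩ B k)) = 0 := le_antisymm (by nlinarith) h0
      have h3 := h.pos _ hE h2
      have h4 : n ∈ Cᶜ ∩ B k := ⟨(hsep n).2 (by linarith [hyn.2]), hn⟩
      rw [h3] at h4
      exact h4
  have hfin : (Tt - c • ContinuousLinearMap.id ℝ EE) b = (Tt - mulE g) b + (g * b - c • b) := by
    simp only [ContinuousLinearMap.sub_apply, mulE_apply, ContinuousLinearMap.smul_apply, ContinuousLinearMap.id_apply]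
    abel
  rw [hfin]
  have hlast : ‖g * b - c • b‖ ≤ ε / 2 := by
    refine norm_le_of (by linarith) fun n => ?_
    rw [sub_ap, mul_ap, smul_ap]
    by_cases hn : n ∈ B k
    · rw [hb, ind_mem hn, mul_one, mul_one]; exact hgc n hn
    · rw [hb, ind_not_mem hn, mul_zero, mul_zero, sub_zero, abs_zero]; linarith
  refine (norm_add_le _ _).trans_lt ?_
  linarith
end
end SSX

namespace SSX

theorem ss_bound (l : EE →L[ℝ] ℝ) (hl : PosF l) {δ : ℝ} (hδ : 0 < δ) (V : Type) [AddCommGroup V] [Module ℝ V]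
    [FiniteDimensional ℝ V] (J : V →ₗ[ℝ] EE) (hJ : Function.Injective J)
    (hV : ∀ f : V, δ * ‖J f‖ ^ 2 ≤ l (J f * J f)) :
    (Module.finrank ℝ V : ℝ) ≤ δ⁻¹ * l 1 := by
  classical
  let B : LinearMap.BilinForm ℝ V := LinearMap.mk₂ ℝ (fun x y => l (J x * J y))
    (fun x y z => by rw [map_add, add_mul, map_add])
    (fun c x y => by rw [map_smul, smul_mul_assoc, map_smul])
    (fun x y z => by rw [map_add, mul_add, map_add])
    (fun c x y => by rw [map_smul, mul_smul_comm, map_smul])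
  have hBa : ∀ x y : V, B x y = l (J x * J y) := fun x y => rfl
  have hBs : LinearMap.IsSymm B := ⟨fun x y => by simp [hBa, mul_comm]⟩
  letI : Invertible (2:ℝ) := invertibleOfNonzero two_ne_zero
  obtain ⟨n, hn, v, hv⟩ : ∃ n, Module.finrank ℝ V = n ∧ ∃ v : Module.Basis (Fin n) ℝ V, B.IsOrthoᵢ v :=
    ⟨_, rfl, LinearMap.BilinForm.exists_orthogonal_basis (B := B) hBs⟩
  have hq : ∀ i, 0 < l (J (v i) * J (v i)) := fun i => by
    have h1 := hV (v i)
    have h2 : J (v i) ≠ 0 := fun h => v.ne_zero i (hJ (by rw [h, map_zero]))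
    have h3 : 0 < ‖J (v i)‖ := norm_pos_iff.2 h2
    have : 0 < δ * ‖J (v i)‖ ^ 2 := by positivity
    linarith
  have ho : ∀ i j, i ≠ j → l (J (v i) * J (v j)) = 0 := fun i j hij => hv hij
  set q : Fin n → ℝ := fun i => l (J (v i) * J (v i)) with hqd
  have key : ∀ w, ∑ i, (q i)⁻¹ * (J (v i) w) ^ 2 ≤ δ⁻¹ := by
    intro w
    set s := ∑ i, (q i)⁻¹ * (J (v i) w) ^ 2 with hs
    have hs0 : 0 ≤ s := Finset.sum_nonneg fun i _ => mul_nonneg (inv_nonneg.2 (hq i).le) (sq_nonneg _)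
    let a : Fin n → ℝ := fun i => (q i)⁻¹ * J (v i) w
    let x : V := ∑ i, a i • v i
    have hx : J x = ∑ i, a i • J (v i) := by simp [x]
    have hxw : J x w = s := by
      rw [hx, sum_ap, hs]
      refine Finset.sum_congr rfl fun i _ => ?_
      rw [smul_ap]; simp only [a]; ring
    have hB : B x x = s := by
      simp only [x, map_sum, LinearMap.sum_apply, map_smul, LinearMap.smul_apply, smul_eq_mul]
      rw [hs]
      refine Finset.sum_congr rfl fun i _ => ?_
      rw [Finset.sum_eq_single i]
      · rw [hBa]; change a i * (a i * q i) = _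
        simp only [a]
        have := (hq i).ne'
        change q i ≠ 0 at this
        field_simp
      · intro j _ hji
        rw [hBa, ho _ _ (by first | exact hji | exact hji.symm)]; ring
      · simp
    have h1 := hV x
    rw [← hBa, hB] at h1
    have h2 : s ≤ ‖J x‖ := by
      have := abs_le_norm (J x) w
      rw [hxw] at this
      exact (le_abs_self _).trans this
    rcases hs0.eq_or_lt with h0 | h0
    · rw [← h0]; positivity
    · have h3 : s ^ 2 ≤ ‖J x‖ ^ 2 := by gcongr
      have h4 : δ * s ^ 2 ≤ s := (mul_le_mul_of_nonneg_left h3 hδ.le).trans h1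
      rw [← one_div, le_div_iff₀ hδ]
      by_contra hc
      push Not at hc
      nlinarith
  have h1 : l (∑ i, (q i)⁻¹ • (J (v i) * J (v i))) = n := by
    rw [map_sum]
    simp only [map_smul, smul_eq_mul]
    rw [Finset.sum_congr rfl (fun i _ => inv_mul_cancel₀ (hq i).ne')]
    simp
  rw [hn, ← h1]
  have h2 : l (∑ i, (q i)⁻¹ • (J (v i) * J (v i))) ≤ l (δ⁻¹ • 1) := hl.mono fun w => by
    rw [sum_ap, smul_ap, one_ap, mul_one]
    refine le_trans (le_of_eq ?_) (key w)
    refine Finset.sum_congr rfl fun i _ => ?_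
    rw [smul_ap, mul_ap]; ring
  rwa [map_smul, smul_eq_mul] at h2

theorem ss_main {X : Type} [NormedAddCommGroup X] [NormedSpace ℝ X] (J : X →ₗᵢ[ℝ] EE)
    {𝔅 : Set (Set ℕ)} (h : IsAlg 𝔅) (hJW : ∀ x, J x ∈ WW h)
    (S : EE →L[ℝ] EE) (l : EE →L[ℝ] ℝ) (hl : PosF l) (hd : DomBy h S l)
    (M : Submodule ℝ X) (hM : ¬ FiniteDimensional ℝ M) :
    ¬ ∃ c : ℝ, 0 < c ∧ ∀ x ∈ M, c * ‖x‖ ≤ ‖S (J x)‖ := by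
  rintro ⟨c, hc, hb⟩
  obtain ⟨δ, hδ, hD⟩ := hd (c / 2) (by linarith)
  have hlow : ∀ x ∈ M, δ * ‖J x‖ ^ 2 ≤ l (J x * J x) := by
    intro x hx
    rcases eq_or_ne x 0 with rfl | hne
    · simp
    have hxp : 0 < ‖J x‖ := by rw [J.norm_map]; exact norm_pos_iff.2 hne
    by_contra hlt
    push Not at hlt
    have h5 : ‖x‖ = ‖J x‖ := (J.norm_map x).symm
    set r := ‖J x‖ with hr
    have h1 : ‖r⁻¹ • J x‖ = 1 := by
      rw [norm_smul, Real.norm_eq_abs, abs_of_pos (inv_pos.2 hxp), ← hr, inv_mul_cancel₀ hxp.ne']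
    have h2 : l ((r⁻¹ • J x) * (r⁻¹ • J x)) < δ := by
      rw [smul_mul_smul_comm, map_smul, smul_eq_mul, ← mul_inv, inv_mul_lt_iff₀ (by positivity)]
      nlinarith
    have h3 := hD (r⁻¹ • J x) (Submodule.smul_mem _ _ (hJW x)) h1.le h2
    rw [map_smul, norm_smul, Real.norm_eq_abs, abs_of_pos (inv_pos.2 hxp), inv_mul_le_iff₀ hxp] at h3
    have h4 := hb x hx
    rw [h5] at h4
    nlinarith
  obtain ⟨n, hn⟩ := exists_nat_gt (δ⁻¹ * l 1)
  let b := Module.Basis.ofVectorSpace ℝ M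
  have hinf : Infinite (Module.Basis.ofVectorSpaceIndex ℝ M) := by
    by_contra hfin
    rw [not_infinite_iff_finite] at hfin
    exact hM (Module.Finite.of_basis b)
  let e := Infinite.natEmbedding (Module.Basis.ofVectorSpaceIndex ℝ M)
  let u : Fin n → M := fun i => b (e i)
  have hu : LinearIndependent ℝ u :=
    b.linearIndependent.comp (fun i : Fin n => e i) (e.injective.comp Fin.val_injective)
  have hfr := finrank_span_eq_card hu
  haveI : FiniteDimensional ℝ (Submodule.span ℝ (Set.range u)) :=
    FiniteDimensional.span_of_finite ℝ (Set.finite_range u)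
  have := ss_bound l hl hδ (Submodule.span ℝ (Set.range u))
    (J.toLinearMap.comp (M.subtype.comp (Submodule.subtype _)))
    (fun x y hxy => Subtype.ext (Subtype.ext (J.injective hxy)))
    (fun f => hlow _ f.1.2)
  rw [hfr, Fintype.card_fin] at this
  linarith
end SSX

namespace SSX

theorem exists_ext0 {E : Type} [NormedAddCommGroup E] [NormedSpace ℝ E] (X : Submodule ℝ E) (T : X →L[ℝ] X)
    (e : ℕ → E →L[ℝ] ℝ) (he : ∀ n f, |e n f| ≤ ‖f‖) :
    ∃ K : ℝ, ∃ τ : ℕ → E →L[ℝ] ℝ, (∀ w, ∀ x : X, τ w x = e w (T x)) ∧ ∀ w f, |τ w f| ≤ K * ‖f‖ := by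
  have h1 : ∀ w, ∃ τ : E →L[ℝ] ℝ, (∀ x : X, τ x = e w (T x)) ∧ ∀ f, |τ f| ≤ ‖T‖ * ‖f‖ := by
    intro w
    let φ : X →L[ℝ] ℝ := (e w).comp (X.subtypeL.comp T)
    have hφ : ∀ x : X, φ x = e w (T x) := fun x => rfl
    obtain ⟨τ, h1, h2⟩ := _root_.exists_extension_norm_eq X φ
    refine ⟨τ, fun x => (h1 x).trans (hφ x), fun f => ?_⟩
    have h3 : ‖φ‖ ≤ ‖T‖ := φ.opNorm_le_bound T.opNorm_nonneg fun x => by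
      rw [hφ]
      exact (he w _).trans (T.le_opNorm x)
    have h4 := τ.le_opNorm f
    rw [h2] at h4
    exact h4.trans (mul_le_mul_of_nonneg_right h3 (norm_nonneg f))
  choose τ hτ hb using h1
  exact ⟨‖T‖, τ, hτ, hb⟩

theorem exists_ext (X : Submodule ℝ EE) (T : X →L[ℝ] X) :
    ∃ Tt : EE →L[ℝ] EE, ∀ x : X, Tt x = (T x : EE) := by
  obtain ⟨K, τ, hτ, hb⟩ := exists_ext0 (E := EE) X T ev (fun n f => abs_le_norm f n)
  let L : EE →ₗ[ℝ] EE :=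
    { toFun := fun f => mkE (fun w => τ w f) (K * ‖f‖) (fun w => hb w f)
      map_add' := fun f g => by ext w; simp
      map_smul' := fun c f => by ext w; simp }
  refine ⟨L.mkContinuous K fun f => norm_mkE_le _ _ (fun w => hb w f), fun x => ?_⟩
  ext w
  exact hτ w x

section
variable {𝔅 : Set (Set ℕ)}

theorem conv_close (h : IsAlg 𝔅) (S : EE →L[ℝ] EE) (l : EE →L[ℝ] ℝ) (hl : PosF l) (hd : DomBy h S l)
    (d : ℕ → EE) (hdX : ∀ n, d n ∈ WW h) (hd1 : ∀ n, ‖d n‖ ≤ 1) (y : EE)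
    (hy : ∀ w, Tendsto (fun n => S (d n) w) atTop (𝓝 (y w))) :
    y ∈ closure (Submodule.span ℝ (Set.range fun n => S (d n)) : Set EE) := by
  set C : ℕ → Set EE := fun n => convexHull ℝ (d '' Set.Ici n) with hC
  have hCanti : ∀ {n m}, n ≤ m → C m ⊆ C n := fun {n m} hnm =>
    convexHull_mono (Set.image_mono (Set.Ici_subset_Ici.2 hnm))
  have hCne : ∀ n, (C n).Nonempty := fun n => ⟨d n, subset_convexHull ℝ _ ⟨n, le_refl n, rfl⟩⟩
  have hCW : ∀ n, C n ⊆ WW h := fun n => convexHull_min (by rintro _ ⟨m, _, rfl⟩; exact hdX m) (WW h).convex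
  have hC1 : ∀ n, ∀ x ∈ C n, ‖x‖ ≤ 1 := fun n x hx => by
    have : C n ⊆ Metric.closedBall 0 1 :=
      convexHull_min (by rintro _ ⟨m, _, rfl⟩; simpa using hd1 m) (convex_closedBall 0 1)
    simpa using this hx
  have hCS : ∀ n, ∀ x ∈ C n, S x ∈ Submodule.span ℝ (Set.range fun n => S (d n)) := fun n x hx => by
    have : C n ⊆ ((Submodule.span ℝ (Set.range fun n => S (d n))).comap S.toLinearMap : Submodule ℝ EE) :=
      convexHull_min (by rintro _ ⟨m, _, rfl⟩; exact Submodule.subset_span ⟨m, rfl⟩) (Submodule.convex _)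
    exact this hx
  have hCw : ∀ w (ε : ℝ), 0 < ε → ∃ N, ∀ n ≥ N, ∀ x ∈ C n, |S x w - y w| ≤ ε := by
    intro w ε hε
    obtain ⟨N, hN⟩ := Metric.tendsto_atTop.1 (hy w) ε hε
    refine ⟨N, fun n hn x hx => ?_⟩
    have : C n ⊆ ((ev w).comp S).toLinearMap ⁻¹' (Metric.closedBall (y w) ε) :=
      convexHull_min (by rintro _ ⟨m, hm, rfl⟩; exact (hN m (le_trans hn hm)).le)
        ((convex_closedBall _ _).linear_preimage _)
    have := this hx
    exact this
  set Q : EE → ℝ := fun x => l (x * x) with hQ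
  have hQ0 : ∀ x, 0 ≤ Q x := fun x => hl _ fun n => by rw [mul_ap]; exact mul_self_nonneg _
  have hbdd : ∀ n, BddBelow (Q '' C n) := fun n => ⟨0, by rintro _ ⟨x, _, rfl⟩; exact hQ0 x⟩
  set q : ℕ → ℝ := fun n => sInf (Q '' C n) with hq
  have hqle : ∀ n, ∀ x ∈ C n, q n ≤ Q x := fun n x hx => csInf_le (hbdd n) ⟨x, hx, rfl⟩
  have hqm : Monotone q := fun n m hnm =>
    csInf_le_csInf (hbdd n) ((hCne m).image _) (Set.image_mono (hCanti hnm))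
  have hqb : BddAbove (Set.range q) := ⟨l 1, by
    rintro _ ⟨n, rfl⟩
    obtain ⟨x, hx⟩ := hCne n
    refine (hqle n x hx).trans (hl.mono fun w => ?_)
    rw [mul_ap, one_ap]
    have := (abs_le_norm x w).trans (hC1 n x hx)
    rw [← sq]; exact (sq_le_one_iff_abs_le_one _).2 this⟩
  set qq := ⨆ n, q n with hqq
  have hqlim : Tendsto q atTop (𝓝 qq) := tendsto_atTop_ciSup hqm hqb
  have hqq' : ∀ n, q n ≤ qq := fun n => le_ciSup hqb n
  have hx : ∀ n : ℕ, ∃ x ∈ C n, Q x < q n + 1 / ((n:ℝ) + 1) := fun n => by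
    obtain ⟨_, ⟨x, hx, rfl⟩, h2⟩ := exists_lt_of_csInf_lt ((hCne n).image Q)
      (show sInf (Q '' C n) < q n + 1 / ((n:ℝ) + 1) from lt_add_of_pos_right _ (by positivity))
    exact ⟨x, hx, h2⟩
  choose x hxC hxQ using hx
  have hpar : ∀ n m, n ≤ m → Q ((1/2:ℝ) • (x n - x m)) ≤ (qq - q n) + 1 / ((n:ℝ) + 1) := by
    intro n m hnm
    have hmid : (1/2:ℝ) • x n + (1/2:ℝ) • x m ∈ C n :=
      (convex_convexHull ℝ _) (hxC n) (hCanti hnm (hxC m)) (by norm_num) (by norm_num) (by norm_num)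
    have h1 := hqle n _ hmid
    have h2 : Q ((1/2:ℝ) • (x n - x m)) + Q ((1/2:ℝ) • x n + (1/2:ℝ) • x m) = (1/2) * (Q (x n) + Q (x m)) := by
      simp only [hQ]
      rw [← map_add, ← map_add, ← smul_eq_mul (1/2:ℝ) (l _), ← map_smul]
      congr 1
      ext w
      simp only [add_ap, mul_ap, smul_ap, sub_ap]
      ring
    have h3 := hxQ n
    have h4 := hxQ m
    have h5 : 1 / ((m:ℝ) + 1) ≤ 1 / ((n:ℝ) + 1) := by gcongr
    have h6 := hqq' m
    have h7 := hqq' n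
    linarith
  have hlim0 : Tendsto (fun n : ℕ => (qq - q n) + 1 / ((n:ℝ) + 1)) atTop (𝓝 0) := by
    have := (tendsto_const_nhds (x := qq)).sub hqlim
    have := this.add tendsto_one_div_add_atTop_nhds_zero_nat
    simpa using this
  have hcau : CauchySeq fun n => S (x n) := by
    rw [Metric.cauchySeq_iff']
    intro ε hε
    obtain ⟨δ, hδ, hD⟩ := hd (ε / 4) (by linarith)
    obtain ⟨N, hN⟩ := (hlim0.eventually (gt_mem_nhds hδ)).exists
    refine ⟨N, fun n hn => ?_⟩
    have h1 := hD ((1/2:ℝ) • (x N - x n))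
      (Submodule.smul_mem _ _ (sub_mem (hCW _ (hxC N)) (hCW _ (hxC n)))) (by
        rw [norm_smul, Real.norm_eq_abs, abs_of_pos (by norm_num)]
        have := norm_sub_le (x N) (x n)
        have := hC1 _ _ (hxC N)
        have := hC1 _ _ (hxC n)
        linarith) ((hpar N n hn).trans_lt hN)
    rw [map_smul, norm_smul, Real.norm_eq_abs, abs_of_pos (by norm_num), map_sub] at h1
    rw [dist_comm, dist_eq_norm]
    linarith
  obtain ⟨z, hz⟩ := cauchySeq_tendsto_of_complete hcau
  have hzy : z = y := by
    ext w
    have h1 : Tendsto (fun n => S (x n) w) atTop (𝓝 (z w)) := ((ev w).continuous.tendsto z).comp hz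
    refine tendsto_nhds_unique h1 ?_
    rw [Metric.tendsto_atTop]
    intro ε hε
    obtain ⟨N, hN⟩ := hCw w (ε / 2) (by linarith)
    refine ⟨N, fun n hn => ?_⟩
    rw [Real.dist_eq]
    have := hN n hn _ (hxC n)
    linarith
  rw [← hzy]
  exact mem_closure_of_tendsto hz (Eventually.of_forall fun n => hCS n _ (hxC n))

theorem sep_main (h : IsAlg 𝔅) (S : EE →L[ℝ] EE) (l : EE →L[ℝ] ℝ) (hl : PosF l) (hd : DomBy h S l) :
    TopologicalSpace.IsSeparable (S '' (XX h : Set EE)) := by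
  set K : Set EE := {f | f ∈ WW h ∧ ‖f‖ ≤ 1} with hK
  let Φ : EE → (ℕ → ℝ) := fun f w => S f w
  obtain ⟨D0, hD0s, hD0c, hD0d⟩ :=
    (TopologicalSpace.IsSeparable.of_separableSpace (Φ '' K)).exists_countable_dense_subset
  obtain ⟨D, hDK, hDc, hDeq⟩ : ∃ D : Set EE, D ⊆ K ∧ D.Countable ∧ Φ '' D = D0 := by
    choose! F hFK hF using (fun p hp => hD0s hp : ∀ p ∈ D0, ∃ f, f ∈ K ∧ Φ f = p)
    refine ⟨F '' D0, by rintro _ ⟨p, hp, rfl⟩; exact hFK p hp, hD0c.image F, ?_⟩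
    ext p
    constructor
    · rintro ⟨_, ⟨r, hr, rfl⟩, rfl⟩; rw [hF r hr]; exact hr
    · intro hp; exact ⟨F p, ⟨p, hp, rfl⟩, hF p hp⟩
  have hsepD : TopologicalSpace.IsSeparable
      (closure (Submodule.span ℝ (S '' D) : Set EE)) :=
    ((hDc.image S).isSeparable.span).closure
  refine hsepD.mono ?_
  have hball : ∀ f ∈ K, S f ∈ closure (Submodule.span ℝ (S '' D) : Set EE) := by
    intro f hf
    have h1 : Φ f ∈ closure (Φ '' D) := hDeq ▸ hD0d ⟨f, hf, rfl⟩
    obtain ⟨u, hu, hut⟩ := mem_closure_iff_seq_limit.1 h1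
    choose d hdD hdu using hu
    have h2 := conv_close h S l hl hd d (fun n => (hDK (hdD n)).1) (fun n => (hDK (hdD n)).2) (S f)
      (fun w => by
        have := (tendsto_pi_nhds.1 hut) w
        simpa only [← hdu] using this)
    refine closure_mono (Submodule.span_mono ?_) h2
    rintro _ ⟨n, rfl⟩
    exact ⟨d n, hdD n, rfl⟩
  rintro _ ⟨f, hf, rfl⟩
  have hr : 0 < ‖f‖ + 1 := by positivity
  have h1 := hball ((‖f‖ + 1)⁻¹ • f) ⟨Submodule.smul_mem _ _ (XX_le_WW h hf), by
    rw [norm_smul, Real.norm_eq_abs, abs_of_pos (inv_pos.2 hr), inv_mul_le_iff₀ hr]; linarith⟩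
  have h2 := (Submodule.span ℝ (S '' D)).topologicalClosure.smul_mem (‖f‖ + 1) h1
  rw [map_smul, smul_smul, mul_inv_cancel₀ hr.ne', one_smul] at h2
  exact h2
end

theorem final : ∃ (X : Type) (_ : NormedAddCommGroup X) (_ : NormedSpace ℝ X),
      CompleteSpace X ∧ ¬ TopologicalSpace.SeparableSpace X ∧
      ∀ T : X →L[ℝ] X, ∃ (lam : ℝ) (S : X →L[ℝ] X),
        (∀ M : Submodule ℝ X, ¬ FiniteDimensional ℝ M →
    ¬ ∃ c : ℝ, 0 < c ∧ ∀ x ∈ M, c * ‖x‖ ≤ ‖S x‖) ∧ TopologicalSpace.IsSeparable (Set.range S) ∧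
        T = lam • ContinuousLinearMap.id ℝ X + S := by
  obtain ⟨𝔅, h⟩ := exists_good
  refine ⟨XX h.alg, inferInstance, inferInstance, (XX_closed h.alg).completeSpace_coe, nonsep h, fun T => ?_⟩
  obtain ⟨Tt, hTt⟩ := exists_ext (XX h.alg) T
  have hTX : ∀ x ∈ XX h.alg, Tt x ∈ XX h.alg := fun x hx => by
    have := hTt ⟨x, hx⟩
    change Tt x = _ at this
    rw [this]; exact (T ⟨x, hx⟩).2
  obtain ⟨g, hg⟩ := exists_mult h Tt fun x hx => XX_le_WW _ (hTX x hx)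
  have hV := step5 h Tt hTX g hg
  obtain ⟨l, hl, hd⟩ := dom h.alg _ hV
  set S' := Tt - mu g • ContinuousLinearMap.id ℝ EE with hS'
  have hS : ∀ x : XX h.alg, ((T - mu g • ContinuousLinearMap.id ℝ (XX h.alg)) x : EE) = S' (x:EE) := by
    intro x
    simp [hS', hTt]
  refine ⟨mu g, T - mu g • ContinuousLinearMap.id ℝ (XX h.alg), fun M hM hc => ?_, ?_, (add_sub_cancel _ _).symm⟩
  · obtain ⟨c, hc0, hc⟩ := hc
    refine ss_main (XX h.alg).subtypeₗᵢ h.alg (fun x => XX_le_WW _ x.2) S' l hl hd M hM ⟨c, hc0, fun x hx => ?_⟩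
    change _ ≤ ‖S' (x:EE)‖
    rw [← hS]
    exact hc x hx
  · have h1 := sep_main h.alg S' l hl hd
    have h2 : Set.range (T - mu g • ContinuousLinearMap.id ℝ (XX h.alg)) ⊆
        ((↑) : XX h.alg → EE) ⁻¹' (S' '' (XX h.alg : Set EE)) := by
      rintro _ ⟨x, rfl⟩
      exact ⟨x, x.2, (hS x).symm⟩
    refine TopologicalSpace.IsSeparable.mono ?_ h2
    exact Topology.IsInducing.subtypeVal.isSeparable_preimage h1
end SSX

theorem stmt_4 :
    ∃ (X : Type) (_ : NormedAddCommGroup X) (_ : NormedSpace ℝ X),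
      CompleteSpace X ∧ ¬ TopologicalSpace.SeparableSpace X ∧
      ∀ T : X →L[ℝ] X, ∃ (lam : ℝ) (S : X →L[ℝ] X),
        StrictlySingular S ∧ TopologicalSpace.IsSeparable (Set.range S) ∧
        T = lam • ContinuousLinearMap.id ℝ X + S := by
  exact SSX.final
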